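/- Let H be a nearest-neighbor one-dimensional SFT over Fin k presented by a finite directed graph G = (Fin k, E) in which every vertex has at least one outgoing and one incoming edge. The predicate, defined on finite sets F of forbidden words over Fin k (each such F encoding the one-dimensional SFT V of sequences avoiding the words of F), asserting that the combined subshift X_{H,V} is nonempty, is a ComputablePred if and only if G satisfies condition D. -/

import Mathlib

open Filter

/-- Shift on one-dimensional configurations: `(shift1 p x) k = x (k - p)`. -/
def shift1 {A : Type*} (p : ℤ) (x : ℤ → A) : ℤ → A := fun k => x (k - p)

/-- Shift on two-dimensional configurations: `(shift2 v x) k = x (k - v)`. -/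
def shift2 {A : Type*} (v : ℤ × ℤ) (x : ℤ × ℤ → A) : ℤ × ℤ → A := fun k => x (k - v)

/-- The finite word `w` occurs in the bi-infinite sequence `x`. -/
def occursIn1 {A : Type*} (w : List A) (x : ℤ → A) : Prop :=
  ∃ i : ℤ, ∀ (n : ℕ) (h : n < w.length), x (i + n) = w.get ⟨n, h⟩

/-- The one-dimensional SFT avoiding the finite set `F` of forbidden words. -/
def SFT1 {A : Type*} (F : Finset (List A)) : Set (ℤ → A) :=
  {x | ∀ w ∈ F, ¬ occursIn1 w x}

/-- `H` is a one-dimensional subshift of finite type. -/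
def IsSFT1 {A : Type*} (H : Set (ℤ → A)) : Prop :=
  ∃ F : Finset (List A), H = SFT1 F

/-- A finite two-dimensional pattern: a finite support together with values. -/
structure Pattern2 (A : Type*) where
  support : Finset (ℤ × ℤ)
  val : ℤ × ℤ → A

/-- The pattern `p` occurs in the configuration `x`. -/
def Pattern2.OccursIn {A : Type*} (p : Pattern2 A) (x : ℤ × ℤ → A) : Prop :=
  ∃ v : ℤ × ℤ, ∀ u ∈ p.support, x (u + v) = p.val u

/-- The two-dimensional SFT avoiding the finite set `F` of forbidden patterns. -/
def SFT2 {A : Type*} (F : Finset (Pattern2 A)) : Set (ℤ × ℤ → A) :=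
  {x | ∀ p ∈ F, ¬ p.OccursIn x}

/-- The SFT `X_F` with added horizontal constraints from `H`: every row lies in `H`
and no pattern of `F` occurs. -/
def XHF {A : Type*} (H : Set (ℤ → A)) (F : Finset (Pattern2 A)) : Set (ℤ × ℤ → A) :=
  {x | (∀ j : ℤ, (fun k => x (k, j)) ∈ H) ∧ ∀ p ∈ F, ¬ p.OccursIn x}

/-- The combined subshift: rows in `H`, columns in `V`. -/
def XHV {A : Type*} (H V : Set (ℤ → A)) : Set (ℤ × ℤ → A) :=
  {x | (∀ j : ℤ, (fun k => x (k, j)) ∈ H) ∧ ∀ i : ℤ, (fun l => x (i, l)) ∈ V}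

/-- Number of restrictions of elements of `X` to `[0,m) × [0,n)`. -/
noncomputable def patCount2 {A : Type*} (X : Set (ℤ × ℤ → A)) (m n : ℕ) : ℕ :=
  Set.ncard {p : Fin m → Fin n → A |
    ∃ x ∈ X, ∀ (i : Fin m) (j : Fin n), x ((i : ℤ), (j : ℤ)) = p i j}

/-- Topological entropy of a two-dimensional subshift. -/
noncomputable def entropy2 {A : Type*} (X : Set (ℤ × ℤ → A)) : ℝ :=
  ⨅ n : ℕ, Real.logb 2 (patCount2 X (n + 1) (n + 1)) / ((n : ℝ) + 1) ^ 2

/-- The word `w` belongs to the language of `H`. -/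
def wordIn {A : Type*} (H : Set (ℤ → A)) (w : List A) : Prop :=
  ∃ x ∈ H, occursIn1 w x

/-- Number of length-`n` words in the language of `H`. -/
noncomputable def wordCount {A : Type*} (H : Set (ℤ → A)) (n : ℕ) : ℕ :=
  Set.ncard {w : List A | w.length = n ∧ wordIn H w}

/-- Topological entropy of a one-dimensional subshift. -/
noncomputable def entropy1 {A : Type*} (H : Set (ℤ → A)) : ℝ :=
  ⨅ n : ℕ, Real.logb 2 (wordCount H (n + 1)) / ((n : ℝ) + 1)

/-- `X` is a two-dimensional subshift (closed and shift-invariant). -/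
def IsSubshift2 {A : Type*} [TopologicalSpace A] (X : Set (ℤ × ℤ → A)) : Prop :=
  IsClosed X ∧ ∀ (v : ℤ × ℤ) (x : ℤ × ℤ → A), x ∈ X → shift2 v x ∈ X

/-- `X` is an `(m,n)`-th root of `Y`. -/
def IsRoot {A B : Type*} [TopologicalSpace A] [TopologicalSpace B]
    (X : Set (ℤ × ℤ → A)) (Y : Set (ℤ × ℤ → B)) (m n : ℕ) : Prop :=
  ∃ Z : Set (ℤ × ℤ → A), Z ⊆ X ∧ IsClopen {x : X | (x : ℤ × ℤ → A) ∈ Z} ∧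
    shift2 ((m : ℤ), 0) '' Z = Z ∧ shift2 (0, (n : ℤ)) '' Z = Z ∧
    (∃ φ : Z ≃ₜ Y,
      ∀ (x : Z) (k₁ k₂ : ℤ)
        (hx : shift2 (k₁ * (m : ℤ), k₂ * (n : ℤ)) (x : ℤ × ℤ → A) ∈ Z),
        (φ ⟨shift2 (k₁ * (m : ℤ), k₂ * (n : ℤ)) (x : ℤ × ℤ → A), hx⟩ : ℤ × ℤ → B) =
          shift2 (k₁, k₂) (φ x : ℤ × ℤ → B)) ∧
    (∀ i j : ℕ, i < m → j < n → shift2 ((i : ℤ), (j : ℤ)) '' Z ⊆ X) ∧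
    ∀ x ∈ X, ∃! q : Fin m × Fin n, x ∈ shift2 ((q.1 : ℤ), (q.2 : ℤ)) '' Z

/-- The vertex shift (nearest-neighbor SFT) of a directed graph on `A`. -/
def vertexShift {A : Type*} (E : A → A → Prop) : Set (ℤ → A) :=
  {x | ∀ i : ℤ, E (x i) (x (i + 1))}

/-- Strongly connected component: a maximal nonempty set whose vertices are pairwise
joined by nonempty directed paths. -/
def IsSCC {A : Type*} (E : A → A → Prop) (S : Set A) : Prop :=
  S.Nonempty ∧ (∀ a ∈ S, ∀ b ∈ S, Relation.TransGen E a b) ∧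
    ∀ T : Set A, S ⊆ T → (∀ a ∈ T, ∀ b ∈ T, Relation.TransGen E a b) → T = S

def ReflexiveType {A : Type*} (E : A → A → Prop) (S : Set A) : Prop :=
  ∀ v ∈ S, E v v

def SymmetricType {A : Type*} (E : A → A → Prop) (S : Set A) : Prop :=
  ∀ v ∈ S, ∀ w ∈ S, v ≠ w → E v w → E w v

def StateSplitType {A : Type*} (E : A → A → Prop) (S : Set A) : Prop :=
  ∃ p : ℕ, 0 < p ∧ ∃ f : A → ZMod p,
    (∀ i : ZMod p, ∃ v ∈ S, f v = i) ∧
    ∀ v ∈ S, ∀ w ∈ S, (E v w ↔ f w = f v + 1)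

/-- Condition D: all SCCs share one of the three types. -/
def ConditionD {A : Type*} (E : A → A → Prop) : Prop :=
  (∀ S : Set A, IsSCC E S → ReflexiveType E S) ∨
  (∀ S : Set A, IsSCC E S → SymmetricType E S) ∨
  (∀ S : Set A, IsSCC E S → StateSplitType E S)

/-- A real is Π₁-computable (right-recursively enumerable). -/
def Pi1Computable (x : ℝ) : Prop :=
  ∃ f : ℕ → ℚ, Computable f ∧ Antitone f ∧
    Tendsto (fun n => (f n : ℝ)) atTop (nhds x)

/-- A computable real number. -/
def IsComputableReal (x : ℝ) : Prop :=
  ∃ f : ℕ → ℚ, Computable f ∧ ∀ n : ℕ, |(f n : ℝ) - x| ≤ (2 : ℝ) ^ (-(n : ℤ))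

/-- `w` is a finite concatenation of copies of `w₁` and `w₂`. -/
def IsConcat {A : Type*} (w₁ w₂ w : List A) : Prop :=
  ∃ L : List (List A), (∀ v ∈ L, v = w₁ ∨ v = w₂) ∧ w = L.flatten

/-- Transitivity of a one-dimensional subshift. -/
def Transitive1 {A : Type*} (H : Set (ℤ → A)) : Prop :=
  ∀ u w : List A, wordIn H u → wordIn H w → ∃ v : List A, wordIn H (u ++ v ++ w)

/-- The subshift of elements of `H` avoiding the word `u`. -/
def avoidWord {A : Type*} (H : Set (ℤ → A)) (u : List A) : Set (ℤ → A) :=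
  {x ∈ H | ¬ occursIn1 u x}

namespace CombinedSubshift

/-- `Walk E n x y`: there is a path of length `n` from `x` to `y`. -/
def Walk {V : Type*} (E : V → V → Prop) : ℕ → V → V → Prop
  | 0, x, y => x = y
  | n + 1, x, y => ∃ z, Walk E n x z ∧ E z y

section Walk

variable {V : Type*} {E : V → V → Prop}

theorem Walk.trans {m n : ℕ} {x y z : V} (h : Walk E m x y) (h' : Walk E n y z) :
    Walk E (m + n) x z := by
  induction n generalizing z with
  | zero => cases h'; exact h
  | succ n ih => obtain ⟨t, ht, hE⟩ := h'; exact ⟨t, ih ht, hE⟩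

theorem Walk.single {x y : V} (h : E x y) : Walk E 1 x y := ⟨x, rfl, h⟩

theorem Walk.head {n : ℕ} {x y z : V} (h : E x y) (h' : Walk E n y z) :
    Walk E (n + 1) x z := by
  rw [add_comm]; exact (Walk.single h).trans h'

theorem Walk.split {m n : ℕ} {x z : V} (h : Walk E (m + n) x z) :
    ∃ y, Walk E m x y ∧ Walk E n y z := by
  induction n generalizing z with
  | zero => exact ⟨z, h, rfl⟩
  | succ n ih =>
    obtain ⟨t, ht, hE⟩ := h
    obtain ⟨y, h1, h2⟩ := ih ht
    exact ⟨y, h1, t, h2, hE⟩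

theorem Walk.exists_path {n : ℕ} {x y : V} (h : Walk E n x y) :
    ∃ w : ℕ → V, w 0 = x ∧ w n = y ∧ ∀ i < n, E (w i) (w (i + 1)) := by
  induction n generalizing y with
  | zero => cases h; exact ⟨fun _ => x, rfl, rfl, by simp⟩
  | succ n ih =>
    obtain ⟨z, hz, hE⟩ := h
    obtain ⟨w, h0, hn, hw⟩ := ih hz
    refine ⟨fun i => if i = n + 1 then y else w i, by simp [h0], by simp, fun i hi => ?_⟩
    have h1 : i ≠ n + 1 := by omega
    by_cases h2 : i = n
    · subst h2; simp [hn, hE]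
    · simp [h1, h2, hw i (by omega)]

theorem Walk.swap {n : ℕ} {x y : V} (h : Walk E n x y) : Walk (Function.swap E) n y x := by
  induction n generalizing y with
  | zero => exact Eq.symm h
  | succ n ih => obtain ⟨z, hz, hE⟩ := h; exact Walk.head (E := Function.swap E) hE (ih hz)

theorem Walk.unswap {n : ℕ} {x y : V} (h : Walk (Function.swap E) n x y) : Walk E n y x :=
  h.swap

theorem exists_walk_of_transGen {x y : V} (h : Relation.TransGen E x y) :
    ∃ n, 0 < n ∧ Walk E n x y := by
  induction h with
  | single h => exact ⟨1, one_pos, Walk.single h⟩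
  | tail _ h ih => obtain ⟨n, _, hn⟩ := ih; exact ⟨n + 1, by omega, _, hn, h⟩

end Walk

/-- Cyclic classes of a finite strongly connected graph, with a uniform bound beyond which all
walks compatible with the classes exist. -/
structure CyclicClasses {V : Type*} (E : V → V → Prop) where
  p : ℕ
  hp : 0 < p
  f : V → ZMod p
  n0 : ℕ
  edge : ∀ x y, E x y → f y = f x + 1
  walk : ∀ n, n0 ≤ n → ∀ x y, f y = f x + n → Walk E n x y

theorem CyclicClasses.walk_eq {V : Type*} {E : V → V → Prop} (c : CyclicClasses E) {n : ℕ} {x y : V}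
    (h : Walk E n x y) : c.f y = c.f x + n := by
  induction n generalizing y with
  | zero => cases h; simp
  | succ n ih =>
    obtain ⟨z, hz, hE⟩ := h
    rw [c.edge _ _ hE, ih hz]; push_cast; ring

def CyclicClasses.swap {V : Type*} {E : V → V → Prop} (c : CyclicClasses E) :
    CyclicClasses (Function.swap E) where
  p := c.p
  hp := c.hp
  f := fun x => - c.f x
  n0 := c.n0
  edge := fun x y h => by rw [c.edge _ _ h]; ring
  walk := fun n hn x y h => Walk.swap (c.walk n hn y x (by
    have h' := congrArg (fun t => -t) h
    simp only [neg_neg, neg_add] at h'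
    rw [h']; ring))

theorem exists_cyclicClasses {V : Type*} [Finite V] [Nonempty V] (E : V → V → Prop)
    (hc : ∀ x y, Relation.TransGen E x y) : Nonempty (CyclicClasses E) := by
  classical
  obtain ⟨v0⟩ := ‹Nonempty V›
  let s : AddSubmonoid ℕ :=
    { carrier := {n | Walk E n v0 v0}
      zero_mem' := rfl
      add_mem' := fun ha hb => Walk.trans ha hb }
  have hs : ∀ n, n ∈ s ↔ Walk E n v0 v0 := fun n => Iff.rfl
  set p := Nat.setGcd (s : Set ℕ) with hp
  choose b _ hb using fun y => exists_walk_of_transGen (hc v0 y)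
  choose a _ ha using fun y => exists_walk_of_transGen (hc y v0)
  have hdvd : ∀ n, Walk E n v0 v0 → p ∣ n := fun n hn => Nat.setGcd_dvd_of_mem (s := (s : Set ℕ)) hn
  have hp0 : 0 < p := by
    obtain ⟨n, hn, hw⟩ := exists_walk_of_transGen (hc v0 v0)
    exact Nat.pos_of_dvd_of_pos (hdvd n hw) hn
  have hwd : ∀ y n, Walk E n v0 y → (n : ZMod p) = - (a y : ZMod p) := fun y n hn => by
    have := hdvd _ (hn.trans (ha y))
    rw [← ZMod.natCast_eq_zero_iff] at this
    push_cast at this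
    exact eq_neg_of_add_eq_zero_left this
  obtain ⟨n1, hn1⟩ := Nat.exists_mem_closure_of_ge (s : Set ℕ)
  rw [AddSubmonoid.closure_eq] at hn1
  obtain ⟨A, hA⟩ := (Set.finite_range a).bddAbove
  obtain ⟨B, hB⟩ := (Set.finite_range b).bddAbove
  refine ⟨⟨p, hp0, fun y => (b y : ZMod p), n1 + A + B, fun x y h => ?_, fun n hn x y h => ?_⟩⟩
  · have h1 := hwd y (b x + 1) ⟨x, hb x, h⟩
    rw [hwd y _ (hb y), ← h1]; push_cast; rfl
  · have hax : a x ≤ A := hA ⟨x, rfl⟩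
    have hby : b y ≤ B := hB ⟨y, rfl⟩
    have h2 : n - a x - b y ∈ s := by
      apply hn1 _ (by omega)
      rw [← ZMod.natCast_eq_zero_iff, Nat.cast_sub (by omega), Nat.cast_sub (by omega)]
      rw [h, hwd x _ (hb x)]; ring
    have h3 := ((ha x).trans h2).trans (hb y)
    have h4 : a x + (n - a x - b y) + b y = n := by omega
    rwa [h4] at h3

/-- If all phase-compatible pairs are edges, then the graph is a blown-up cycle. -/
theorem CyclicClasses.exists_split {V : Type*} {E : V → V → Prop} [Nonempty V]
    (c : CyclicClasses E) (hout : ∀ x, ∃ y, E x y)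
    (h : ∀ x y, c.f y = c.f x + 1 → E x y) :
    ∃ p : ℕ, 0 < p ∧ ∃ f : V → ZMod p, (∀ i, ∃ v, f v = i) ∧
      ∀ v w, E v w ↔ f w = f v + 1 := by
  refine ⟨c.p, c.hp, c.f, fun i => ?_, fun v w => ⟨c.edge v w, h v w⟩⟩
  obtain ⟨v0⟩ := ‹Nonempty V›
  have key : ∀ n : ℕ, ∃ v, c.f v = c.f v0 + n := fun n => by
    induction n with
    | zero => exact ⟨v0, by simp⟩
    | succ n ih =>
      obtain ⟨v, hv⟩ := ih
      obtain ⟨y, hy⟩ := hout v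
      exact ⟨y, by rw [c.edge _ _ hy, hv]; push_cast; ring⟩
  have : NeZero c.p := ⟨c.hp.ne'⟩
  obtain ⟨v, hv⟩ := key (i - c.f v0).val
  exact ⟨v, by rw [hv, ZMod.natCast_zmod_val]; ring⟩


section Split

variable {V : Type*} {E : V → V → Prop}

theorem Walk.iterate_of_imp {d : ℕ} (h : ∀ x y, Walk E (d + 1) x y → E x y) (m : ℕ) {x y : V}
    (hw : Walk E (1 + m * d) x y) : E x y := by
  induction m generalizing x y with
  | zero =>
    rw [zero_mul, add_zero] at hw
    obtain ⟨z, hz, hE⟩ := hw; cases hz; exact hE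
  | succ m ih =>
    have e : 1 + (m + 1) * d = (1 + m * d) + d := by ring
    rw [e] at hw
    obtain ⟨z, h1, h2⟩ := hw.split
    exact h _ _ (Walk.head (ih h1) h2)

theorem CyclicClasses.edge_of_walk (c : CyclicClasses E) {d : ℕ} (hd : 2 ≤ d)
    (h : ∀ x y, Walk E d x y → E x y) (x y : V) (hxy : c.f y = c.f x + 1) : E x y := by
  obtain ⟨d, rfl⟩ : ∃ e, d = e + 1 := ⟨d - 1, by omega⟩
  refine Walk.iterate_of_imp h (c.p * c.n0) (c.walk _ ?_ x y ?_)
  · have : 1 * c.n0 * 1 ≤ c.p * c.n0 * d := by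
      gcongr
      · exact c.hp
      · omega
    omega
  · rw [hxy]; push_cast; rw [ZMod.natCast_self]; ring

theorem Walk.iterate_reverse {d : ℕ} (h : ∀ x y, Walk E d y x → E x y) (m : ℕ) {x y : V}
    (hw : Walk E (m * d) y x) : Walk E m x y := by
  induction m generalizing x y with
  | zero => rw [zero_mul] at hw; exact Eq.symm hw
  | succ m ih =>
    rw [add_mul, one_mul] at hw
    obtain ⟨z, h1, h2⟩ := hw.split
    exact Walk.head (h _ _ h2) (ih h1)

theorem CyclicClasses.exists_far_nonedge (c : CyclicClasses E) {M d : ℕ} (hM : 2 * c.n0 ≤ M)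
    (hpM : c.p ∣ M) (h2 : 2 ≤ d) (hd : d + 2 ≤ M)
    (hn : ∃ x y, c.f y = c.f x + 1 ∧ ¬ E x y) :
    ∃ x y, Walk E d x y ∧ Walk E (M - d) y x ∧ ¬ E x y := by
  by_contra! hcon
  obtain ⟨x0, y0, hf, hne⟩ := hn
  have hMz : (M : ZMod c.p) = 0 := (ZMod.natCast_eq_zero_iff _ _).2 hpM
  apply hne
  by_cases hl : c.n0 ≤ M - d
  · refine c.edge_of_walk h2 (fun x y h => hcon x y h (c.walk _ hl _ _ ?_)) _ _ hf
    rw [c.walk_eq h, Nat.cast_sub (by omega), hMz]; ring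
  · have h' : ∀ x y, Walk E (M - d) y x → E x y := fun x y h => by
      refine hcon x y (c.walk _ (by omega) _ _ ?_) h
      rw [c.walk_eq h, Nat.cast_sub (by omega), hMz]; ring
    refine c.edge_of_walk (d := (M - d) * (M - d)) ?_ (fun x y h => ?_) _ _ hf
    · have : 2 ≤ M - d := by omega
      nlinarith
    · exact h' _ _ (Walk.iterate_reverse h' _ h)

theorem CyclicClasses.exists_near_nonedge (c : CyclicClasses E) {j : ℕ} (hj : 1 ≤ j)
    (hn : ∃ x y, c.f y = c.f x + 1 ∧ ¬ E x y) :
    ∃ g x y, Walk E j g x ∧ Walk E (j + 1) g y ∧ ¬ E x y := by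
  by_contra! hcon
  obtain ⟨x0, y0, hf, hne⟩ := hn
  apply hne
  have key : ∀ n, j ≤ n → ∀ g x y, Walk E n g x → Walk E (n + 1) g y → E x y := by
    intro n hn
    induction n, hn using Nat.le_induction with
    | base => exact hcon
    | succ n hn ih =>
      intro g x y hx hy
      obtain ⟨n, rfl⟩ : ∃ m, n = m + 1 := ⟨n - 1, by omega⟩
      rw [add_comm] at hx
      obtain ⟨g1, hg1, hx⟩ := hx.split
      obtain ⟨y', hy', hE⟩ := hy
      obtain ⟨z, hz, hzx⟩ := hx
      have hE' : E z y' := ih g z y' (by rw [add_comm]; exact hg1.trans hz) hy'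
      exact ih g1 x y ⟨z, hz, hzx⟩ ⟨y', ⟨z, hz, hE'⟩, hE⟩
  have hle : max j c.n0 ≤ c.p * max j c.n0 := Nat.le_mul_of_pos_left _ c.hp
  have h0 : ((c.p * max j c.n0 : ℕ) : ZMod c.p) = 0 := by simp
  refine key (c.p * max j c.n0) ((le_max_left _ _).trans hle) x0 x0 y0 ?_ ?_
  · exact c.walk _ ((le_max_right _ _).trans hle) _ _ (by rw [h0, add_zero])
  · refine c.walk _ (by have := le_max_right j c.n0; omega) _ _ ?_
    rw [Nat.cast_add, h0, hf]; simp

end Split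

/-- A closed walk of length `M`, unrolled periodically. -/
def ClosedWalk {K : Type*} (E : K → K → Prop) (M : ℕ) (w : ℕ → K) : Prop :=
  (∀ i, E (w i) (w (i + 1))) ∧ ∀ i, w (i + M) = w i

theorem ClosedWalk.mod {K : Type*} {E : K → K → Prop} {M : ℕ} {w : ℕ → K} (h : ClosedWalk E M w)
    (i : ℕ) : w (i % M) = w i := by
  have : ∀ n j, w (j + M * n) = w j := fun n j => by
    induction n with
    | zero => simp
    | succ n ih => rw [Nat.mul_succ, ← add_assoc, h.2, ih]
  conv_rhs => rw [← Nat.mod_add_div i M]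
  exact (this _ _).symm

theorem ClosedWalk.of_path {K : Type*} {E : K → K → Prop} {M : ℕ} (hM : 0 < M) {w : ℕ → K}
    (h : ∀ i < M, E (w i) (w (i + 1))) (h0 : w M = w 0) :
    ClosedWalk E M (fun i => w (i % M)) := by
  refine ⟨fun i => ?_, fun i => by simp⟩
  have hi := Nat.mod_lt i hM
  have := h _ hi
  by_cases hl : i % M + 1 = M
  · have h2 : (i + 1) % M = 0 := by
      have e := Nat.mod_add_div i M
      have : i + 1 = M * (i / M + 1) := by rw [Nat.mul_succ]; omega
      rw [this]; simp
    dsimp only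
    rw [hl, h0] at this
    rw [h2]; exact this
  · have h2 : (i + 1) % M = i % M + 1 := by
      rw [Nat.add_mod, Nat.mod_eq_of_lt (a := 1) (by omega), Nat.mod_eq_of_lt (by omega)]
    dsimp only
    rw [h2]; exact this

theorem exists_path_through {V : Type*} {E : V → V → Prop} {m n : ℕ} {x y z : V}
    (h : Walk E m x y) (h' : Walk E n y z) :
    ∃ w : ℕ → V, w 0 = x ∧ w m = y ∧ w (m + n) = z ∧ ∀ i < m + n, E (w i) (w (i + 1)) := by
  obtain ⟨u, u0, um, hu⟩ := h.exists_path
  obtain ⟨v, v0, vn, hv⟩ := h'.exists_path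
  refine ⟨fun i => if i ≤ m then u i else v (i - m), by simp [u0], by simp [um], ?_, fun i hi => ?_⟩
  · dsimp only
    split_ifs with h
    · have : n = 0 := by omega
      subst this; rw [← vn, v0]; simpa using um
    · rw [← vn]; congr 1; omega
  · rcases Nat.lt_trichotomy i m with h | h | h
    · have h1 : i ≤ m := by omega
      have h2 : i + 1 ≤ m := by omega
      simp only [h1, h2, if_true]; exact hu _ h
    · subst h
      have h2 : ¬ (i + 1 ≤ i) := by omega
      simp only [h2, le_refl, if_true, if_false, um, ← v0]
      have := hv 0 (by omega)
      simpa using this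
    · have h1 : ¬ i ≤ m := by omega
      have h2 : ¬ i + 1 ≤ m := by omega
      simp only [h1, h2, if_false]
      have := hv (i - m) (by omega)
      have e : i - m + 1 = i + 1 - m := by omega
      rwa [e] at this

/-- Embedding of a strongly connected graph, with chosen cyclic classes. -/
structure Comp {K : Type*} (E : K → K → Prop) where
  V : Type
  ι : V → K
  inj : Function.Injective ι
  c : CyclicClasses (fun x y => E (ι x) (ι y))
  succ : ∀ x, ∃ y, E (ι x) (ι y)
  pred : ∀ x, ∃ y, E (ι y) (ι x)

theorem Comp.closedWalk {K : Type*} {E : K → K → Prop} (C : Comp E) {m n : ℕ} (hM : 0 < m + n)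
    {x y : C.V} (h : Walk (fun x y => E (C.ι x) (C.ι y)) m x y)
    (h' : Walk (fun x y => E (C.ι x) (C.ι y)) n y x) :
    ∃ w, ClosedWalk E (m + n) w ∧ w 0 = C.ι x ∧ w m = C.ι y := by
  obtain ⟨w, h0, h1, h2, h3⟩ := exists_path_through h h'
  refine ⟨fun i => C.ι (w (i % (m + n))), ?_, ?_, ?_⟩
  · exact ClosedWalk.of_path (w := fun i => C.ι (w i)) hM h3 (by simp only [h2, h0])
  · simp [h0]
  · rcases Nat.eq_zero_or_pos n with hn | hn
    · subst hn; cases h'; simp [h0]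
    · dsimp only; rw [Nat.mod_eq_of_lt (by omega), h1]

/-- Witnesses for failure of condition D together with a suitable length `M`. -/
structure Bad {K : Type*} (E : K → K → Prop) where
  (C₁ C₂ C₃ : Comp E)
  nonrefl : ∃ x, ¬ E (C₁.ι x) (C₁.ι x)
  nonsymm : ∃ x y, E (C₂.ι x) (C₂.ι y) ∧ ¬ E (C₂.ι y) (C₂.ι x)
  nonsplit : ∃ x y, C₃.c.f y = C₃.c.f x + 1 ∧ ¬ E (C₃.ι x) (C₃.ι y)
  M : ℕ
  hM₁ : 2 * C₁.c.n0 + 4 ≤ M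
  hM₂ : 2 * C₂.c.n0 + 4 ≤ M
  hM₃ : 2 * C₃.c.n0 + 4 ≤ M
  hp₁ : C₁.c.p ∣ M
  hp₂ : C₂.c.p ∣ M
  hp₃ : C₃.c.p ∣ M

section Sep

variable {K : Type*} {E : K → K → Prop} (B : Bad E)

theorem ClosedWalk.shift {M : ℕ} {w : ℕ → K} (h : ClosedWalk E M w) (s : ℕ) :
    ClosedWalk E M (fun i => w (i + s)) :=
  ⟨fun i => by have := h.1 (i + s); rwa [add_right_comm] at this,
    fun i => by have := h.2 (i + s); rwa [add_right_comm] at this⟩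

theorem Bad.closedWalk₀ {d : ℕ} (hd : d < B.M) (h1 : d ≠ 1) :
    ∃ w, ClosedWalk E B.M w ∧ ¬ E (w 0) (w d) := by
  have := B.hM₁
  have := B.hM₂
  have := B.hM₃
  have z₁ : (B.M : ZMod B.C₁.c.p) = 0 := (ZMod.natCast_eq_zero_iff _ _).2 B.hp₁
  have z₂ : (B.M : ZMod B.C₂.c.p) = 0 := (ZMod.natCast_eq_zero_iff _ _).2 B.hp₂
  rcases Nat.eq_zero_or_pos d with rfl | hd0
  · obtain ⟨x, hx⟩ := B.nonrefl
    obtain ⟨w, hw, h0, -⟩ := B.C₁.closedWalk (m := 0) (n := B.M) (by omega) (x := x) (y := x) rfl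
      (B.C₁.c.walk _ (by omega) _ _ (by rw [z₁, add_zero]))
    rw [zero_add] at hw
    exact ⟨w, hw, by rwa [h0]⟩
  by_cases hl : d = B.M - 1
  · obtain ⟨x, y, hxy, hyx⟩ := B.nonsymm
    obtain ⟨w, hw, h0, h1⟩ := B.C₂.closedWalk (m := B.M - 1) (n := 1) (by omega) (x := y) (y := x)
      (B.C₂.c.walk _ (by omega) _ _ (by
        rw [B.C₂.c.edge _ _ hxy, Nat.cast_sub (by omega), z₂]; simp)) (Walk.single hxy)
    rw [Nat.sub_add_cancel (by omega)] at hw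
    exact ⟨w, hw, by rwa [hl, h0, h1]⟩
  · obtain ⟨x, y, h1, h2, h3⟩ := B.C₃.c.exists_far_nonedge (M := B.M) (d := d) (by omega) B.hp₃
      (by omega) (by omega) B.nonsplit
    obtain ⟨w, hw, h0, h4⟩ := B.C₃.closedWalk (by omega) h1 h2
    rw [Nat.add_sub_cancel' (by omega)] at hw
    exact ⟨w, hw, by rwa [h0, h4]⟩

theorem Bad.closedWalk_nonedge {p q : ℕ} (hp : p < B.M) (hq : q < B.M)
    (h : q ≠ (p + 1) % B.M) : ∃ w, ClosedWalk E B.M w ∧ ¬ E (w p) (w q) := by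
  have hM := B.hM₁
  obtain ⟨w, hw, hn⟩ := B.closedWalk₀ (d := (q + B.M - p) % B.M) (Nat.mod_lt _ (by omega))
    (fun h1 => h (by
      have e : (p + (q + B.M - p) % B.M) % B.M = q := by
        rw [Nat.add_mod_mod, Nat.add_sub_cancel' (by omega)]
        simp [Nat.mod_eq_of_lt hq]
      rw [h1] at e; exact e.symm))
  refine ⟨_, hw.shift (B.M - p), ?_⟩
  rw [hw.mod] at hn
  have e1 : p + (B.M - p) = 0 + B.M := by omega
  have e2 : q + (B.M - p) = q + B.M - p := by omega
  rw [e1, e2, hw.2]; exact hn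

/-- Any vertex of a component lies on a closed walk, at any position. -/
theorem Bad.closedWalk_through (x : B.C₃.V) (p : ℕ) :
    ∃ w, ClosedWalk E B.M w ∧ w p = B.C₃.ι x := by
  have := B.hM₃
  have z₁ : (B.M : ZMod B.C₃.c.p) = 0 := (ZMod.natCast_eq_zero_iff _ _).2 B.hp₃
  obtain ⟨w, hw, h0, -⟩ := B.C₃.closedWalk (m := 0) (n := B.M) (by omega) (x := x) (y := x) rfl
      (B.C₃.c.walk _ (by omega) _ _ (by rw [z₁, add_zero]))
  rw [zero_add] at hw
  refine ⟨_, hw.shift (B.M - p % B.M), ?_⟩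
  have := Nat.mod_lt p (show 0 < B.M by omega)
  rw [← hw.mod, ← h0]
  congr 1
  have e := Nat.mod_add_div p B.M
  have : p + (B.M - p % B.M) = B.M * (p / B.M + 1) := by
    rw [Nat.mul_succ]; omega
  rw [this]; simp

theorem Bad.closedWalks_nonedge (p q : ℕ) :
    ∃ w w', ClosedWalk E B.M w ∧ ClosedWalk E B.M w' ∧ ¬ E (w p) (w' q) := by
  obtain ⟨x, y, -, h⟩ := B.nonsplit
  obtain ⟨w, hw, h1⟩ := B.closedWalk_through x p
  obtain ⟨w', hw', h2⟩ := B.closedWalk_through y q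
  exact ⟨w, w', hw, hw', by rwa [h1, h2]⟩

theorem Bad.exists_base : ∃ g₀ g₁ h, B.C₃.c.f g₀ = B.C₃.c.f g₁ ∧ E (B.C₃.ι g₁) (B.C₃.ι h) ∧
    ¬ E (B.C₃.ι g₀) (B.C₃.ι h) := by
  obtain ⟨x, y, hf, h⟩ := B.nonsplit
  obtain ⟨z, hz⟩ := B.C₃.pred y
  refine ⟨x, z, y, ?_, hz, h⟩
  have := B.C₃.c.edge _ _ hz
  rw [hf] at this; exact add_right_cancel this

theorem Bad.exists_base' : ∃ g₀ g₁ h, B.C₃.c.f g₀ = B.C₃.c.f g₁ ∧ E (B.C₃.ι h) (B.C₃.ι g₁) ∧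
    ¬ E (B.C₃.ι h) (B.C₃.ι g₀) := by
  obtain ⟨x, y, hf, h⟩ := B.nonsplit
  obtain ⟨z, hz⟩ := B.C₃.succ x
  refine ⟨y, z, x, ?_, hz, h⟩
  rw [B.C₃.c.edge _ _ hz, hf]

theorem Bad.closedWalks_ne (p q : ℕ) :
    ∃ w w', ClosedWalk E B.M w ∧ ClosedWalk E B.M w' ∧ w p ≠ w' q := by
  obtain ⟨x, y, z, -, h1, h2⟩ := B.exists_base
  obtain ⟨w, hw, h1'⟩ := B.closedWalk_through x p
  obtain ⟨w', hw', h2'⟩ := B.closedWalk_through y q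
  refine ⟨w, w', hw, hw', fun h => h2 ?_⟩
  rw [← h1', h, h2']; exact h1

/-- The subdivision of the graph of `R`: each edge becomes a path of length `M`. -/
abbrev Sub (T : Type*) (M : ℕ) := T ⊕ T × T × Fin M

namespace Sub

variable {T : Type*} {M : ℕ} (R : T → T → Prop)

def pos : Sub T M → ℕ
  | .inl _ => 0
  | .inr (_, _, j) => j

def Valid : Sub T M → Prop
  | .inl _ => True
  | .inr (a, b, j) => R a b ∧ 1 ≤ (j : ℕ)

/-- Edges of the subdivision. -/
def Adj : Sub T M → Sub T M → Prop
  | .inl a, .inr (a', _, j) => a = a' ∧ (j : ℕ) = 1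
  | .inr (a, b, j), .inr (a', b', j') => a = a' ∧ b = b' ∧ (j' : ℕ) = j + 1
  | .inr (_, b, j), .inl b' => b = b' ∧ (j : ℕ) + 1 = M
  | .inl _, .inl _ => False

/-- Graph homomorphisms from the valid part of the subdivision. -/
def IsHom (E : K → K → Prop) (φ : Sub T M → K) : Prop :=
  ∀ g g', g.Valid R → g'.Valid R → g.Adj g' → E (φ g) (φ g')

theorem isHom_closedWalk {w : ℕ → K} (hw : ClosedWalk E M w) :
    IsHom R E (fun g : Sub T M => w g.pos) := by
  rintro (a | ⟨a, b, j⟩) (a' | ⟨a', b', j'⟩) h h' hadj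
  · exact hadj.elim
  · have := hw.1 0
    simp only [pos]; rw [hadj.2]; exact this
  · have := hw.1 j
    have h0 := hw.2 0
    rw [hadj.2] at this
    rw [zero_add] at h0
    simp only [pos]; rw [h0] at this; exact this
  · have := hw.1 j
    simp only [pos]; rw [hadj.2.2]; exact this

theorem isHom_of_paths (g : T → K) (w : T → T → ℕ → K)
    (h0 : ∀ a b, w a b 0 = g a) (h1 : ∀ a b, w a b M = g b)
    (hw : ∀ a b, ∀ i < M, E (w a b i) (w a b (i + 1))) :
    IsHom R E (Sum.elim g (fun t => w t.1 t.2.1 t.2.2) : Sub T M → K) := by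
  rintro (a | ⟨a, b, j⟩) (a' | ⟨a', b', j'⟩) h h' hadj
  · exact hadj.elim
  · obtain ⟨rfl, hj⟩ := hadj
    have := hw a b' 0 (by have := j'.2; omega)
    rw [h0] at this
    simpa [hj] using this
  · obtain ⟨rfl, hj⟩ := hadj
    have := hw a b j j.2
    rw [hj, h1] at this
    exact this
  · obtain ⟨rfl, rfl, hj⟩ := hadj
    have := hw a b j j.2
    simpa [hj] using this

end Sub

variable {T : Type*} (R : T → T → Prop)

/-- Extending a base map with constant phase and paths prescribed on some edges. -/
theorem Bad.exists_hom (g : T → B.C₃.V) (hg : ∀ a b, B.C₃.c.f (g a) = B.C₃.c.f (g b))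
    (D : T → T → Prop) (w : T → T → ℕ → B.C₃.V)
    (h0 : ∀ a b, D a b → w a b 0 = g a) (h1 : ∀ a b, D a b → w a b B.M = g b)
    (hw : ∀ a b, D a b → ∀ i < B.M, E (B.C₃.ι (w a b i)) (B.C₃.ι (w a b (i + 1)))) :
    ∃ φ : Sub T B.M → K, Sub.IsHom R E φ ∧ (∀ a, φ (.inl a) = B.C₃.ι (g a)) ∧
      ∀ a b j, D a b → φ (.inr (a, b, j)) = B.C₃.ι (w a b j) := by
  classical
  have z : (B.M : ZMod B.C₃.c.p) = 0 := (ZMod.natCast_eq_zero_iff _ _).2 B.hp₃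
  have := B.hM₃
  choose u u0 u1 hu using fun a b => (B.C₃.c.walk B.M (by omega) (g a) (g b)
    (by rw [z, add_zero, hg])).exists_path
  let w' : T → T → ℕ → B.C₃.V := fun a b => if D a b then w a b else u a b
  refine ⟨Sum.elim (fun a => B.C₃.ι (g a)) (fun t => B.C₃.ι (w' t.1 t.2.1 t.2.2)),
    Sub.isHom_of_paths R (fun a => B.C₃.ι (g a)) (fun a b i => B.C₃.ι (w' a b i)) ?_ ?_ ?_,
    fun _ => rfl, fun a b j h => by simp [w', h]⟩
  · intro a b; by_cases h : D a b <;> simp [w', h, u0, h0]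
  · intro a b; by_cases h : D a b <;> simp [w', h, u1, h1]
  · intro a b; by_cases h : D a b
    · simpa [w', h] using hw a b h
    · simpa [w', h] using hu a b

theorem Bad.exists_hom_inl_inr {a : T} {σ b : T} (j : Fin B.M) (hj : (j : ℕ) = 1) (h : a ≠ σ) :
    ∃ φ : Sub T B.M → K, Sub.IsHom R E φ ∧ φ (.inl a) ≠ φ (.inl σ) ∧
      ¬ E (φ (.inl a)) (φ (.inr (σ, b, j))) := by
  classical
  obtain ⟨g₀, g₁, x, hf, h1, h2⟩ := B.exists_base
  have z : (B.M : ZMod B.C₃.c.p) = 0 := (ZMod.natCast_eq_zero_iff _ _).2 B.hp₃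
  have hM := B.hM₃
  let g : T → B.C₃.V := fun t => if t = a then g₀ else g₁
  have hg : ∀ t, B.C₃.c.f (g t) = B.C₃.c.f g₁ := fun t => by
    by_cases h : t = a <;> simp [g, h, hf]
  obtain ⟨w, w0, w1, w2, hw⟩ := exists_path_through
    (Walk.single (E := fun x y => E (B.C₃.ι x) (B.C₃.ι y)) h1)
    (B.C₃.c.walk (B.M - 1) (by omega) x (g b) (by
      rw [hg, B.C₃.c.edge _ _ h1, Nat.cast_sub (by omega), z]; simp))
  rw [Nat.add_sub_cancel' (by omega)] at w2 hw
  obtain ⟨φ, hφ, hφ1, hφ2⟩ := B.exists_hom R g (fun a b => by rw [hg, hg])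
    (fun s t => s = σ ∧ t = b) (fun _ _ => w)
    (fun s t hst => by rw [hst.1, w0]; simp [g, h.symm])
    (fun s t hst => by rw [hst.2, w2]) (fun _ _ _ => hw)
  have e0 : φ (.inl a) = B.C₃.ι g₀ := by simp [hφ1, g]
  have e1 : φ (.inl σ) = B.C₃.ι g₁ := by simp [hφ1, g, h.symm]
  refine ⟨φ, hφ, ?_, ?_⟩
  · rw [e0, e1]; intro he; rw [he] at h2; exact h2 h1
  · rw [hφ2 _ _ _ ⟨rfl, rfl⟩, e0, hj, w1]; exact h2

theorem Bad.exists_hom_inr_inl {a : T} {σ b : T} (j : Fin B.M) (hj : (j : ℕ) + 1 = B.M)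
    (h : b ≠ σ) :
    ∃ φ : Sub T B.M → K, Sub.IsHom R E φ ∧ ¬ E (φ (.inr (a, σ, j))) (φ (.inl b)) := by
  classical
  obtain ⟨g₀, g₁, x, hf, h1, h2⟩ := B.exists_base'
  have z : (B.M : ZMod B.C₃.c.p) = 0 := (ZMod.natCast_eq_zero_iff _ _).2 B.hp₃
  have hM := B.hM₃
  let g : T → B.C₃.V := fun t => if t = b then g₀ else g₁
  have hg : ∀ t, B.C₃.c.f (g t) = B.C₃.c.f g₁ := fun t => by
    by_cases h : t = b <;> simp [g, h, hf]
  obtain ⟨w, w0, w1, w2, hw⟩ := exists_path_through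
    (B.C₃.c.walk (B.M - 1) (by omega) (g a) x (by
      rw [hg, B.C₃.c.edge _ _ h1, Nat.cast_sub (by omega), z]; simp))
    (Walk.single (E := fun x y => E (B.C₃.ι x) (B.C₃.ι y)) h1)
  rw [Nat.sub_add_cancel (by omega)] at w2 hw
  obtain ⟨φ, hφ, hφ1, hφ2⟩ := B.exists_hom R g (fun a b => by rw [hg, hg])
    (fun s t => s = a ∧ t = σ) (fun _ _ => w)
    (fun s t hst => by rw [hst.1, w0])
    (fun s t hst => by rw [hst.2, w2]; simp [g, h.symm]) (fun _ _ _ => hw)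
  have e0 : φ (.inl b) = B.C₃.ι g₀ := by simp [hφ1, g]
  have e1 : (j : ℕ) = B.M - 1 := by omega
  refine ⟨φ, hφ, ?_⟩
  rw [hφ2 _ _ _ ⟨rfl, rfl⟩, e0, e1, w1]; exact h2

theorem Bad.exists_inner {j : ℕ} (hj : 1 ≤ j) (hj' : j + 2 ≤ B.M) :
    ∃ g x y, Walk (fun x y => E (B.C₃.ι x) (B.C₃.ι y)) j g x ∧
      Walk (fun x y => E (B.C₃.ι x) (B.C₃.ι y)) (B.M - j) x g ∧
      Walk (fun x y => E (B.C₃.ι x) (B.C₃.ι y)) (j + 1) g y ∧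
      Walk (fun x y => E (B.C₃.ι x) (B.C₃.ι y)) (B.M - (j + 1)) y g ∧
      ¬ E (B.C₃.ι x) (B.C₃.ι y) := by
  have z : (B.M : ZMod B.C₃.c.p) = 0 := (ZMod.natCast_eq_zero_iff _ _).2 B.hp₃
  have hM := B.hM₃
  by_cases hl : B.C₃.c.n0 ≤ B.M - (j + 1)
  · obtain ⟨g, x, y, h1, h2, h3⟩ := B.C₃.c.exists_near_nonedge hj B.nonsplit
    refine ⟨g, x, y, h1, B.C₃.c.walk _ (by omega) _ _ ?_, h2,
      B.C₃.c.walk _ (by omega) _ _ ?_, h3⟩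
    · rw [B.C₃.c.walk_eq h1, Nat.cast_sub (by omega), z]; ring
    · rw [B.C₃.c.walk_eq h2, Nat.cast_sub (by omega), z]; ring
  · obtain ⟨g, y, x, h1, h2, h3⟩ := B.C₃.c.swap.exists_near_nonedge (j := B.M - (j + 1))
      (by omega) (by
        obtain ⟨x, y, hf, h⟩ := B.nonsplit
        refine ⟨y, x, ?_, h⟩
        change - B.C₃.c.f x = - B.C₃.c.f y + 1
        rw [hf]; ring)
    have h1 := h1.unswap
    have h2 := h2.unswap
    have e : B.M - (j + 1) + 1 = B.M - j := by omega
    rw [e] at h2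
    refine ⟨g, x, y, B.C₃.c.walk _ (by omega) _ _ ?_, h2,
      B.C₃.c.walk _ (by omega) _ _ ?_, h1, h3⟩
    · rw [B.C₃.c.walk_eq h2, Nat.cast_sub (by omega), z]; ring
    · rw [B.C₃.c.walk_eq h1, Nat.cast_sub (by omega), z]; ring

theorem Bad.exists_hom_inr_inr {a b a' b' : T} (j j' : Fin B.M) (hj : 1 ≤ (j : ℕ))
    (hj' : (j' : ℕ) = j + 1) (h : ¬ (a = a' ∧ b = b')) :
    ∃ φ : Sub T B.M → K, Sub.IsHom R E φ ∧
      ¬ E (φ (.inr (a, b, j))) (φ (.inr (a', b', j'))) := by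
  classical
  have hjM := j'.2
  obtain ⟨g, x, y, h1, h2, h3, h4, h5⟩ := B.exists_inner hj (by omega)
  obtain ⟨w, w0, w1, w2, hw⟩ := exists_path_through h1 h2
  obtain ⟨v, v0, v1, v2, hv⟩ := exists_path_through h3 h4
  rw [Nat.add_sub_cancel' (by omega)] at w2 hw v2 hv
  obtain ⟨φ, hφ, hφ1, hφ2⟩ := B.exists_hom R (fun _ => g) (fun a b => rfl)
    (fun s t => (s = a ∧ t = b) ∨ (s = a' ∧ t = b'))
    (fun s t => if s = a ∧ t = b then w else v)
    (fun s t hst => by split_ifs <;> assumption)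
    (fun s t hst => by split_ifs <;> assumption)
    (fun s t _ => by split_ifs <;> assumption)
  refine ⟨φ, hφ, ?_⟩
  rw [hφ2 _ _ _ (Or.inl ⟨rfl, rfl⟩), hφ2 _ _ _ (Or.inr ⟨rfl, rfl⟩)]
  have h' : ¬ (a' = a ∧ b' = b) := fun h' => h ⟨h'.1.symm, h'.2.symm⟩
  simp only [if_neg h', and_self, if_true, w1, hj', v1]
  exact h5

theorem Sub.pos_lt {M : ℕ} (hM : 0 < M) (g : Sub T M) : g.pos < M := by
  rcases g with a | ⟨a, b, j⟩
  · exact hM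
  · exact j.2

/-- Homomorphisms detect non-edges of the subdivision. -/
theorem Bad.exists_hom_nonedge (g g' : Sub T B.M) (hg : g.Valid R) (hg' : g'.Valid R)
    (h : ¬ g.Adj g') : ∃ φ : Sub T B.M → K, Sub.IsHom R E φ ∧ ¬ E (φ g) (φ g') := by
  have hM := B.hM₃
  by_cases hp : g'.pos = (g.pos + 1) % B.M
  · rcases g with a | ⟨a, b, j⟩ <;> rcases g' with a' | ⟨a', b', j'⟩
    · simp only [Sub.pos] at hp
      rw [Nat.mod_eq_of_lt (by omega)] at hp
      omega
    · simp only [Sub.pos] at hp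
      rw [Nat.mod_eq_of_lt (by omega)] at hp
      obtain ⟨φ, h1, -, h2⟩ := B.exists_hom_inl_inr R (a := a) (σ := a') (b := b') j' hp
        (fun e => h ⟨e, hp⟩)
      exact ⟨φ, h1, h2⟩
    · simp only [Sub.pos] at hp
      have hj : (j : ℕ) + 1 = B.M := by
        have := j.2
        by_contra hne
        rw [Nat.mod_eq_of_lt (by omega)] at hp
        omega
      exact B.exists_hom_inr_inl R j hj (fun e => h ⟨e.symm, hj⟩)
    · simp only [Sub.pos] at hp
      have hj : (j' : ℕ) = j + 1 := by
        have := j.2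
        have h1 := hg'.2
        by_cases hne : (j : ℕ) + 1 = B.M
        · rw [hne, Nat.mod_self] at hp; omega
        · rw [Nat.mod_eq_of_lt (by omega)] at hp; exact hp
      exact B.exists_hom_inr_inr R j j' hg.2 hj (fun e => h ⟨e.1, e.2, hj⟩)
  · obtain ⟨w, hw, hn⟩ := B.closedWalk_nonedge (Sub.pos_lt (by omega) g)
      (Sub.pos_lt (by omega) g') hp
    exact ⟨_, Sub.isHom_closedWalk R hw, hn⟩

theorem Bad.exists_hom_ne {a b : T} (h : a ≠ b) :
    ∃ φ : Sub T B.M → K, Sub.IsHom R E φ ∧ φ (.inl a) ≠ φ (.inl b) := by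
  have hM := B.hM₃
  obtain ⟨φ, h1, h2, -⟩ := B.exists_hom_inl_inr R (a := a) (σ := b) (b := b) ⟨1, by omega⟩ rfl h
  exact ⟨φ, h1, h2⟩

end Sep


theorem exists_mod_mod {μ : ℕ} (hμ : 0 < μ) (p c a b : ℕ) (ha : a < μ) (hb : b < μ) :
    ∃ r, p ≤ r ∧ r < p + 2 * μ ^ 2 ∧ r % μ = a ∧ ((r + c) / μ) % μ = b := by
  obtain ⟨q, hq1, hq2, hqb⟩ : ∃ q, p + c ≤ q * μ ∧ q * μ + μ ≤ p + c + μ + μ ^ 2 ∧ q % μ = b := by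
    set q0 := (p + c) / μ + 1 with hq0
    have h1 := Nat.div_add_mod (p + c) μ
    have h2 := Nat.mod_lt (p + c) hμ
    have h3 : p + c ≤ q0 * μ := by rw [hq0]; nlinarith
    have h4 : q0 * μ ≤ p + c + μ := by
      rw [hq0, add_mul, one_mul]; exact Nat.add_le_add_right (Nat.div_mul_le_self _ _) _
    set t := (b + μ * q0 - q0) % μ with ht
    have ht' : t < μ := Nat.mod_lt _ hμ
    have hle : q0 ≤ μ * q0 := Nat.le_mul_of_pos_left _ hμ
    refine ⟨q0 + t, by nlinarith, ?_, ?_⟩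
    · have : (t + 1) * μ ≤ μ * μ := Nat.mul_le_mul_right _ ht'
      nlinarith
    · rw [ht, Nat.add_mod_mod, Nat.add_sub_cancel' (by omega), Nat.add_mul_mod_self_left,
        Nat.mod_eq_of_lt hb]
  set s := q * μ - c with hs
  set t := (a + μ * s - s) % μ with ht
  have ht' : t < μ := Nat.mod_lt _ hμ
  have hle : s ≤ μ * s := Nat.le_mul_of_pos_left _ hμ
  have hμ2 : μ ≤ μ ^ 2 := by nlinarith
  refine ⟨s + t, by omega, by omega, ?_, ?_⟩
  · rw [ht, Nat.add_mod_mod, Nat.add_sub_cancel' (by omega), Nat.add_mul_mod_self_left,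
      Nat.mod_eq_of_lt ha]
  · have e : s + t + c = t + μ * q := by rw [mul_comm μ q]; omega
    rw [e, Nat.add_mul_div_left _ _ hμ, Nat.div_eq_of_lt ht', zero_add, hqb]

/-- A cyclic arrangement of functions in which every ordered pair of the first family occurs at
every nonzero cyclic distance, and every function of the second family occurs. -/
theorem exists_sync {Φ : Type*} (μ N : ℕ) (hμ : 0 < μ) (w u : ℕ → Φ) :
    ∃ (B : ℕ) (f : ℕ → Φ), 0 < B ∧
      (∀ s, 0 < s → s < B → ∀ a < μ, ∀ b < μ, ∃ r < B, f r = w a ∧ f ((r + s) % B) = w b) ∧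
      ∀ i < N, ∃ r < B, f r = u i := by
  set K := 2 * μ ^ 2 with hK
  set X := 2 * K + 2 * K * μ ^ 2 + N with hX
  have hKpos : 0 < K := by positivity
  let f : ℕ → Φ := fun r =>
    if r < X then w (r % μ)
    else if r < 2 * X then w ((r / μ) % μ)
    else if r < 2 * X + 2 * K * μ ^ 2 then
      if (r - 2 * X) % (2 * K) < K then w ((r - 2 * X) / (2 * K) / μ)
      else w ((r - 2 * X) / (2 * K) % μ)
    else u (r - (2 * X + 2 * K * μ ^ 2))
  have f1 : ∀ r < X, f r = w (r % μ) := fun r h => by simp only [f, if_pos h]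
  have f2 : ∀ r, X ≤ r → r < 2 * X → f r = w ((r / μ) % μ) := fun r h h' => by
    simp only [f, if_neg (not_lt.2 h), if_pos h']
  have f3 : ∀ a < μ, ∀ b < μ, ∀ t < 2 * K, 2 * X + 2 * K * (μ * a + b) + t < 2 * X + 2 * K * μ ^ 2 ∧
      f (2 * X + 2 * K * (μ * a + b) + t) = if t < K then w a else w b := fun a ha b hb t ht => by
    have hc : μ * a + b + 1 ≤ μ ^ 2 := by nlinarith
    have hlt : 2 * K * (μ * a + b) + t < 2 * K * μ ^ 2 := by
      have := Nat.mul_le_mul_left (2 * K) hc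
      nlinarith
    have e1 : 2 * X + 2 * K * (μ * a + b) + t - 2 * X = t + 2 * K * (μ * a + b) := by omega
    have e2 : (μ * a + b) / μ = a := by
      rw [add_comm, Nat.add_mul_div_left _ _ hμ, Nat.div_eq_of_lt hb, zero_add]
    have e3 : (μ * a + b) % μ = b := by
      rw [add_comm, Nat.add_mul_mod_self_left, Nat.mod_eq_of_lt hb]
    refine ⟨by omega, ?_⟩
    simp only [f]
    rw [if_neg (by omega), if_neg (by omega), if_pos (by omega), e1, Nat.add_mul_mod_self_left,
      Nat.mod_eq_of_lt ht, Nat.add_mul_div_left _ _ (by omega), Nat.div_eq_of_lt ht, zero_add,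
      e2, e3]
  refine ⟨2 * X + 2 * K * μ ^ 2 + N, f, by omega, fun s hs hsB a ha b hb => ?_, fun i hi => ?_⟩
  · set B := 2 * X + 2 * K * μ ^ 2 + N with hB
    by_cases h1 : s ≤ K
    · obtain ⟨l1, v1⟩ := f3 a ha b hb (K - 1) (by omega)
      obtain ⟨l2, v2⟩ := f3 a ha b hb (K - 1 + s) (by omega)
      refine ⟨_, lt_of_lt_of_le l1 (by omega), ?_, ?_⟩
      · rw [v1, if_pos (by omega)]
      · rw [add_assoc, Nat.mod_eq_of_lt (by omega), v2, if_neg (by omega)]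
    by_cases h2 : B ≤ s + K
    · obtain ⟨l1, v1⟩ := f3 b hb a ha K (by omega)
      obtain ⟨l2, v2⟩ := f3 b hb a ha (K - (B - s)) (by omega)
      refine ⟨_, lt_of_lt_of_le l1 (by omega), ?_, ?_⟩
      · rw [v1, if_neg (by omega)]
      · have e : 2 * X + 2 * K * (μ * b + a) + K + s =
          2 * X + 2 * K * (μ * b + a) + (K - (B - s)) + B := by omega
        rw [e, Nat.add_mod_right, Nat.mod_eq_of_lt (by omega), v2, if_pos (by omega)]
    by_cases h3 : s + K ≤ 2 * X
    · obtain ⟨r, hr1, hr2, hr3, hr4⟩ := exists_mod_mod hμ (X - s) s a b ha hb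
      have hrX : r < X := by omega
      refine ⟨r, by omega, by rw [f1 r hrX, hr3], ?_⟩
      rw [Nat.mod_eq_of_lt (by omega), f2 _ (by omega) (by omega), hr4]
    · obtain ⟨r, hr1, hr2, hr3, hr4⟩ := exists_mod_mod hμ (X - (B - s)) (B - s) b a hb ha
      refine ⟨r + (B - s), by omega, by rw [f2 _ (by omega) (by omega), hr4], ?_⟩
      have e : r + (B - s) + s = r + B := by omega
      rw [e, Nat.add_mod_right, Nat.mod_eq_of_lt (by omega), f1 _ (by omega), hr3]
  · refine ⟨2 * X + 2 * K * μ ^ 2 + i, by omega, ?_⟩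
    simp only [f]
    rw [if_neg (by omega), if_neg (by omega), if_neg (by omega)]
    congr 1; omega


open CombinedSubshift.Sub

section Occ

variable {A : Type*}

def OccAt (i : ℤ) (w : List A) (x : ℤ → A) : Prop :=
  ∀ (n : ℕ) (h : n < w.length), x (i + n) = w.get ⟨n, h⟩

theorem occAt_cons {i : ℤ} {a : A} {w : List A} {x : ℤ → A} :
    OccAt i (a :: w) x ↔ x i = a ∧ OccAt (i + 1) w x := by
  constructor
  · intro h
    refine ⟨by simpa using h 0 (by simp), fun n hn => ?_⟩
    have := h (n + 1) (by simpa using hn)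
    rw [List.get_cons_succ] at this
    rw [← this]; congr 1; push_cast; ring
  · rintro ⟨h1, h2⟩ n hn
    rcases n with _ | n
    · simpa using h1
    · have := h2 n (by simpa using hn)
      rw [List.get_cons_succ, ← this]; congr 1; push_cast; ring

theorem occAt_append {i : ℤ} {u v : List A} {x : ℤ → A} :
    OccAt i (u ++ v) x ↔ OccAt i u x ∧ OccAt (i + u.length) v x := by
  induction u generalizing i with
  | nil => simp [OccAt]
  | cons a u ih =>
    rw [List.cons_append, occAt_cons, occAt_cons, ih, and_assoc]
    simp [add_assoc, add_comm (1 : ℤ)]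

theorem occAt_map_range {i : ℤ} {B : ℕ} {f : ℕ → A} {x : ℤ → A} :
    OccAt i ((List.range B).map f) x ↔ ∀ r < B, x (i + r) = f r := by
  simp [OccAt]

theorem occAt_flatMap {T : Type*} {B : ℕ} (f : ℕ → T → A) {i : ℤ} {w : List T} {x : ℤ → A} :
    OccAt i (w.flatMap fun a => (List.range B).map fun r => f r a) x ↔
      ∀ (n : ℕ) (h : n < w.length), ∀ r < B, x (i + n * B + r) = f r (w.get ⟨n, h⟩) := by
  induction w generalizing i with
  | nil => simp [OccAt]
  | cons a w ih =>
    rw [List.flatMap_cons, occAt_append, ih, occAt_map_range]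
    simp only [List.length_map, List.length_range]
    constructor
    · rintro ⟨h1, h2⟩ n hn r hr
      rcases n with _ | n
      · simpa using h1 r hr
      · have := h2 n (by simpa using hn) r hr
        rw [List.get_cons_succ, ← this]; congr 1; push_cast; ring
    · intro h
      refine ⟨fun r hr => by simpa using h 0 (by simp) r hr, fun n hn r hr => ?_⟩
      have := h (n + 1) (by simpa using hn) r hr
      rw [List.get_cons_succ] at this
      rw [← this]; congr 1; push_cast; ring

end Occ

theorem int_dvd_sub_of_step {B : ℤ} {g : ℤ → ℤ} (h : ∀ i, B ∣ g (i + 1) - g i) (i : ℤ) :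
    B ∣ g i - g 0 := by
  induction i using Int.induction_on with
  | zero => simp
  | succ i ih => have := dvd_add (h i) ih; simpa using this
  | pred i ih =>
    have := dvd_sub ih (h (-i - 1))
    simp only [sub_add_cancel] at this
    have e : ∀ a b c : ℤ, a - b - (a - c) = c - b := fun a b c => by ring
    rwa [e] at this

/-- A sequence of row functions, periodic of period `B`, that synchronises columns. -/
structure SyncRows {K : Type*} (E : K → K → Prop) {T : Type*} (R : T → T → Prop) (M : ℕ) where
  B : ℕ
  hB : 0 < B
  F : ℤ → Sub T M → K
  per : ∀ l m, F (l + B * m) = F l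
  hom : ∀ l, IsHom R E (F l)
  sync : ∀ s : ℤ, ¬ (B : ℤ) ∣ s → ∀ w w', ClosedWalk E M w → ClosedWalk E M w' →
    ∃ r, (∀ g, F r g = w g.pos) ∧ ∀ g, F (r + s) g = w' g.pos
  surj : ∀ φ, IsHom R E φ → ∃ r, F r = φ

theorem exists_enum (α : Type*) [Finite α] [Nonempty α] :
    ∃ n : ℕ, 0 < n ∧ ∃ e : ℕ → α, ∀ a, ∃ i < n, e i = a := by
  classical
  obtain ⟨a0⟩ := ‹Nonempty α›
  obtain ⟨n, ⟨e⟩⟩ := Finite.exists_equiv_fin α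
  refine ⟨n, Fin.pos (e a0), fun i => if h : i < n then e.symm ⟨i, h⟩ else a0, fun a =>
    ⟨e a, (e a).2, by simp⟩⟩

theorem Bad.exists_syncRows {K : Type*} [Finite K] {E : K → K → Prop} (Bd : Bad E) {T : Type*}
    [Finite T] (R : T → T → Prop) : Nonempty (SyncRows E R Bd.M) := by
  let Φ := {φ : Sub T Bd.M → K // IsHom R E φ}
  let W := {φ : Φ // ∃ w, ClosedWalk E Bd.M w ∧ ∀ g, φ.1 g = w g.pos}
  obtain ⟨w0, -, hw0, -⟩ := Bd.closedWalks_ne 0 0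
  have : Nonempty W := ⟨⟨⟨_, isHom_closedWalk R hw0⟩, w0, hw0, fun _ => rfl⟩⟩
  have : Nonempty Φ := ⟨⟨_, isHom_closedWalk R hw0⟩⟩
  obtain ⟨μ, hμ, w, hw⟩ := exists_enum W
  obtain ⟨N, hN, u, hu⟩ := exists_enum Φ
  obtain ⟨B, f, hB, h1, h2⟩ := exists_sync μ N hμ (fun i => (w i).1) u
  have hB' : (B : ℤ) ≠ 0 := by exact_mod_cast hB.ne'
  refine ⟨⟨B, hB, fun l => (f (l % B).toNat).1, fun l m => ?_, fun l => (f _).2,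
    fun s hs v v' hv hv' => ?_, fun φ hφ => ?_⟩⟩
  · simp [Int.add_mul_emod_self_left]
  · obtain ⟨a, ha, hav⟩ := hw ⟨⟨_, isHom_closedWalk R hv⟩, v, hv, fun _ => rfl⟩
    obtain ⟨b, hb, hbv⟩ := hw ⟨⟨_, isHom_closedWalk R hv'⟩, v', hv', fun _ => rfl⟩
    have hs0 : 0 ≤ s % B := Int.emod_nonneg _ hB'
    have hs1 : s % B < B := Int.emod_lt_of_pos _ (by exact_mod_cast hB)
    have hs2 : s % B ≠ 0 := fun h => hs (Int.dvd_of_emod_eq_zero h)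
    obtain ⟨r, hr, e1, e2⟩ := h1 (s % B).toNat (by omega) (by omega) a ha b hb
    refine ⟨r, fun g => ?_, fun g => ?_⟩
    · have : ((r : ℤ) % B).toNat = r := by
        rw [Int.emod_eq_of_lt (by omega) (by omega)]; simp
      simp only [this, e1, hav]
    · have : (((r : ℤ) + s) % B).toNat = (r + (s % B).toNat) % B := by
        rw [← Int.add_emod_emod]
        zify
        rw [Int.toNat_of_nonneg (Int.emod_nonneg _ hB'), Int.toNat_of_nonneg hs0]
      simp only [this, e2, hbv]
  · obtain ⟨i, hi, e⟩ := hu ⟨φ, hφ⟩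
    obtain ⟨r, hr, e'⟩ := h2 i hi
    refine ⟨r, ?_⟩
    have : ((r : ℤ) % B).toNat = r := by
      rw [Int.emod_eq_of_lt (by omega) (by omega)]; simp
    simp only [this, e', e]

section Decode

variable {K : Type*} {E : K → K → Prop} (Bd : Bad E) {T : Type*} {R : T → T → Prop}
  (Vr : T → T → Prop) (S : SyncRows E R Bd.M)

theorem SyncRows.exists_ne {s : ℤ} (hs : ¬ (S.B : ℤ) ∣ s) (p q : ℕ) (t : ℤ) :
    ∃ r, t ≤ r ∧ r < t + S.B ∧
      ∀ g g', g.pos = p → g'.pos = q → S.F r g ≠ S.F (r + s) g' := by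
  obtain ⟨w, w', h, h', hne⟩ := Bd.closedWalks_ne p q
  obtain ⟨r, h1, h2⟩ := S.sync s hs w w' h h'
  have hB : (0 : ℤ) < S.B := by exact_mod_cast S.hB
  have e0 := Int.emod_add_mul_ediv (r - t) S.B
  have e1 := Int.emod_nonneg (r - t) hB.ne'
  have e2 := Int.emod_lt_of_pos (r - t) hB
  have e : t + (r - t) % S.B = r + S.B * (-((r - t) / S.B)) := by linarith
  refine ⟨t + (r - t) % S.B, by omega, by omega, ?_⟩
  rintro g g' rfl rfl
  have e' : t + (r - t) % S.B + s = r + s + S.B * (-((r - t) / S.B)) := by linarith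
  rw [e', S.per, e, S.per, h1, h2]; exact hne

theorem SyncRows.exists_nonedge {s : ℤ} (hs : ¬ (S.B : ℤ) ∣ s) (p q : ℕ) :
    ∃ r, ∀ g g', g.pos = p → g'.pos = q → ¬ E (S.F r g) (S.F (r + s) g') := by
  obtain ⟨w, w', h, h', hne⟩ := Bd.closedWalks_nonedge p q
  obtain ⟨r, h1, h2⟩ := S.sync s hs w w' h h'
  exact ⟨r, by rintro g g' rfl rfl; rwa [h1, h2]⟩

theorem SyncRows.pos_eq {g g' : Sub T Bd.M} (h : ∀ r, S.F r g = S.F r g') : g.pos = g'.pos := by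
  by_contra hne
  have hM := Bd.hM₁
  have hg := pos_lt (by omega) g
  have hg' := pos_lt (by omega) g'
  have hq : (g'.pos + 1) % Bd.M ≠ (g.pos + 1) % Bd.M := fun he => by
    rcases Nat.lt_or_ge (g.pos + 1) Bd.M with h1 | h1 <;>
      rcases Nat.lt_or_ge (g'.pos + 1) Bd.M with h2 | h2
    · rw [Nat.mod_eq_of_lt h1, Nat.mod_eq_of_lt h2] at he; omega
    · have h3 : g'.pos + 1 = Bd.M := by omega
      rw [Nat.mod_eq_of_lt h1, h3, Nat.mod_self] at he; omega
    · have h3 : g.pos + 1 = Bd.M := by omega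
      rw [Nat.mod_eq_of_lt h2, h3, Nat.mod_self] at he; omega
    · omega
  obtain ⟨w, hw, hn⟩ := Bd.closedWalk_nonedge hg (Nat.mod_lt (g'.pos + 1) (by omega)) hq
  obtain ⟨r, hr⟩ := S.surj _ (isHom_closedWalk R hw)
  have := h r
  rw [hr] at this
  simp only at this
  rw [this, hw.mod] at hn
  exact hn (hw.1 _)

theorem SyncRows.inl_eq {g g' : Sub T Bd.M} (hg : g'.Valid R) (h : ∀ r, S.F r g = S.F r g') {a : T}
    (ha : g = .inl a) : g' = .inl a := by
  have hp := S.pos_eq Bd h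
  subst ha
  rcases g' with b | ⟨b, c, j⟩
  · by_contra hne
    obtain ⟨φ, hφ, hφ'⟩ := Bd.exists_hom_ne R (a := a) (b := b) (fun e => hne (by rw [e]))
    obtain ⟨r, rfl⟩ := S.surj φ hφ
    exact hφ' (h r)
  · have := hg.2
    simp only [pos] at hp; omega

/-- Admissible sequences of symbols along a column. -/
structure GoodCol (R Vr : T → T → Prop) {M : ℕ} (γ : ℤ → Sub T M) : Prop where
  valid : ∀ n, (γ n).Valid R
  pos : ∀ n, (γ (n + 1)).pos = (γ n).pos
  vert : ∀ n a b, γ n = .inl a → γ (n + 1) = .inl b → Vr a b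

theorem GoodCol.pos_eq {M : ℕ} {γ : ℤ → Sub T M} (h : GoodCol R Vr γ) (m n : ℤ) :
    (γ n).pos = (γ m).pos := by
  have key : ∀ n, (γ n).pos = (γ 0).pos := fun n => by
    induction n using Int.induction_on with
    | zero => rfl
    | succ i ih => rw [h.pos, ih]
    | pred i ih => rw [← ih, ← h.pos, sub_add_cancel]
  rw [key, key m]

theorem GoodCol.shift {M : ℕ} {γ : ℤ → Sub T M} (h : GoodCol R Vr γ) (m : ℤ) :
    GoodCol R Vr (fun n => γ (n + m)) where
  valid n := h.valid _
  pos n := by rw [add_right_comm]; exact h.pos _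
  vert n a b ha hb := h.vert (n + m) a b ha (by rw [add_right_comm]; exact hb)

/-- A finite window of a coded column. -/
def SyncRows.Window (w : List K) : Prop :=
  ∃ (γ : ℤ → Sub T Bd.M) (o : ℤ), GoodCol R Vr γ ∧
    ∀ (t : ℕ) (h : t < w.length), w.get ⟨t, h⟩ = S.F (o + t) (γ ((o + t) / S.B))

theorem SyncRows.decode (c : ℤ → K)
    (h : ∀ i : ℤ, S.Window Bd Vr ((List.range (2 * S.B)).map fun t : ℕ => c (i + t))) :
    ∃ (γ : ℤ → Sub T Bd.M) (o : ℤ), GoodCol R Vr γ ∧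
      ∀ l, c l = S.F (l + o) (γ ((l + o) / S.B)) := by
  choose γ o hγ hw using h
  have hB : (0 : ℤ) < S.B := by exact_mod_cast S.hB
  have hw' : ∀ i t : ℤ, 0 ≤ t → t < 2 * S.B →
      c (i + t) = S.F (o i + t) (γ i ((o i + t) / S.B)) := fun i t h0 h1 => by
    have := hw i t.toNat (by simp; omega)
    simp only [List.get_eq_getElem, List.getElem_map, List.getElem_range,
      Int.toNat_of_nonneg h0] at this
    exact this
  have hstep : ∀ i, (S.B : ℤ) ∣ (o (i + 1) - (i + 1)) - (o i - i) := fun i => by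
    by_contra hd
    obtain ⟨r, hr1, hr2, hne⟩ := S.exists_ne Bd hd (γ i 0).pos (γ (i + 1) 0).pos (o i + 1)
    apply hne (γ i (r / S.B)) (γ (i + 1) ((o (i + 1) + (r - o i - 1)) / S.B))
      ((hγ i).pos_eq _ _ _) ((hγ (i + 1)).pos_eq _ _ _)
    have e1 := hw' i (r - o i) (by omega) (by omega)
    have e2 := hw' (i + 1) (r - o i - 1) (by omega) (by omega)
    have e3 : i + (r - o i) = i + 1 + (r - o i - 1) := by ring
    have e4 : o i + (r - o i) = r := by ring
    have e5 : r + (o (i + 1) - (i + 1) - (o i - i)) = o (i + 1) + (r - o i - 1) := by ring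
    rw [e5, ← e2, ← e3, e1, e4]
  have hdvd : ∀ n, (S.B : ℤ) ∣ o (n * S.B - o 0) := fun n => by
    have := int_dvd_sub_of_step (g := fun i => o i - i) hstep (n * S.B - o 0)
    simp only [sub_zero] at this
    have h2 : (S.B : ℤ) ∣ n * S.B := Dvd.intro_left n rfl
    have := dvd_add this h2
    have e : ∀ a b c : ℤ, a - (b - c) - c + b = a := fun a b c => by ring
    rwa [e] at this
  let γ' : ℤ → Sub T Bd.M := fun n => γ (n * S.B - o 0) (o (n * S.B - o 0) / S.B)
  have hc : ∀ n r : ℤ, 0 ≤ r → r < S.B → c (n * S.B - o 0 + r) = S.F r (γ' n) := fun n r h0 h1 => by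
    obtain ⟨q, hq⟩ := hdvd n
    rw [hw' _ _ h0 (by omega)]
    simp only [γ']
    rw [hq, Int.mul_ediv_cancel_left _ hB.ne', add_comm _ r, S.per,
      Int.add_mul_ediv_left _ _ hB.ne', Int.ediv_eq_zero_of_lt h0 h1, zero_add]
  have hnext : ∀ n r, S.F r (γ (n * S.B - o 0) (o (n * S.B - o 0) / S.B + 1)) =
      S.F r (γ' (n + 1)) := fun n r => by
    have e0 := Int.emod_nonneg r hB.ne'
    have e1 := Int.emod_lt_of_pos r hB
    have hr : ∀ g, S.F r g = S.F (r % S.B) g := fun g => by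
      conv_lhs => rw [← Int.emod_add_mul_ediv r S.B, S.per]
    rw [hr, hr, ← hc _ _ e0 e1]
    obtain ⟨q, hq⟩ := hdvd n
    have := hw' (n * S.B - o 0) (S.B + r % S.B) (by omega) (by omega)
    have e : (n + 1) * S.B - o 0 + r % S.B = n * S.B - o 0 + (S.B + r % S.B) := by ring
    have e' : S.B * q + (S.B + r % S.B) = r % S.B + S.B * (q + 1) := by ring
    rw [e, this, hq, Int.mul_ediv_cancel_left _ hB.ne', e', S.per,
      Int.add_mul_ediv_left _ _ hB.ne', Int.ediv_eq_zero_of_lt e0 e1, zero_add]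
  refine ⟨γ', o 0, ⟨fun n => (hγ _).valid _, fun n => ?_, fun n a b ha hb => ?_⟩, fun l => ?_⟩
  · rw [← S.pos_eq Bd (hnext n)]; exact (hγ _).pos _
  · refine (hγ (n * S.B - o 0)).vert _ a b ha ?_
    exact S.inl_eq Bd ((hγ _).valid _) (fun r => (hnext n r).symm) hb
  · have e0 := Int.emod_nonneg (l + o 0) hB.ne'
    have e1 := Int.emod_lt_of_pos (l + o 0) hB
    have e := Int.emod_add_mul_ediv (l + o 0) S.B
    have := hc ((l + o 0) / S.B) ((l + o 0) % S.B) e0 e1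
    have e2 : (l + o 0) / S.B * S.B - o 0 + (l + o 0) % S.B = l := by linarith
    rw [e2] at this
    rw [this]
    conv_rhs => rw [← e, S.per, e]

theorem SyncRows.adj {x : ℤ → ℤ → K} (hx : ∀ i l, E (x i l) (x (i + 1) l))
    (hcol : ∀ i, ∃ (γ : ℤ → Sub T Bd.M) (o : ℤ), GoodCol R Vr γ ∧
      ∀ l, x i l = S.F (l + o) (γ ((l + o) / S.B))) :
    ∃ (γ : ℤ → ℤ → Sub T Bd.M) (o : ℤ), (∀ i, GoodCol R Vr (γ i)) ∧
      (∀ i l, x i l = S.F (l + o) (γ i ((l + o) / S.B))) ∧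
      ∀ i n, (γ i n).Adj (γ (i + 1) n) := by
  have hB : (0 : ℤ) < S.B := by exact_mod_cast S.hB
  choose γ o hγ hc using hcol
  have hstep : ∀ i, (S.B : ℤ) ∣ o (i + 1) - o i := fun i => by
    by_contra hd
    obtain ⟨r, hr⟩ := S.exists_nonedge Bd hd (γ i 0).pos (γ (i + 1) 0).pos
    apply hr (γ i (r / S.B)) (γ (i + 1) ((r - o i + o (i + 1)) / S.B))
      ((hγ i).pos_eq _ _ _) ((hγ (i + 1)).pos_eq _ _ _)
    have := hx i (r - o i)
    rw [hc, hc, sub_add_cancel] at this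
    have e : r + (o (i + 1) - o i) = r - o i + o (i + 1) := by ring
    rw [e]; exact this
  choose d hd using int_dvd_sub_of_step hstep
  have hc' : ∀ i l, x i l = S.F (l + o 0) (γ i ((l + o 0) / S.B + d i)) := fun i l => by
    have e : l + o i = l + o 0 + S.B * d i := by rw [← hd]; ring
    rw [hc, e, S.per, Int.add_mul_ediv_left _ _ hB.ne']
  refine ⟨fun i n => γ i (n + d i), o 0, fun i => (hγ i).shift _ _, hc', fun i n => ?_⟩
  by_contra hadj
  obtain ⟨φ, hφ, hne⟩ := Bd.exists_hom_nonedge R _ _ ((hγ i).valid _) ((hγ (i + 1)).valid _) hadj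
  obtain ⟨r, rfl⟩ := S.surj φ hφ
  apply hne
  have e0 := Int.emod_nonneg r hB.ne'
  have e1 := Int.emod_lt_of_pos r hB
  have hr : ∀ g, S.F r g = S.F (r % S.B) g := fun g => by
    conv_lhs => rw [← Int.emod_add_mul_ediv r S.B, S.per]
  have := hx i (r % S.B + S.B * n - o 0)
  rw [hc', hc', sub_add_cancel, S.per, Int.add_mul_ediv_left _ _ hB.ne',
    Int.ediv_eq_zero_of_lt e0 e1, zero_add] at this
  rwa [hr, hr]

end Decode

theorem Sub.Adj.pos_eq {T : Type*} {M : ℕ} (hM : 2 ≤ M) {g g' : Sub T M} (h : g.Adj g') :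
    g'.pos = (g.pos + 1) % M := by
  rcases g with a | ⟨a, b, j⟩ <;> rcases g' with a' | ⟨a', b', j'⟩
  · exact h.elim
  · simp only [Sub.pos]; rw [h.2, Nat.mod_eq_of_lt (by omega)]
  · simp only [Sub.pos]; rw [h.2, Nat.mod_self]
  · have := j'.2
    have := h.2.2
    simp only [Sub.pos]; rw [this, Nat.mod_eq_of_lt (by omega)]

/-- Following a path of adjacent valid vertices through a subdivided edge. -/
theorem Sub.follow {T : Type*} {R : T → T → Prop} {M : ℕ} (hM : 2 ≤ M) {γ : ℤ → Sub T M}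
    (hv : ∀ i, (γ i).Valid R) (hadj : ∀ i, (γ i).Adj (γ (i + 1))) {i : ℤ} {a a' : T}
    (h0 : γ i = .inl a) (h1 : γ (i + M) = .inl a') : R a a' := by
  have hb : ∃ b, ∃ j : Fin M, γ (i + 1) = .inr (a, b, j) ∧ (j : ℕ) = 1 := by
    have := hadj i
    rw [h0] at this
    rcases hg : γ (i + 1) with c | ⟨c, b, j⟩
    · rw [hg] at this; exact this.elim
    · rw [hg] at this
      exact ⟨b, j, by rw [this.1], this.2⟩
  obtain ⟨b, j1, hj1, hj1'⟩ := hb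
  have key : ∀ t : ℕ, (ht : t + 1 < M) → γ (i + (t + 1 : ℕ)) = .inr (a, b, ⟨t + 1, ht⟩) := by
    intro t
    induction t with
    | zero =>
      intro ht
      have : j1 = ⟨1, ht⟩ := Fin.ext hj1'
      rw [← this, ← hj1]; norm_num
    | succ t ih =>
      intro ht
      have := hadj (i + (t + 1 : ℕ))
      have e : i + (t + 1 : ℕ) + 1 = i + (t + 1 + 1 : ℕ) := by push_cast; ring
      rw [ih (by omega), e] at this
      rcases hg : γ (i + (t + 1 + 1 : ℕ)) with c | ⟨c, d, j⟩
      · rw [hg] at this; have := this.2; simp only at this; omega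
      · rw [hg] at this
        obtain ⟨rfl, rfl, hj⟩ := this
        have : j = ⟨t + 1 + 1, ht⟩ := Fin.ext hj
        rw [this]
  have hl := key (M - 2) (by omega)
  have hlast := hadj (i + (M - 2 + 1 : ℕ))
  have e : i + (M - 2 + 1 : ℕ) + 1 = i + M := by omega
  have hvl := hv (i + (M - 2 + 1 : ℕ))
  rw [e, h1, hl] at hlast
  rw [hl] at hvl
  rw [← hlast.1]; exact hvl.1

/-- Tilings of the plane with forbidden column words. -/
def Tiles {T : Type*} (R Vr : T → T → Prop) (G : List (List T)) : Prop :=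
  ∃ z : ℤ → ℤ → T, (∀ i j, R (z i j) (z (i + 1) j)) ∧ (∀ i j, Vr (z i j) (z i (j + 1))) ∧
    ∀ w ∈ G, ∀ i j, ¬ OccAt j w (z i)

theorem Bad.embed {K : Type} [Finite K] {E : K → K → Prop} (Bd : Bad E) {T : Type*} [Finite T]
    (R Vr : T → T → Prop) :
    ∃ (Fixed : List (List K)) (code : T → List K), ∀ G : List (List T),
      Tiles R Vr G ↔ (XHV (vertexShift E)
        {x | ∀ w ∈ Fixed ++ G.map (fun w => w.flatMap code), ¬ occursIn1 w x}).Nonempty := by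
  classical
  obtain ⟨S⟩ := Bd.exists_syncRows R
  have hB : (0 : ℤ) < S.B := by exact_mod_cast S.hB
  have hM := Bd.hM₁
  have hM' : (0 : ℤ) < Bd.M := by omega
  let bad : Set (List K) := {w | w.length = 2 * S.B ∧ ¬ S.Window Bd Vr w}
  have hfin : bad.Finite := (List.finite_length_eq K (2 * S.B)).subset fun w hw => hw.1
  refine ⟨hfin.toFinset.toList, fun a => (List.range S.B).map fun r : ℕ => S.F r (.inl a),
    fun G => ⟨?_, ?_⟩⟩
  · rintro ⟨z, hR, hV, hG⟩
    let γ : ℤ → ℤ → Sub T Bd.M := fun i n =>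
      if i % Bd.M = 0 then .inl (z (i / Bd.M) n)
      else .inr (z (i / Bd.M) n, z (i / Bd.M + 1) n, ⟨(i % Bd.M).toNat, by
        have := Int.emod_lt_of_pos i hM'; have := Int.emod_nonneg i hM'.ne'; omega⟩)
    have γ0 : ∀ i n : ℤ, i % Bd.M = 0 → γ i n = .inl (z (i / Bd.M) n) := fun i n h => if_pos h
    have γ1 : ∀ i n : ℤ, ¬ i % Bd.M = 0 → ∃ h, γ i n =
        .inr (z (i / Bd.M) n, z (i / Bd.M + 1) n, ⟨(i % Bd.M).toNat, h⟩) := fun i n h =>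
      ⟨_, if_neg h⟩
    clear_value γ
    have hpos : ∀ i n, (γ i n).pos = (i % Bd.M).toNat := fun i n => by
      by_cases h : i % Bd.M = 0
      · rw [γ0 _ _ h, h]; rfl
      · obtain ⟨h', e⟩ := γ1 i n h
        rw [e]; rfl
    have hgood : ∀ i, GoodCol R Vr (γ i) := fun i => by
      refine ⟨fun n => ?_, fun n => by rw [hpos, hpos], fun n a b ha hb => ?_⟩
      · by_cases h : i % Bd.M = 0
        · rw [γ0 _ _ h]; trivial
        · have := Int.emod_nonneg i hM'.ne'
          obtain ⟨h', e⟩ := γ1 i n h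
          rw [e]
          simp only [Sub.Valid]
          exact ⟨hR _ _, by omega⟩
      · by_cases h : i % Bd.M = 0
        · rw [γ0 _ _ h, Sum.inl.injEq] at ha hb
          rw [← ha, ← hb]; exact hV _ _
        · obtain ⟨h', e⟩ := γ1 i n h
          rw [e] at ha; cases ha
    have hadj : ∀ i n, (γ i n).Adj (γ (i + 1) n) := fun i n => by
      have h0 := Int.emod_nonneg i hM'.ne'
      have h1 := Int.emod_lt_of_pos i hM'
      have h2 := Int.emod_add_mul_ediv i Bd.M
      by_cases hl : i % Bd.M + 1 = Bd.M
      · have e : i + 1 = Bd.M * (i / Bd.M + 1) := by linarith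
        have e1 : (i + 1) % Bd.M = 0 := by rw [e]; simp
        have e2 : (i + 1) / Bd.M = i / Bd.M + 1 := by
          rw [e, Int.mul_ediv_cancel_left _ hM'.ne']
        have e3 : ¬ i % Bd.M = 0 := by omega
        obtain ⟨h', e4⟩ := γ1 i n e3
        rw [γ0 _ _ e1, e4, e2]
        exact ⟨rfl, by dsimp only; omega⟩
      · have e : i + 1 = (i % Bd.M + 1) + Bd.M * (i / Bd.M) := by linarith
        have e1 : (i + 1) % Bd.M = i % Bd.M + 1 := by
          conv_lhs => rw [e, Int.add_mul_emod_self_left, Int.emod_eq_of_lt (by omega) (by omega)]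
        have e2 : (i + 1) / Bd.M = i / Bd.M := by
          conv_lhs => rw [e, Int.add_mul_ediv_left _ _ hM'.ne',
            Int.ediv_eq_zero_of_lt (by omega) (by omega), zero_add]
        have e3 : ¬ (i % Bd.M + 1 = 0) := by omega
        by_cases h : i % Bd.M = 0
        · obtain ⟨h', e4⟩ := γ1 (i + 1) n (by omega)
          rw [γ0 _ _ h, e4, e2]
          exact ⟨rfl, by dsimp only; omega⟩
        · obtain ⟨h', e4⟩ := γ1 (i + 1) n (by omega)
          obtain ⟨h'', e5⟩ := γ1 i n h
          rw [e4, e5, e2]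
          exact ⟨rfl, rfl, by dsimp only; omega⟩
    refine ⟨fun q => S.F q.2 (γ q.1 (q.2 / S.B)), fun j i => ?_, fun i w hw => ?_⟩
    · exact S.hom j _ _ ((hgood i).valid _) ((hgood (i + 1)).valid _) (hadj _ _)
    · rintro ⟨l, hl⟩
      rcases List.mem_append.1 hw with hw | hw
      · have hw : w ∈ bad := by simpa using hw
        exact hw.2 ⟨γ i, l, hgood i, fun t h => (hl t h).symm⟩
      · obtain ⟨w, hwG, rfl⟩ := List.mem_map.1 hw
        have hl := (occAt_flatMap (fun r a => S.F r (.inl a))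
          (x := fun l => S.F l (γ i (l / S.B)))).1 hl
        by_cases hw0 : w = []
        · subst hw0
          exact hG _ hwG 0 0 (by simp [OccAt])
        have hw0 : 0 < w.length := List.length_pos_iff.2 hw0
        have hdvd : (S.B : ℤ) ∣ l := by
          by_contra hd
          obtain ⟨r, hr1, hr2, hr⟩ := S.exists_ne Bd hd 0 (γ i 0).pos 0
          apply hr (.inl (w.get ⟨0, hw0⟩)) (γ i ((r + l) / S.B)) rfl ((hgood i).pos_eq _ _ _)
          have := hl 0 hw0 r.toNat (by omega)
          have e : l + ((0 : ℕ) : ℤ) * S.B + r.toNat = r + l := by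
            rw [Int.toNat_of_nonneg hr1]; push_cast; ring
          rw [e, Int.toNat_of_nonneg hr1] at this
          exact this.symm
        obtain ⟨m, rfl⟩ := hdvd
        have hγ : ∀ n (h : n < w.length), γ i (m + n) = .inl (w.get ⟨n, h⟩) := fun n h => by
          refine S.inl_eq Bd ((hgood i).valid _) (fun r => ?_) rfl
          have e0 := Int.emod_nonneg r hB.ne'
          have e1 := Int.emod_lt_of_pos r hB
          have hr : ∀ g, S.F r g = S.F (r % S.B) g := fun g => by
            conv_lhs => rw [← Int.emod_add_mul_ediv r S.B, S.per]
          have := hl n h (r % S.B).toNat (by omega)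
          have e : S.B * m + n * S.B + ((r % S.B).toNat : ℤ) = r % S.B + S.B * (m + n) := by
            rw [Int.toNat_of_nonneg e0]; ring
          rw [e, S.per, Int.toNat_of_nonneg e0, Int.add_mul_ediv_left _ _ hB.ne',
            Int.ediv_eq_zero_of_lt e0 e1, zero_add] at this
          rw [hr, hr, this]
        apply hG w hwG (i / Bd.M) m
        intro n h
        have := hγ n h
        by_cases h0 : i % Bd.M = 0
        · rw [γ0 _ _ h0] at this
          exact Sum.inl_injective this
        · obtain ⟨h', e⟩ := γ1 i (m + n) h0
          rw [e] at this; cases this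
  · rintro ⟨x, hrow, hcol⟩
    obtain ⟨γ, o, hγ, hx, hadj⟩ := S.adj Bd Vr (x := fun i l => x (i, l)) (fun i l => hrow l i)
      (fun i => S.decode Bd Vr _ fun l => by
        by_contra hwin
        refine hcol i ((List.range (2 * S.B)).map fun t : ℕ => x (i, l + t))
          (List.mem_append_left _ ?_) ⟨l, ?_⟩
        · simpa [bad] using hwin
        · exact (occAt_map_range (f := fun t : ℕ => x (i, l + t)) (x := fun l => x (i, l))).2
            fun r hr => rfl)
    have hp : ∀ i n, (γ (i + 1) n).pos = ((γ i n).pos + 1) % Bd.M := fun i n =>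
      (hadj i n).pos_eq (by omega)
    have hdvd := int_dvd_sub_of_step (B := Bd.M) (g := fun i => ((γ i 0).pos : ℤ) - i) (fun i => by
      rw [hp]
      have := Int.emod_add_mul_ediv ((γ i 0).pos + 1 : ℤ) Bd.M
      push_cast
      exact ⟨-(((γ i 0).pos + 1 : ℤ) / Bd.M), by linarith⟩)
    set i0 : ℤ := -((γ 0 0).pos : ℤ) with hi0
    have hp0 : ∀ i n, (γ (i0 + i * Bd.M) n).pos = 0 := fun i n => by
      rw [(hγ _).pos_eq _ 0 n]
      have h1 := hdvd (i0 + i * Bd.M)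
      have h2 : (Bd.M : ℤ) ∣ i * Bd.M := Dvd.intro_left _ rfl
      have h3 := dvd_add h1 h2
      have e : ((γ (i0 + i * Bd.M) 0).pos : ℤ) - (i0 + i * Bd.M) - (((γ 0 0).pos : ℤ) - 0) + i * Bd.M
        = ((γ (i0 + i * Bd.M) 0).pos : ℤ) := by rw [hi0]; ring
      rw [e] at h3
      have h4 := pos_lt (by omega) (γ (i0 + i * Bd.M) 0)
      exact Nat.eq_zero_of_dvd_of_lt (by exact_mod_cast h3) h4
    have hz : ∀ i n, ∃ a, γ (i0 + i * Bd.M) n = .inl a := fun i n => by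
      have h1 := hp0 i n
      have h2 := (hγ (i0 + i * Bd.M)).valid n
      rcases hg : γ (i0 + i * Bd.M) n with a | ⟨a, b, j⟩
      · exact ⟨a, rfl⟩
      · rw [hg] at h1 h2
        have := h2.2
        simp only [Sub.pos] at h1; omega
    choose z hz using hz
    refine ⟨z, fun i n => ?_, fun i n => ?_, fun w hw i n hocc => ?_⟩
    · refine Sub.follow (M := Bd.M) (by omega) (γ := fun i => γ i n) (fun i => (hγ i).valid n)
        (fun i => hadj i n) (hz i n) ?_
      have e : i0 + i * Bd.M + Bd.M = i0 + (i + 1) * Bd.M := by ring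
      simp only [e, hz]
    · exact (hγ _).vert n _ _ (hz i n) (hz i (n + 1))
    · refine hcol (i0 + i * Bd.M) _ (List.mem_append_right _ (List.mem_map_of_mem hw))
        ⟨S.B * n - o, (occAt_flatMap (fun r a => S.F r (.inl a))
          (x := fun l => x (i0 + i * Bd.M, l))).2 fun m h r hr => ?_⟩
      have e : S.B * n - o + m * S.B + r + o = r + S.B * (n + m) := by ring
      change x (i0 + i * Bd.M, S.B * n - o + m * S.B + r) = _
      have hx' := hx (i0 + i * Bd.M) (S.B * n - o + m * S.B + r)
      rw [hx', e, S.per, Int.add_mul_ediv_left _ _ hB.ne', Int.ediv_eq_zero_of_lt (by omega)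
        (by exact_mod_cast hr), zero_add, hz, hocc m h]


/-- `x - a` is divisible by `p ^ n` but not by `p ^ (n + 1)`. -/
def Exact (p : ℤ) (n : ℕ) (a x : ℤ) : Prop :=
  p ^ n ∣ x - a ∧ ¬ p ^ (n + 1) ∣ x - a

/-- Local rules of the `p`-adic hierarchical structure on the plane. -/
structure PadicSystem (p : ℤ) where
  δ : ℤ → ℤ → ℤ
  I : ℤ → ℤ → ℤ
  J : ℤ → ℤ → ℤ
  u : ℤ → ℤ
  w : ℤ → ℤ
  α : ℤ
  β : ℤ
  two_le : 2 ≤ p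
  le_δ : ∀ x y, -2 ≤ δ x y
  δ_le : ∀ x y, δ x y ≤ 2
  stepI₀ : ∀ x y, ¬ p ∣ y - β → p ^ 3 ∣ I (x + 1) y - (I x y + p)
  stepI₁ : ∀ x y, p ∣ y - β → -1 ≤ δ (x + 1) y → p ^ 3 ∣ I (x + 1) y - (I x y + 1)
  stepI₂ : ∀ x y, p ∣ y - β → δ (x + 1) y = -2 → p ^ 3 ∣ I (x + 1) y - I x y
  stepJ₀ : ∀ x y, ¬ p ∣ x - α → p ^ 3 ∣ J x (y + 1) - (J x y + p)
  stepJ₁ : ∀ x y, p ∣ x - α → δ x (y + 1) ≤ 1 → p ^ 3 ∣ J x (y + 1) - (J x y + 1)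
  stepJ₂ : ∀ x y, p ∣ x - α → δ x (y + 1) = 2 → p ^ 3 ∣ J x (y + 1) - J x y
  I_neg : ∀ x y, δ x y = -1 → ¬ p ∣ I x y
  I_zero : ∀ x y, δ x y = 0 → p ∣ I x y ∧ ¬ p ^ 2 ∣ I x y
  I_one : ∀ x y, δ x y = 1 → p ^ 2 ∣ I x y ∧ ¬ p ^ 3 ∣ I x y
  I_two : ∀ x y, δ x y = 2 → p ^ 3 ∣ I x y
  J_neg : ∀ x y, δ x y = 1 → ¬ p ∣ J x y
  J_zero : ∀ x y, δ x y = 0 → p ∣ J x y ∧ ¬ p ^ 2 ∣ J x y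
  J_one : ∀ x y, δ x y = -1 → p ^ 2 ∣ J x y ∧ ¬ p ^ 3 ∣ J x y
  J_two : ∀ x y, δ x y = -2 → p ^ 3 ∣ J x y
  I_eq : ∀ x y, δ x y = 0 → p ^ 3 ∣ I x y - u x
  J_eq : ∀ x y, δ x y = 0 → p ^ 3 ∣ J x y - w y
  base_zero : ∀ x y, ¬ p ∣ x - α → ¬ p ∣ y - β → δ x y = 0
  base_neg : ∀ x y, ¬ p ∣ x - α → p ∣ y - β → δ x y < 0
  base_pos : ∀ x y, p ∣ x - α → ¬ p ∣ y - β → 0 < δ x y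

namespace PadicSystem

variable {p : ℤ}

/-- Exchange the two coordinates. -/
def swap (S : PadicSystem p) : PadicSystem p where
  δ x y := -S.δ y x
  I x y := S.J y x
  J x y := S.I y x
  u := S.w
  w := S.u
  α := S.β
  β := S.α
  two_le := S.two_le
  le_δ x y := by have := S.δ_le y x; omega
  δ_le x y := by have := S.le_δ y x; omega
  stepI₀ x y := S.stepJ₀ y x
  stepI₁ x y h h' := S.stepJ₁ y x h (by omega)
  stepI₂ x y h h' := S.stepJ₂ y x h (by omega)
  stepJ₀ x y := S.stepI₀ y x
  stepJ₁ x y h h' := S.stepI₁ y x h (by omega)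
  stepJ₂ x y h h' := S.stepI₂ y x h (by omega)
  I_neg x y h := S.J_neg y x (by omega)
  I_zero x y h := S.J_zero y x (by omega)
  I_one x y h := S.J_one y x (by omega)
  I_two x y h := S.J_two y x (by omega)
  J_neg x y h := S.I_neg y x (by omega)
  J_zero x y h := S.I_zero y x (by omega)
  J_one x y h := S.I_one y x (by omega)
  J_two x y h := S.I_two y x (by omega)
  I_eq x y h := S.J_eq y x (by omega)
  J_eq x y h := S.I_eq y x (by omega)
  base_zero x y h h' := by have := S.base_zero y x h' h; omega
  base_neg x y h h' := by have := S.base_pos y x h' h; omega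
  base_pos x y h h' := by have := S.base_neg y x h' h; omega

/-- The structure is determined up to level `n`, with origin `(a, b)` modulo `p ^ (n + 1)`. -/
structure Level (S : PadicSystem p) (n : ℕ) (a b : ℤ) : Prop where
  hα : p ∣ a - S.α
  hβ : p ∣ b - S.β
  zero : ∀ x y, Exact p n a x → Exact p n b y → S.δ x y = 0
  neg : ∀ x y, Exact p n a x → p ^ (n + 1) ∣ y - b → S.δ x y < 0
  pos : ∀ x y, p ^ (n + 1) ∣ x - a → Exact p n b y → 0 < S.δ x y
  incI : ∀ x y, Exact p n b y → p ^ n ∣ x - a → p ^ 3 ∣ S.I (x + p ^ n) y - (S.I x y + p)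
  incJ : ∀ x y, Exact p n a x → p ^ n ∣ y - b → p ^ 3 ∣ S.J x (y + p ^ n) - (S.J x y + p)
  lowI : ∀ x y, p ^ (n + 1) ∣ x - a → ¬ p ^ n ∣ y - b → S.δ x y = 2
  lowJ : ∀ x y, p ^ (n + 1) ∣ y - b → ¬ p ^ n ∣ x - a → S.δ x y = -2

theorem Level.swap {S : PadicSystem p} {n : ℕ} {a b : ℤ} (h : S.Level n a b) :
    S.swap.Level n b a where
  hα := h.hβ
  hβ := h.hα
  zero x y hx hy := by have := h.zero y x hy hx; simp only [PadicSystem.swap]; omega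
  neg x y hx hy := by have := h.pos y x hy hx; simp only [PadicSystem.swap]; omega
  pos x y hx hy := by have := h.neg y x hy hx; simp only [PadicSystem.swap]; omega
  incI x y hx hy := h.incJ y x hx hy
  incJ x y hx hy := h.incI y x hx hy
  lowI x y hx hy := by have := h.lowJ y x hx hy; simp only [PadicSystem.swap]; omega
  lowJ x y hx hy := by have := h.lowI y x hx hy; simp only [PadicSystem.swap]; omega

theorem level_zero (S : PadicSystem p) : S.Level 0 S.α S.β where
  hα := by simp
  hβ := by simp
  zero x y hx hy := S.base_zero x y (by simpa using hx.2) (by simpa using hy.2)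
  neg x y hx hy := S.base_neg x y (by simpa using hx.2) (by simpa using hy)
  pos x y hx hy := S.base_pos x y (by simpa using hx) (by simpa using hy.2)
  incI x y hy _ := by simpa using S.stepI₀ x y (by simpa using hy.2)
  incJ x y hx _ := by simpa using S.stepJ₀ x y (by simpa using hx.2)
  lowI x y _ h := absurd (by simp) h
  lowJ x y _ h := absurd (by simp) h

theorem exact_add {n : ℕ} {a x t : ℤ} (hp : 2 ≤ p) (hx : p ^ (n + 1) ∣ x - a) (ht : ¬ p ∣ t) :
    Exact p n a (x + p ^ n * t) := by
  obtain ⟨s, hs⟩ := hx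
  have e : x + p ^ n * t - a = p ^ n * (p * s + t) := by linear_combination hs
  have h0 : p ^ n ≠ 0 := pow_ne_zero _ (by omega)
  refine ⟨⟨_, e⟩, ?_⟩
  rw [e, pow_succ, mul_dvd_mul_iff_left h0]
  exact fun h => ht ((Int.dvd_add_right (Dvd.intro _ rfl)).1 h)

theorem not_dvd_of_lt {t : ℤ} (h0 : 0 < t) (h1 : t < p) : ¬ p ∣ t := fun h => by
  have := Int.le_of_dvd h0 h; omega

theorem Level.incI_mul {S : PadicSystem p} {n : ℕ} {a b : ℤ} (h : S.Level n a b) {x y : ℤ}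
    (hy : Exact p n b y) (hx : p ^ n ∣ x - a) (t : ℤ) :
    p ^ 3 ∣ S.I (x + p ^ n * t) y - (S.I x y + p * t) := by
  have key : ∀ t : ℤ, p ^ 3 ∣ S.I (x + p ^ n * (t + 1)) y - (S.I (x + p ^ n * t) y + p) :=
    fun t => by
      have := h.incI (x + p ^ n * t) y hy (by
        rw [add_sub_right_comm]; exact dvd_add hx (Dvd.intro _ rfl))
      rwa [show x + p ^ n * (t + 1) = x + p ^ n * t + p ^ n by ring]
  induction t using Int.induction_on with
  | zero => simp
  | succ i ih =>
    have := dvd_add (key i) ih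
    refine this.trans (dvd_of_eq ?_); ring
  | pred i ih =>
    have := dvd_sub ih (key (-i - 1))
    rw [show (-(i : ℤ) - 1 + 1) = -i by ring] at this
    refine this.trans (dvd_of_eq ?_); ring

theorem Level.exists_next {S : PadicSystem p} {n : ℕ} {a b : ℤ} (h : S.Level n a b) :
    ∃ a', p ^ (n + 1) ∣ a' - a ∧ ∀ x y, Exact p n b y →
      (Exact p (n + 1) a' x → S.δ x y = 1) ∧ (p ^ (n + 2) ∣ x - a' → S.δ x y = 2) := by
  have hp := S.two_le
  have h0 : p ^ (n + 1) ≠ 0 := pow_ne_zero _ (by omega)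
  have h2 : p ^ 2 ≠ 0 := pow_ne_zero _ (by omega)
  have h1 : ¬ p ∣ 1 := not_dvd_of_lt (by omega) (by omega)
  have hy0 : Exact p n b (b + p ^ n * 1) := exact_add hp (by simp) h1
  have hx1 : Exact p n a (a + p ^ n * 1) := exact_add hp (by simp) h1
  set y₀ := b + p ^ n * 1
  have hpos := h.pos a y₀ (by simp) hy0
  have hle := S.δ_le a y₀
  obtain ⟨κ, hκ⟩ : p ^ 2 ∣ S.I a y₀ := by
    rcases (by omega : S.δ a y₀ = 1 ∨ S.δ a y₀ = 2) with e | e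
    · exact (S.I_one _ _ e).1
    · exact (pow_dvd_pow p (by norm_num)).trans (S.I_two _ _ e)
  refine ⟨a - p ^ (n + 1) * κ, ⟨-κ, by ring⟩, fun x y hy => ?_⟩
  have hIy : p ^ 3 ∣ S.I a y - S.I a y₀ := by
    have e1 := h.incI_mul hy (x := a) (by simp) 1
    have e2 := h.incI_mul hy0 (x := a) (by simp) 1
    have e3 := S.I_eq _ _ (h.zero _ _ hx1 hy)
    have e4 := S.I_eq _ _ (h.zero _ _ hx1 hy0)
    have := dvd_sub (dvd_sub e3 e4) (dvd_sub e1 e2)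
    refine this.trans (dvd_of_eq ?_); ring
  have key : p ^ (n + 1) ∣ x - (a - p ^ (n + 1) * κ) →
      0 < S.δ x y ∧ ∀ c, (p ^ (n + 2) ∣ x - (a - p ^ (n + 1) * κ) ↔ p ^ 3 ∣ S.I x y - c * p ^ 3) := by
    rintro ⟨s, hs⟩
    have hx : x = a + p ^ n * (p * (s - κ)) := by linear_combination hs
    have e1 := h.incI_mul hy (x := a) (by simp) (p * (s - κ))
    rw [← hx] at e1
    refine ⟨h.pos x y ⟨s - κ, by rw [hx]; ring⟩ hy, fun c => ?_⟩
    have e2 := dvd_add e1 hIy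
    have e3 : S.I x y - c * p ^ 3 = (S.I x y - (S.I a y + p * (p * (s - κ))) + (S.I a y - S.I a y₀)
        - c * p ^ 3) + p ^ 2 * s := by rw [hκ]; ring
    rw [hs, e3, dvd_add_right (dvd_sub e2 (Dvd.intro_left _ rfl)), pow_succ p (n + 1), pow_succ p 2,
      mul_dvd_mul_iff_left h0, mul_dvd_mul_iff_left h2]
  have hle := S.δ_le x y
  refine ⟨fun hx => ?_, fun hx => ?_⟩
  · obtain ⟨k1, k2⟩ := key hx.1
    have k2 := k2 0
    rw [zero_mul, sub_zero] at k2
    by_contra hne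
    exact hx.2 (k2.2 (S.I_two _ _ (by omega)))
  · obtain ⟨k1, k2⟩ := key ((pow_dvd_pow p (by omega)).trans hx)
    have k2 := k2 0
    rw [zero_mul, sub_zero] at k2
    by_contra hne
    exact (S.I_one x y (by omega)).2 (k2.1 hx)

theorem Level.incJ_unit {S : PadicSystem p} {n : ℕ} {a b : ℤ} (h : S.Level n a b) {x y : ℤ}
    (hx : p ^ (n + 1) ∣ x - a) (hy : p ^ n ∣ y - b) :
    (S.δ x (y + p ^ n) ≤ 1 → p ^ 3 ∣ S.J x (y + p ^ n) - (S.J x y + 1)) ∧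
    (S.δ x (y + p ^ n) = 2 → p ^ 3 ∣ S.J x (y + p ^ n) - S.J x y) := by
  have hp := S.two_le
  have hP : 0 < p ^ n := pow_pos (by omega) _
  have hα : p ∣ x - S.α := by
    have := dvd_add ((dvd_pow_self p (Nat.succ_ne_zero n)).trans hx) h.hα
    simpa using this
  have key : ∀ i : ℕ, (i : ℤ) < p ^ n → p ^ 3 ∣ S.J x (y + i) - S.J x y := fun i => by
    induction i with
    | zero => simp
    | succ i ih =>
      intro hi
      push_cast at hi
      have := S.stepJ₂ x (y + i) hα (h.lowI _ _ hx fun hd => by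
        have e : y + i + 1 - b = (y - b) + (i + 1) := by ring
        rw [e, Int.dvd_add_right hy] at hd
        have := Int.le_of_dvd (by omega) hd
        omega)
      have := dvd_add this (ih (by omega))
      push_cast
      rw [← add_assoc]
      refine this.trans (dvd_of_eq ?_); ring
  obtain ⟨i, hi⟩ : ∃ i : ℕ, (i : ℤ) = p ^ n - 1 := ⟨(p ^ n - 1).toNat, by omega⟩
  have k := key i (by omega)
  have e : y + p ^ n = y + i + 1 := by omega
  rw [e]
  refine ⟨fun hd => ?_, fun hd => ?_⟩
  · refine (dvd_add (S.stepJ₁ x (y + i) hα hd) k).trans (dvd_of_eq ?_); ring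
  · refine (dvd_add (S.stepJ₂ x (y + i) hα hd) k).trans (dvd_of_eq ?_); ring

theorem Level.col_next {S : PadicSystem p} {n : ℕ} {a b x : ℤ} (h : S.Level n a b)
    (hx : p ^ (n + 1) ∣ x - a) (hx1 : ∀ y, Exact p n b y → S.δ x y = 1) {y : ℤ}
    (hy : p ^ (n + 1) ∣ y - b) :
    S.δ x y ≤ 0 ∧ p ∣ S.J x y ∧ p ^ 3 ∣ S.J x (y + p ^ (n + 1)) - (S.J x y + p) := by
  have hp := S.two_le
  have hp3 : p ∣ p ^ 3 := dvd_pow_self p (by norm_num)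
  have hpn : p ^ n ∣ p ^ (n + 1) := pow_dvd_pow p (by omega)
  have run : ∀ y, p ^ (n + 1) ∣ y - b → ∀ t : ℕ, (t : ℤ) < p →
      p ^ 3 ∣ S.J x (y + p ^ n * t) - (S.J x y + t) := fun y hy t => by
    induction t with
    | zero => simp
    | succ t ih =>
      intro ht
      push_cast at ht
      have e : y + p ^ n * (t + 1 : ℕ) = y + p ^ n * t + p ^ n := by push_cast; ring
      have hex : Exact p n b (y + p ^ n * t + p ^ n) := by
        rw [← e]; exact exact_add hp hy (not_dvd_of_lt (by push_cast; omega) (by push_cast; omega))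
      have := (h.incJ_unit (y := y + p ^ n * t) hx (by
        rw [add_sub_right_comm]; exact dvd_add (hpn.trans hy) (Dvd.intro _ rfl))).1
          (by rw [hx1 _ hex])
      rw [e]
      refine (dvd_add this (ih (by omega))).trans (dvd_of_eq ?_)
      push_cast; ring
  have dvdJ : ∀ y, p ^ (n + 1) ∣ y - b → p ∣ S.J x y := fun y hy => by
    have t0 := Int.emod_nonneg (-S.J x y) (b := p) (by omega)
    have t1 := Int.emod_lt_of_pos (-S.J x y) (b := p) (by omega)
    have t2 := Int.emod_add_mul_ediv (-S.J x y) p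
    set t := -S.J x y % p
    by_cases ht : t = 0
    · exact ⟨-(-S.J x y / p), by linarith⟩
    exfalso
    have := run y hy t.toNat (by omega)
    rw [Int.toNat_of_nonneg t0] at this
    refine S.J_neg _ _ (hx1 _ (exact_add hp hy (not_dvd_of_lt (t := t) (by omega) t1))) ?_
    have e : S.J x y + t = p * (-(-S.J x y / p)) := by linarith
    rw [e] at this
    exact (dvd_sub_left (Dvd.intro _ rfl)).1 (hp3.trans this)
  have hstep : ∀ y, p ^ (n + 1) ∣ y - b → S.δ x (y + p ^ (n + 1)) ≤ 1 ∧
      p ^ 3 ∣ S.J x (y + p ^ (n + 1)) - (S.J x y + p) := fun y hy => by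
    have h1 := run y hy (p - 1).toNat (by omega)
    rw [Int.toNat_of_nonneg (by omega)] at h1
    have h2 := h.incJ_unit (y := y + p ^ n * (p - 1)) hx (by
        rw [add_sub_right_comm]; exact dvd_add (hpn.trans hy) (Dvd.intro _ rfl))
    have e : y + p ^ n * (p - 1) + p ^ n = y + p ^ (n + 1) := by ring
    rw [e] at h2
    have hle := S.δ_le x (y + p ^ (n + 1))
    by_cases hd : S.δ x (y + p ^ (n + 1)) ≤ 1
    · refine ⟨hd, (dvd_add (h2.1 hd) h1).trans (dvd_of_eq ?_)⟩
      ring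
    · exfalso
      have h3 := hp3.trans (dvd_add (h2.2 (by omega)) h1)
      have h4 := dvd_sub (dvdJ (y + p ^ (n + 1)) (by
        rw [add_sub_right_comm]; exact dvd_add hy dvd_rfl)) (dvdJ y hy)
      have h5 := dvd_sub h4 h3
      refine not_dvd_of_lt (t := p - 1) (by omega) (by omega) (h5.trans (dvd_of_eq ?_))
      ring
  have h1 := (hstep (y - p ^ (n + 1)) (by
    rw [sub_right_comm]; exact dvd_sub hy dvd_rfl)).1
  rw [sub_add_cancel] at h1
  have h2 : S.δ x y ≠ 1 := fun e => S.J_neg _ _ e (dvdJ y hy)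
  exact ⟨by omega, dvdJ y hy, (hstep y hy).2⟩

theorem exact_congr {n : ℕ} {a a' x : ℤ} (h : p ^ (n + 1) ∣ a' - a) :
    Exact p n a' x ↔ Exact p n a x := by
  have e : x - a = (x - a') + (a' - a) := by ring
  rw [Exact, Exact, e, dvd_add_left h, dvd_add_left ((pow_dvd_pow p (by omega)).trans h)]

theorem dvd_congr {n : ℕ} {a a' x : ℤ} (h : p ^ n ∣ a' - a) :
    p ^ n ∣ x - a' ↔ p ^ n ∣ x - a := by
  have e : x - a = (x - a') + (a' - a) := by ring
  rw [e, dvd_add_left h]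

theorem col_neg (S : PadicSystem p) {n : ℕ} {b x : ℤ}
    (hx : ∀ y, p ^ n ∣ y - b → S.δ x y ≤ 0 ∧ p ∣ S.J x y ∧
      p ^ 3 ∣ S.J x (y + p ^ n) - (S.J x y + p))
    (hx0 : ∀ y, Exact p n b y → S.δ x y = 0) {y : ℤ} (hy : p ^ (n + 1) ∣ y - b) :
    S.δ x y < 0 := by
  have hp := S.two_le
  have hy' : p ^ n ∣ y - b := (pow_dvd_pow p (by omega)).trans hy
  have run : ∀ t : ℕ, p ^ 3 ∣ S.J x (y + p ^ n * t) - (S.J x y + p * t) := fun t => by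
    induction t with
    | zero => simp
    | succ t ih =>
      have := (hx (y + p ^ n * t) (by
        rw [add_sub_right_comm]; exact dvd_add hy' (Dvd.intro _ rfl))).2.2
      have e : y + p ^ n * (t + 1 : ℕ) = y + p ^ n * t + p ^ n := by push_cast; ring
      rw [e]
      refine (dvd_add this ih).trans (dvd_of_eq ?_)
      push_cast; ring
  obtain ⟨k1, ⟨c, hc⟩, -⟩ := hx y hy'
  have t0 := Int.emod_nonneg (-c) (b := p) (by omega)
  have t1 := Int.emod_lt_of_pos (-c) (b := p) (by omega)
  have t2 := Int.emod_add_mul_ediv (-c) p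
  set t := -c % p
  have hsq : p ^ 2 ∣ S.J x y := by
    by_cases ht : t = 0
    · refine ⟨-(-c / p), ?_⟩
      rw [hc]; linear_combination p * (t2 - ht)
    exfalso
    have h1 := run t.toNat
    rw [Int.toNat_of_nonneg t0] at h1
    refine (S.J_zero _ _ (hx0 _ (exact_add hp hy
      (not_dvd_of_lt (t := t) (by omega) t1)))).2 ?_
    have e : S.J x y + p * t = p ^ 2 * (-(-c / p)) := by rw [hc]; linear_combination p * t2
    rw [e] at h1
    exact (dvd_sub_left (Dvd.intro _ rfl)).1 ((pow_dvd_pow p (by norm_num)).trans h1)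
  have : S.δ x y ≠ 0 := fun h0 => (S.J_zero _ _ h0).2 hsq
  omega

theorem Level.next {S : PadicSystem p} {n : ℕ} {a b : ℤ} (h : S.Level n a b) :
    ∃ a' b', p ^ (n + 1) ∣ a' - a ∧ p ^ (n + 1) ∣ b' - b ∧ S.Level (n + 1) a' b' ∧
      ∀ x y, Exact p (n + 1) a' x → Exact p n b' y → S.δ x y = 1 := by
  have hp := S.two_le
  obtain ⟨a', ha, hI⟩ := h.exists_next
  obtain ⟨b', hb, hJ⟩ := h.swap.exists_next
  have hJ' : ∀ x y, Exact p n a x →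
      (Exact p (n + 1) b' y → S.δ x y = -1) ∧ (p ^ (n + 2) ∣ y - b' → S.δ x y = -2) := by
    intro x y hx
    have := hJ y x hx
    simp only [PadicSystem.swap] at this
    exact ⟨fun h => by have := this.1 h; omega, fun h => by have := this.2 h; omega⟩
  have hcol : ∀ x y, Exact p (n + 1) a' x → p ^ (n + 1) ∣ y - b' → S.δ x y ≤ 0 ∧ p ∣ S.J x y ∧
      p ^ 3 ∣ S.J x (y + p ^ (n + 1)) - (S.J x y + p) := fun x y hx hy =>
    h.col_next ((dvd_congr ha).1 hx.1) (fun y hy => (hI x y hy).1 hx) ((dvd_congr hb).1 hy)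
  have hrow : ∀ x y, p ^ (n + 1) ∣ x - a' → Exact p (n + 1) b' y → 0 ≤ S.δ x y ∧ p ∣ S.I x y ∧
      p ^ 3 ∣ S.I (x + p ^ (n + 1)) y - (S.I x y + p) := fun x y hx hy => by
    have := h.swap.col_next (x := y) ((dvd_congr hb).1 hy.1) (fun x hx => (hJ y x hx).1 hy)
      ((dvd_congr ha).1 hx)
    simp only [PadicSystem.swap] at this
    exact ⟨by omega, this.2⟩
  have hzero : ∀ x y, Exact p (n + 1) a' x → Exact p (n + 1) b' y → S.δ x y = 0 :=
    fun x y hx hy => le_antisymm (hcol x y hx hy.1).1 (hrow x y hx.1 hy).1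
  have pn : ∀ m : ℕ, p ∣ p ^ (m + 1) := fun m => dvd_pow_self p (Nat.succ_ne_zero m)
  have pn2 : p ^ (n + 1) ∣ p ^ (n + 2) := pow_dvd_pow p (by omega)
  refine ⟨a', b', ha, hb, ⟨?_, ?_, hzero, ?_, ?_, ?_, ?_, ?_, ?_⟩, ?_⟩
  · have := dvd_add ((pn n).trans ha) h.hα; simpa using this
  · have := dvd_add ((pn n).trans hb) h.hβ; simpa using this
  · exact fun x y hx hy => S.col_neg (fun y hy => hcol x y hx hy) (fun y hy => hzero x y hx hy) hy
  · intro x y hx hy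
    have := S.swap.col_neg (x := y) (n := n + 1) (b := a') (fun x hx => by
        obtain ⟨k1, k2⟩ := hrow x y hx hy
        exact ⟨by simp only [PadicSystem.swap]; omega, k2⟩)
      (fun x hx => by simp only [PadicSystem.swap]; have := hzero x y hx hy; omega) hx
    simp only [PadicSystem.swap] at this
    omega
  · exact fun x y hy hx => (hrow x y hx hy).2.2
  · exact fun x y hx hy => (hcol x y hx hy).2.2
  · intro x y hx hy
    rw [dvd_congr hb] at hy
    by_cases hyn : p ^ n ∣ y - b
    · exact (hI x y ⟨hyn, hy⟩).2 hx
    · exact h.lowI x y ((dvd_congr ha).1 (pn2.trans hx)) hyn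
  · intro x y hy hx
    rw [dvd_congr ha] at hx
    by_cases hxn : p ^ n ∣ x - a
    · exact (hJ' x y ⟨hxn, hx⟩).2 hy
    · exact h.lowJ x y ((dvd_congr hb).1 (pn2.trans hy)) hxn
  · exact fun x y hx hy => (hI x y ((exact_congr hb).1 hy)).1 hx

theorem exists_levels (S : PadicSystem p) :
    ∃ a b : ℕ → ℤ, a 0 = S.α ∧ b 0 = S.β ∧
      (∀ n, p ^ (n + 1) ∣ a (n + 1) - a n) ∧ (∀ n, p ^ (n + 1) ∣ b (n + 1) - b n) ∧
      (∀ n, S.Level n (a n) (b n)) ∧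
      (∀ n x y, Exact p (n + 1) (a (n + 1)) x → Exact p n (b n) y → S.δ x y = 1) := by
  have key : ∀ n (q : {q : ℤ × ℤ // S.Level n q.1 q.2}),
      ∃ q' : {q : ℤ × ℤ // S.Level (n + 1) q.1 q.2},
      p ^ (n + 1) ∣ q'.1.1 - q.1.1 ∧ p ^ (n + 1) ∣ q'.1.2 - q.1.2 ∧
      ∀ x y, Exact p (n + 1) q'.1.1 x → Exact p n q.1.2 y → S.δ x y = 1 := fun n q => by
    obtain ⟨a', b', h1, h2, h3, h4⟩ := q.2.next
    exact ⟨⟨(a', b'), h3⟩, h1, h2, fun x y hx hy => h4 x y hx ((exact_congr h2).2 hy)⟩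
  choose f hf using key
  let s : ∀ n, {q : ℤ × ℤ // S.Level n q.1 q.2} := fun n =>
    Nat.rec ⟨(S.α, S.β), S.level_zero⟩ (fun n q => f n q) n
  exact ⟨fun n => (s n).1.1, fun n => (s n).1.2, rfl, rfl, fun n => (hf n (s n)).1,
    fun n => (hf n (s n)).2.1, fun n => (s n).2, fun n => (hf n (s n)).2.2⟩

end PadicSystem


section Canonical

variable (p : ℕ)

/-- Truncated difference of valuations. -/
def canonDelta (x y : ℤ) : ℤ :=
  if x = 0 then (if y = 0 then 0 else 2) else if y = 0 then -2 else
    max (-2) (min 2 ((padicValInt p x : ℤ) - padicValInt p y))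

/-- Rescaled position counter. -/
def canonI (x y : ℤ) : ℤ :=
  if y = 0 then (if x < 0 then (p : ℤ) - 1 else p) else p * x / p ^ padicValInt p y

variable {p}

theorem canonDelta_swap (x y : ℤ) : canonDelta p y x = -canonDelta p x y := by
  unfold canonDelta
  by_cases hx : x = 0 <;> by_cases hy : y = 0 <;> simp only [hx, hy, if_true, if_false] <;> omega


theorem canonDelta_cases {x y : ℤ} (hd : -2 < canonDelta p x y) :
    (x = 0 ∧ y = 0) ∨ (x = 0 ∧ y ≠ 0 ∧ canonDelta p x y = 2) ∨ (x ≠ 0 ∧ y ≠ 0 ∧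
      ∃ e : ℕ, padicValInt p x + 1 = padicValInt p y + e ∧
        canonDelta p x y = min 2 ((e : ℤ) - 1)) := by
  by_cases hx : x = 0 <;> by_cases hy : y = 0
  · exact Or.inl ⟨hx, hy⟩
  · exact Or.inr (Or.inl ⟨hx, hy, by simp [canonDelta, hx, hy]⟩)
  · simp [canonDelta, hx, hy] at hd
  · refine Or.inr (Or.inr ⟨hx, hy, padicValInt p x + 1 - padicValInt p y, ?_⟩)
    rw [canonDelta, if_neg hx, if_neg hy] at hd ⊢
    omega

theorem canonDelta_zero : canonDelta p 0 0 = 0 := by simp [canonDelta]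

theorem le_canonDelta (x y : ℤ) : -2 ≤ canonDelta p x y := by
  unfold canonDelta; split_ifs <;> omega

theorem canonI_eq {x y : ℤ} (hd : canonDelta p x y = 0) : canonI p x y = canonI p x x := by
  rcases canonDelta_cases (p := p) (x := x) (y := y) (by omega) with
    ⟨rfl, rfl⟩ | ⟨-, -, h⟩ | ⟨hx, hy, e, he, h⟩
  · rfl
  · omega
  · rw [canonI, canonI, if_neg hx, if_neg hy]
    congr 2; omega

variable [hp : Fact p.Prime]

theorem le_padicValInt_iff {x : ℤ} (hx : x ≠ 0) (n : ℕ) :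
    n ≤ padicValInt p x ↔ (p : ℤ) ^ n ∣ x := by
  rw [padicValInt_dvd_iff]; simp [hx]

theorem padicValInt_eq_zero' {x : ℤ} (hx : ¬ (p : ℤ) ∣ x) : x ≠ 0 ∧ padicValInt p x = 0 := by
  have h0 : x ≠ 0 := by rintro rfl; simp at hx
  refine ⟨h0, ?_⟩
  by_contra h
  exact hx (by simpa using (le_padicValInt_iff h0 1).1 (by omega))

theorem padicValInt_pos' {x : ℤ} (h0 : x ≠ 0) (hx : (p : ℤ) ∣ x) : 1 ≤ padicValInt p x :=
  (le_padicValInt_iff h0 1).2 (by simpa using hx)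

theorem canonI_unit {x y : ℤ} (hx : x ≠ 0) (hy : y ≠ 0) {e : ℕ}
    (he : padicValInt p x + 1 = padicValInt p y + e) (k : ℕ) :
    (p : ℤ) ^ k ∣ canonI p x y ↔ k ≤ e := by
  have hp0 : (p : ℤ) ≠ 0 := by exact_mod_cast hp.1.ne_zero
  obtain ⟨x', hx'⟩ : (p : ℤ) ^ padicValInt p x ∣ x := padicValInt_dvd x
  have hI : canonI p x y = p ^ e * x' := by
    rw [canonI, if_neg hy]
    apply Int.ediv_eq_of_eq_mul_right (pow_ne_zero _ hp0)
    rw [← mul_assoc, ← pow_add, ← he, pow_succ']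
    conv_lhs => rw [hx']
    ring
  have hx0 : x' ≠ 0 := by rintro rfl; simp at hx'; exact hx hx'
  have hnd : ¬ (p : ℤ) ∣ x' := fun ⟨c, hc⟩ => by
    have := (le_padicValInt_iff (p := p) hx (padicValInt p x + 1)).2 ⟨c, by
      conv_lhs => rw [hx', hc]
      ring⟩
    omega
  rw [hI]
  constructor
  · intro h
    by_contra hk
    have h1 : (p : ℤ) ^ e * p ∣ p ^ e * x' := by
      rw [← pow_succ]; exact (pow_dvd_pow _ (by omega)).trans h
    exact hnd ((mul_dvd_mul_iff_left (pow_ne_zero _ hp0)).1 h1)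
  · exact fun h => (pow_dvd_pow _ h).mul_right _

theorem canonI_step_zero {x y : ℤ} (hy : ¬ (p : ℤ) ∣ y) :
    canonI p (x + 1) y = canonI p x y + p := by
  obtain ⟨h0, h1⟩ := padicValInt_eq_zero' hy
  simp [canonI, h0, h1, mul_add]

theorem canonI_of_pos {x y : ℤ} (hy : y ≠ 0) {m : ℕ} (hm : padicValInt p y = m + 1) :
    canonI p x y = x / p ^ m := by
  have hp0 : (0 : ℤ) < p := by exact_mod_cast hp.1.pos
  rw [canonI, if_neg hy, hm, pow_succ', Int.mul_ediv_mul_of_pos _ _ hp0]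

theorem canonI_step_one {x y : ℤ} (hy : (p : ℤ) ∣ y) (h : -1 ≤ canonDelta p (x + 1) y) :
    canonI p (x + 1) y = canonI p x y + 1 := by
  have hp0 : (0 : ℤ) < p := by exact_mod_cast hp.1.pos
  by_cases hy0 : y = 0
  · subst hy0
    by_cases hx : x + 1 = 0
    · have : x = -1 := by omega
      subst this
      simp [canonI]
    · simp [canonDelta, hx] at h
  · obtain ⟨m, hm⟩ : ∃ m, padicValInt p y = m + 1 :=
      ⟨padicValInt p y - 1, by have := padicValInt_pos' hy0 hy; omega⟩
    have hm0 : (0 : ℤ) < p ^ m := pow_pos hp0 _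
    obtain ⟨c, hc⟩ : (p : ℤ) ^ m ∣ x + 1 := by
      by_cases hx : x + 1 = 0
      · rw [hx]; exact dvd_zero _
      · rw [canonDelta, if_neg hx, if_neg hy0] at h
        exact (le_padicValInt_iff hx m).1 (by omega)
    rw [canonI_of_pos hy0 hm, canonI_of_pos hy0 hm, hc, Int.mul_ediv_cancel_left _ hm0.ne']
    have : x = (p ^ m - 1) + p ^ m * (c - 1) := by linear_combination hc
    rw [this, Int.add_mul_ediv_left _ _ hm0.ne', Int.ediv_eq_zero_of_lt (by omega) (by omega)]
    ring

theorem canonI_step_two {x y : ℤ} (hy : (p : ℤ) ∣ y) (h : canonDelta p (x + 1) y = -2) :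
    canonI p (x + 1) y = canonI p x y := by
  have hp0 : (0 : ℤ) < p := by exact_mod_cast hp.1.pos
  have hx : x + 1 ≠ 0 := by
    intro hx
    rw [canonDelta, if_pos hx] at h
    split_ifs at h
  by_cases hy0 : y = 0
  · subst hy0
    have : x < 0 ↔ x + 1 < 0 := by omega
    simp [canonI, this]
  · obtain ⟨m, hm⟩ : ∃ m, padicValInt p y = m + 1 :=
      ⟨padicValInt p y - 1, by have := padicValInt_pos' hy0 hy; omega⟩
    have hm0 : (0 : ℤ) < p ^ m := pow_pos hp0 _
    have hnd : ¬ (p : ℤ) ^ m ∣ x + 1 := fun hd => by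
      have := (le_padicValInt_iff hx m).2 hd
      rw [canonDelta, if_neg hx, if_neg hy0] at h
      omega
    rw [canonI_of_pos hy0 hm, canonI_of_pos hy0 hm]
    have e0 := Int.emod_nonneg (x + 1) hm0.ne'
    have e1 := Int.emod_lt_of_pos (x + 1) hm0
    have e2 := Int.emod_add_mul_ediv (x + 1) (p ^ m)
    have e3 : (x + 1) % p ^ m ≠ 0 := fun e => hnd (Int.dvd_of_emod_eq_zero e)
    have : x = ((x + 1) % p ^ m - 1) + p ^ m * ((x + 1) / p ^ m) := by linarith
    conv_rhs => rw [this, Int.add_mul_ediv_left _ _ hm0.ne',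
      Int.ediv_eq_zero_of_lt (by omega) (by omega), zero_add]

theorem canonI_neg {x y : ℤ} (hd : canonDelta p x y = -1) : ¬ (p : ℤ) ∣ canonI p x y := by
  rcases canonDelta_cases (p := p) (x := x) (y := y) (by omega) with
    ⟨rfl, rfl⟩ | ⟨-, -, h⟩ | ⟨hx, hy, e, he, h⟩
  · rw [canonDelta_zero] at hd; omega
  · omega
  · have := canonI_unit hx hy he 1
    rw [pow_one] at this
    rw [this]; omega

theorem canonI_zero {x y : ℤ} (hd : canonDelta p x y = 0) :
    (p : ℤ) ∣ canonI p x y ∧ ¬ (p : ℤ) ^ 2 ∣ canonI p x y := by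
  have h2 : (2 : ℤ) ≤ p := by exact_mod_cast hp.1.two_le
  rcases canonDelta_cases (p := p) (x := x) (y := y) (by omega) with
    ⟨rfl, rfl⟩ | ⟨-, -, h⟩ | ⟨hx, hy, e, he, h⟩
  · refine ⟨by simp [canonI], fun h => ?_⟩
    simp only [canonI, if_true, lt_irrefl, if_false] at h
    have := Int.le_of_dvd (by omega) h
    nlinarith
  · omega
  · have h1 := canonI_unit hx hy he 1
    rw [pow_one] at h1
    rw [h1, canonI_unit hx hy he]; omega

theorem canonI_one {x y : ℤ} (hd : canonDelta p x y = 1) :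
    (p : ℤ) ^ 2 ∣ canonI p x y ∧ ¬ (p : ℤ) ^ 3 ∣ canonI p x y := by
  rcases canonDelta_cases (p := p) (x := x) (y := y) (by omega) with
    ⟨rfl, rfl⟩ | ⟨-, -, h⟩ | ⟨hx, hy, e, he, h⟩
  · rw [canonDelta_zero] at hd; omega
  · omega
  · rw [canonI_unit hx hy he, canonI_unit hx hy he]; omega

theorem canonI_two {x y : ℤ} (hd : canonDelta p x y = 2) : (p : ℤ) ^ 3 ∣ canonI p x y := by
  rcases canonDelta_cases (p := p) (x := x) (y := y) (by omega) with
    ⟨rfl, rfl⟩ | ⟨rfl, hy, -⟩ | ⟨hx, hy, e, he, h⟩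
  · rw [canonDelta_zero] at hd; omega
  · simp [canonI, hy]
  · rw [canonI_unit hx hy he]; omega

theorem canonDelta_base_zero {x y : ℤ} (hx : ¬ (p : ℤ) ∣ x) (hy : ¬ (p : ℤ) ∣ y) :
    canonDelta p x y = 0 := by
  obtain ⟨h0, h1⟩ := padicValInt_eq_zero' hx
  obtain ⟨h2, h3⟩ := padicValInt_eq_zero' hy
  simp [canonDelta, h0, h1, h2, h3]

theorem canonDelta_base_neg {x y : ℤ} (hx : ¬ (p : ℤ) ∣ x) (hy : (p : ℤ) ∣ y) :
    canonDelta p x y < 0 := by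
  obtain ⟨h0, h1⟩ := padicValInt_eq_zero' hx
  by_cases hy0 : y = 0
  · simp [canonDelta, h0, hy0]
  · have := padicValInt_pos' hy0 hy
    rw [canonDelta, if_neg h0, if_neg hy0]; omega

variable (p) in
/-- The structure with origin at `(0, 0)`. -/
def canonical : PadicSystem p where
  δ := canonDelta p
  I := canonI p
  J x y := canonI p y x
  u x := canonI p x x
  w y := canonI p y y
  α := 0
  β := 0
  two_le := by exact_mod_cast hp.1.two_le
  le_δ := le_canonDelta
  δ_le x y := by
    have h1 := canonDelta_swap (p := p) y x
    have h2 := le_canonDelta (p := p) y x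
    omega
  stepI₀ x y h := by rw [canonI_step_zero (by simpa using h), sub_self]; exact dvd_zero _
  stepI₁ x y h h' := by rw [canonI_step_one (by simpa using h) h', sub_self]; exact dvd_zero _
  stepI₂ x y h h' := by rw [canonI_step_two (by simpa using h) h', sub_self]; exact dvd_zero _
  stepJ₀ x y h := by rw [canonI_step_zero (by simpa using h), sub_self]; exact dvd_zero _
  stepJ₁ x y h h' := by
    rw [canonI_step_one (by simpa using h) (by rw [canonDelta_swap]; omega), sub_self]
    exact dvd_zero _
  stepJ₂ x y h h' := by
    rw [canonI_step_two (by simpa using h) (by rw [canonDelta_swap]; omega), sub_self]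
    exact dvd_zero _
  I_neg x y := canonI_neg
  I_zero x y := canonI_zero
  I_one x y := canonI_one
  I_two x y := canonI_two
  J_neg x y h := canonI_neg (by rw [canonDelta_swap]; omega)
  J_zero x y h := canonI_zero (by rw [canonDelta_swap]; omega)
  J_one x y h := canonI_one (by rw [canonDelta_swap]; omega)
  J_two x y h := canonI_two (by rw [canonDelta_swap]; omega)
  I_eq x y h := by rw [canonI_eq h, sub_self]; exact dvd_zero _
  J_eq x y h := by
    rw [canonI_eq (x := y) (y := x) (by rw [canonDelta_swap]; omega), sub_self]; exact dvd_zero _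
  base_zero x y h h' := canonDelta_base_zero (by simpa using h) (by simpa using h')
  base_neg x y h h' := canonDelta_base_neg (by simpa using h) (by simpa using h')
  base_pos x y h h' := by
    have := canonDelta_base_neg (p := p) (x := y) (y := x) (by simpa using h') (by simpa using h)
    have := canonDelta_swap (p := p) x y
    omega

end Canonical

/-- Finite data attached to a position of a `p`-adic structure. -/
structure Cell (p : ℕ) where
  δ : Fin 5
  I : ZMod (p ^ 3)
  J : ZMod (p ^ 3)
  u : ZMod (p ^ 3)
  w : ZMod (p ^ 3)
  ρ₁ : ZMod p
  ρ₂ : ZMod p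

namespace Cell

variable {p : ℕ}

instance [NeZero p] : Finite (Cell p) := by
  have : NeZero (p ^ 3) := ⟨pow_ne_zero _ (NeZero.ne p)⟩
  refine Finite.of_injective (fun c : Cell p => (c.δ, c.I, c.J, c.u, c.w, c.ρ₁, c.ρ₂)) ?_
  rintro ⟨⟩ ⟨⟩ h
  simp only [Prod.mk.injEq] at h
  simp only [Cell.mk.injEq]
  exact h

/-- The signed level difference. -/
def d (c : Cell p) : ℤ := (c.δ : ℤ) - 2

/-- Constraints inside one cell. -/
structure Ok (c : Cell p) : Prop where
  I_neg : c.d = -1 → ¬ (p : ℤ) ∣ (c.I.val : ℤ)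
  I_zero : c.d = 0 → (p : ℤ) ∣ (c.I.val : ℤ) ∧ ¬ (p : ℤ) ^ 2 ∣ (c.I.val : ℤ)
  I_one : c.d = 1 → (p : ℤ) ^ 2 ∣ (c.I.val : ℤ) ∧ ¬ (p : ℤ) ^ 3 ∣ (c.I.val : ℤ)
  I_two : c.d = 2 → (p : ℤ) ^ 3 ∣ (c.I.val : ℤ)
  J_neg : c.d = 1 → ¬ (p : ℤ) ∣ (c.J.val : ℤ)
  J_zero : c.d = 0 → (p : ℤ) ∣ (c.J.val : ℤ) ∧ ¬ (p : ℤ) ^ 2 ∣ (c.J.val : ℤ)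
  J_one : c.d = -1 → (p : ℤ) ^ 2 ∣ (c.J.val : ℤ) ∧ ¬ (p : ℤ) ^ 3 ∣ (c.J.val : ℤ)
  J_two : c.d = -2 → (p : ℤ) ^ 3 ∣ (c.J.val : ℤ)
  I_eq : c.d = 0 → c.I = c.u
  J_eq : c.d = 0 → c.J = c.w
  base_zero : c.ρ₁ ≠ 0 → c.ρ₂ ≠ 0 → c.d = 0
  base_neg : c.ρ₁ ≠ 0 → c.ρ₂ = 0 → c.d < 0
  base_pos : c.ρ₁ = 0 → c.ρ₂ ≠ 0 → 0 < c.d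

/-- Constraints between horizontal neighbours. -/
structure Horiz (c c' : Cell p) : Prop where
  ρ₁ : c'.ρ₁ = c.ρ₁ + 1
  ρ₂ : c'.ρ₂ = c.ρ₂
  w : c'.w = c.w
  step₀ : c.ρ₂ ≠ 0 → c'.I = c.I + p
  step₁ : c.ρ₂ = 0 → -1 ≤ c'.d → c'.I = c.I + 1
  step₂ : c.ρ₂ = 0 → c'.d = -2 → c'.I = c.I

/-- Constraints between vertical neighbours. -/
structure Vert (c c' : Cell p) : Prop where
  ρ₂ : c'.ρ₂ = c.ρ₂ + 1
  ρ₁ : c'.ρ₁ = c.ρ₁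
  u : c'.u = c.u
  step₀ : c.ρ₁ ≠ 0 → c'.J = c.J + p
  step₁ : c.ρ₁ = 0 → c'.d ≤ 1 → c'.J = c.J + 1
  step₂ : c.ρ₁ = 0 → c'.d = 2 → c'.J = c.J

end Cell

theorem eq_add_intCast {α : Type*} [AddCommGroup α] {g : ℤ → α} {c : α}
    (h : ∀ i, g (i + 1) = g i + c) (i : ℤ) : g i = g 0 + i • c := by
  induction i using Int.induction_on with
  | zero => simp
  | succ i ih => rw [h, ih, add_smul, one_smul, add_assoc]
  | pred i ih =>
    have := h (-i - 1)
    rw [sub_add_cancel, ih] at this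
    rw [sub_smul, one_smul, ← add_sub_assoc, this, add_sub_cancel_right]

theorem eq_of_step {α : Type*} {g : ℤ → α} (h : ∀ i, g (i + 1) = g i) (i : ℤ) : g i = g 0 := by
  induction i using Int.induction_on with
  | zero => rfl
  | succ i ih => rw [h, ih]
  | pred i ih => rw [← ih, ← h, sub_add_cancel]

theorem cast_eq_iff {p : ℕ} {a b : ℤ} : (a : ZMod (p ^ 3)) = b ↔ (p : ℤ) ^ 3 ∣ a - b := by
  rw [eq_comm, ZMod.intCast_eq_intCast_iff_dvd_sub]; push_cast; rfl

theorem val_dvd_iff {p : ℕ} [NeZero p] {k : ℕ} (hk : k ≤ 3) (a : ℤ) :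
    (p : ℤ) ^ k ∣ (((a : ZMod (p ^ 3)).val : ℕ) : ℤ) ↔ (p : ℤ) ^ k ∣ a := by
  have : NeZero (p ^ 3) := ⟨pow_ne_zero _ (NeZero.ne p)⟩
  rw [ZMod.val_intCast, Int.dvd_iff_emod_eq_zero, Int.emod_emod_of_dvd, ← Int.dvd_iff_emod_eq_zero]
  push_cast
  exact pow_dvd_pow _ hk

/-- A plane of compatible cells is a `p`-adic system. -/
theorem exists_padicSystem {p : ℕ} (hp : 2 ≤ p) (z : ℤ → ℤ → Cell p) (h : ∀ x y, (z x y).Ok)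
    (hH : ∀ x y, (z x y).Horiz (z (x + 1) y)) (hV : ∀ x y, (z x y).Vert (z x (y + 1))) :
    ∃ S : PadicSystem p, (∀ x y, S.δ x y = (z x y).d) ∧
      ∀ x y, (z x y).ρ₁ = 0 ↔ (p : ℤ) ∣ x - S.α := by
  have : NeZero p := ⟨by omega⟩
  have : NeZero (p ^ 3) := ⟨pow_ne_zero _ (NeZero.ne p)⟩
  have key : ∀ (c : ZMod p) (x : ℤ), (c + x • (1 : ZMod p) = 0 ↔ (p : ℤ) ∣ x - -(c.val : ℤ)) :=
    fun c x => by
      rw [← ZMod.intCast_zmod_eq_zero_iff_dvd]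
      push_cast
      rw [ZMod.natCast_zmod_val, sub_neg_eq_add, zsmul_one, add_comm]
  have h1 : ∀ x y, (z x y).ρ₁ = 0 ↔ (p : ℤ) ∣ x - -((z 0 0).ρ₁.val : ℤ) := fun x y => by
    rw [eq_of_step (g := fun y => (z x y).ρ₁) (fun y => (hV x y).ρ₁) y,
      eq_add_intCast (g := fun x => (z x 0).ρ₁) (fun x => (hH x 0).ρ₁) x, key]
  have h2 : ∀ x y, (z x y).ρ₂ = 0 ↔ (p : ℤ) ∣ y - -((z 0 0).ρ₂.val : ℤ) := fun x y => by
    rw [eq_of_step (g := fun x => (z x y).ρ₂) (fun x => (hH x y).ρ₂) x,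
      eq_add_intCast (g := fun y => (z 0 y).ρ₂) (fun y => (hV 0 y).ρ₂) y, key]
  have hu : ∀ x y, (z x y).u = (z x 0).u := fun x y =>
    eq_of_step (g := fun y => (z x y).u) (fun y => (hV x y).u) y
  have hw : ∀ x y, (z x y).w = (z 0 y).w := fun x y =>
    eq_of_step (g := fun x => (z x y).w) (fun x => (hH x y).w) x
  refine ⟨{
    δ := fun x y => (z x y).d
    I := fun x y => (z x y).I.val
    J := fun x y => (z x y).J.val
    u := fun x => (z x 0).u.val
    w := fun y => (z 0 y).w.val
    α := -((z 0 0).ρ₁.val : ℤ)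
    β := -((z 0 0).ρ₂.val : ℤ)
    two_le := by exact_mod_cast hp
    le_δ := fun x y => by simp only [Cell.d]; omega
    δ_le := fun x y => by have := (z x y).δ.2; simp only [Cell.d]; omega
    stepI₀ := fun x y hy => by
      rw [← cast_eq_iff]; push_cast; simp only [ZMod.natCast_zmod_val]
      exact (hH x y).step₀ (mt (h2 x y).1 hy)
    stepI₁ := fun x y hy hd => by
      rw [← cast_eq_iff]; push_cast; simp only [ZMod.natCast_zmod_val]
      exact (hH x y).step₁ ((h2 x y).2 hy) hd
    stepI₂ := fun x y hy hd => by
      rw [← cast_eq_iff]; push_cast; simp only [ZMod.natCast_zmod_val]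
      exact (hH x y).step₂ ((h2 x y).2 hy) hd
    stepJ₀ := fun x y hx => by
      rw [← cast_eq_iff]; push_cast; simp only [ZMod.natCast_zmod_val]
      exact (hV x y).step₀ (mt (h1 x y).1 hx)
    stepJ₁ := fun x y hx hd => by
      rw [← cast_eq_iff]; push_cast; simp only [ZMod.natCast_zmod_val]
      exact (hV x y).step₁ ((h1 x y).2 hx) hd
    stepJ₂ := fun x y hx hd => by
      rw [← cast_eq_iff]; push_cast; simp only [ZMod.natCast_zmod_val]
      exact (hV x y).step₂ ((h1 x y).2 hx) hd
    I_neg := fun x y => (h x y).I_neg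
    I_zero := fun x y => (h x y).I_zero
    I_one := fun x y => (h x y).I_one
    I_two := fun x y => (h x y).I_two
    J_neg := fun x y => (h x y).J_neg
    J_zero := fun x y => (h x y).J_zero
    J_one := fun x y => (h x y).J_one
    J_two := fun x y => (h x y).J_two
    I_eq := fun x y hd => by
      rw [(h x y).I_eq hd, hu, sub_self]; exact dvd_zero _
    J_eq := fun x y hd => by
      rw [(h x y).J_eq hd, hw, sub_self]; exact dvd_zero _
    base_zero := fun x y hx hy => (h x y).base_zero (mt (h1 x y).1 hx) (mt (h2 x y).1 hy)
    base_neg := fun x y hx hy => (h x y).base_neg (mt (h1 x y).1 hx) ((h2 x y).2 hy)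
    base_pos := fun x y hx hy => (h x y).base_pos ((h1 x y).2 hx) (mt (h2 x y).1 hy) },
    fun x y => rfl, h1⟩

/-- The cells of a `p`-adic system. -/
def PadicSystem.cell {p : ℕ} (S : PadicSystem p) (x y : ℤ) : Cell p where
  δ := ⟨(S.δ x y + 2).toNat, by have := S.δ_le x y; omega⟩
  I := S.I x y
  J := S.J x y
  u := S.u x
  w := S.w y
  ρ₁ := ((x - S.α : ℤ) : ZMod p)
  ρ₂ := ((y - S.β : ℤ) : ZMod p)

namespace PadicSystem

variable {p : ℕ} (S : PadicSystem p)

theorem cell_d (x y : ℤ) : (S.cell x y).d = S.δ x y := by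
  have := S.le_δ x y
  simp only [Cell.d, cell]; omega

theorem cell_ρ₁ (x y : ℤ) : (S.cell x y).ρ₁ = 0 ↔ (p : ℤ) ∣ x - S.α :=
  ZMod.intCast_zmod_eq_zero_iff_dvd _ _

theorem cell_ρ₂ (x y : ℤ) : (S.cell x y).ρ₂ = 0 ↔ (p : ℤ) ∣ y - S.β :=
  ZMod.intCast_zmod_eq_zero_iff_dvd _ _

theorem cell_ok (x y : ℤ) : (S.cell x y).Ok := by
  have : NeZero p := ⟨by rintro rfl; have := S.two_le; simp at this⟩
  have v1 := fun a : ℤ => val_dvd_iff (p := p) (k := 1) (by norm_num) a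
  have v2 := fun a : ℤ => val_dvd_iff (p := p) (k := 2) (by norm_num) a
  have v3 := fun a : ℤ => val_dvd_iff (p := p) (k := 3) (by norm_num) a
  simp only [pow_one] at v1
  constructor <;> (try simp only [cell_d, ne_eq, cell_ρ₁, cell_ρ₂]) <;> (try simp only [cell, v1, v2, v3])
  · exact S.I_neg x y
  · exact S.I_zero x y
  · exact S.I_one x y
  · exact S.I_two x y
  · exact S.J_neg x y
  · exact S.J_zero x y
  · exact S.J_one x y
  · exact S.J_two x y
  · exact fun h => cast_eq_iff.2 (S.I_eq x y h)
  · exact fun h => cast_eq_iff.2 (S.J_eq x y h)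
  · exact S.base_zero x y
  · exact S.base_neg x y
  · exact S.base_pos x y

theorem cell_horiz (x y : ℤ) : (S.cell x y).Horiz (S.cell (x + 1) y) := by
  constructor <;> (try simp only [cell_d, ne_eq, cell_ρ₂]) <;> (try simp only [cell])
  · push_cast; ring
  · intro h
    have := cast_eq_iff.2 (S.stepI₀ x y h)
    push_cast at this; exact this
  · intro h h'
    have := cast_eq_iff.2 (S.stepI₁ x y h h')
    push_cast at this; exact this
  · intro h h'
    exact cast_eq_iff.2 (S.stepI₂ x y h h')

theorem cell_vert (x y : ℤ) : (S.cell x y).Vert (S.cell x (y + 1)) := by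
  constructor <;> (try simp only [cell_d, ne_eq, cell_ρ₁]) <;> (try simp only [cell])
  · push_cast; ring
  · intro h
    have := cast_eq_iff.2 (S.stepJ₀ x y h)
    push_cast at this; exact this
  · intro h h'
    have := cast_eq_iff.2 (S.stepJ₁ x y h h')
    push_cast at this; exact this
  · intro h h'
    exact cast_eq_iff.2 (S.stepJ₂ x y h h')

end PadicSystem


/-- All concatenations of `n` letters from `L`. -/
def words {α : Type*} (L : List α) : ℕ → List (List α)
  | 0 => [[]]
  | n + 1 => L.flatMap fun a => (words L n).map (List.cons a)

theorem mem_words {α : Type*} {L : List α} {n : ℕ} {w : List α} :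
    w ∈ words L n ↔ w.length = n ∧ ∀ a ∈ w, a ∈ L := by
  induction n generalizing w with
  | zero =>
    rw [words, List.mem_singleton, List.length_eq_zero_iff]
    exact ⟨fun h => ⟨h, by simp [h]⟩, fun h => h.1⟩
  | succ n ih =>
    simp only [words, List.mem_flatMap, List.mem_map]
    constructor
    · rintro ⟨a, ha, w, hw, rfl⟩
      obtain ⟨h1, h2⟩ := ih.1 hw
      exact ⟨by simp [h1], by simpa [ha] using h2⟩
    · rintro ⟨h1, h2⟩
      rcases w with _ | ⟨a, w⟩
      · simp at h1
      · exact ⟨a, h2 a (by simp), w, ih.2 ⟨by simpa using h1, fun b hb => h2 b (by simp [hb])⟩, rfl⟩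

theorem words_map {α β : Type*} (f : α → β) (L : List α) (n : ℕ) :
    words (L.map f) n = (words L n).map (List.map f) := by
  induction n with
  | zero => rfl
  | succ n ih => simp [words, ih, List.flatMap_map, List.map_flatMap, Function.comp_def]

/-- Words starting in `s`, ending in `e`, with `n` letters of `m` in between. -/
def sandwich {α : Type*} (s m e : List α) (n : ℕ) : List (List α) :=
  s.flatMap fun a => (words m n).flatMap fun w => e.map fun b => a :: (w ++ [b])

theorem mem_sandwich {α : Type*} {s m e : List α} {n : ℕ} {v : List α} :
    v ∈ sandwich s m e n ↔ ∃ a ∈ s, ∃ w, (w.length = n ∧ ∀ c ∈ w, c ∈ m) ∧ ∃ b ∈ e,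
      v = a :: (w ++ [b]) := by
  simp only [sandwich, List.mem_flatMap, List.mem_map, mem_words]
  constructor
  · rintro ⟨a, ha, w, hw, b, hb, rfl⟩; exact ⟨a, ha, w, hw, b, hb, rfl⟩
  · rintro ⟨a, ha, w, hw, b, hb, rfl⟩; exact ⟨a, ha, w, hw, b, hb, rfl⟩

/-- A quarter plane with prescribed neighbour and boundary rules. -/
structure Quarter {D : Type*} (H V : D → D → Prop) (L B : D → Prop) (d : ℕ → ℕ → D) : Prop where
  horiz : ∀ a b, H (d a b) (d (a + 1) b)
  vert : ∀ a b, V (d a b) (d a (b + 1))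
  left : ∀ b, L (d 0 b)
  bottom : ∀ a, B (d a 0)

theorem exists_exact {p q : ℤ} (hp : 2 ≤ p) (hq : 2 ≤ q) (hpq : IsCoprime p q) (m n : ℕ) (a b : ℤ) :
    ∃ x, Exact p m a x ∧ Exact q n b x := by
  obtain ⟨s, t, hst⟩ : IsCoprime (p ^ (m + 1)) (q ^ (n + 1)) := hpq.pow
  have h1 : ∀ {r : ℤ}, 2 ≤ r → ¬ r ∣ 1 := fun h h' => by have := Int.le_of_dvd (by omega) h'; omega
  have key : ∀ (r : ℤ) (k : ℕ) (c x e : ℤ), 2 ≤ r → x - c = r ^ k + r ^ (k + 1) * e →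
      Exact r k c x := fun r k c x e hr h => by
    have hr0 : r ^ k ≠ 0 := pow_ne_zero k (by omega)
    refine ⟨⟨1 + r * e, by rw [h, pow_succ]; ring⟩, fun hd => ?_⟩
    rw [h] at hd
    have h2 : r ^ k * r ∣ r ^ k * 1 := by
      rw [mul_one, ← pow_succ]; exact (Int.dvd_add_left (Dvd.intro _ rfl)).1 hd
    exact h1 hr ((mul_dvd_mul_iff_left hr0).1 h2)
  refine ⟨(a + p ^ m) * (t * q ^ (n + 1)) + (b + q ^ n) * (s * p ^ (m + 1)),
    key p m a _ (s * (b + q ^ n - a - p ^ m)) hp ?_,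
    key q n b _ (t * (a + p ^ m - b - q ^ n)) hq ?_⟩
  · linear_combination (a + p ^ m) * hst
  · linear_combination (b + q ^ n) * hst

/-- Tiles: cells of the dyadic and triadic structures with a row symbol and a column symbol. -/
structure PTile (D : Type) where
  c₂ : Cell 2
  c₃ : Cell 3
  r : D
  q : D

instance {D : Type} [Finite D] : Finite (PTile D) := by
  refine Finite.of_injective (fun c : PTile D => (c.c₂, c.c₃, c.r, c.q)) ?_
  rintro ⟨⟩ ⟨⟩ h
  simp only [Prod.mk.injEq] at h
  simp only [PTile.mk.injEq]
  exact h

namespace PTile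

variable {D : Type} (H V : D → D → Prop) (L B : D → Prop)

/-- Constraints inside a tile. -/
structure Ok (t : PTile D) : Prop where
  ok₂ : t.c₂.Ok
  ok₃ : t.c₃.Ok
  same : t.c₂.d = 0 → t.c₃.d = 0 → t.r = t.q
  horiz : t.c₂.d = 1 → t.c₃.d = 0 → H t.r t.q
  vert : t.c₂.d = 0 → t.c₃.d = 1 → V t.r t.q
  left : t.c₂.ρ₁ ≠ 0 → L t.q
  bottom : t.c₃.ρ₁ ≠ 0 → B t.q

/-- Horizontal rule. -/
def Horiz (t t' : PTile D) : Prop :=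
  t.Ok H V L B ∧ t.c₂.Horiz t'.c₂ ∧ t.c₃.Horiz t'.c₃ ∧ t'.r = t.r

/-- Vertical rule. -/
def Vert (t t' : PTile D) : Prop :=
  t.c₂.Vert t'.c₂ ∧ t.c₃.Vert t'.c₃ ∧ t'.q = t.q

variable {H V L B}

theorem exact_of_levels {p : ℤ} {a : ℕ → ℤ} (h : ∀ n, p ^ (n + 1) ∣ a (n + 1) - a n) {n : ℕ} {x : ℤ}
    (hx : Exact p (n + 1) (a (n + 1)) x) : p ^ (n + 1) ∣ x - a n :=
  (PadicSystem.dvd_congr (h n)).1 hx.1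

theorem delta_ne_zero {p : ℤ} {S : PadicSystem p} {a b : ℕ → ℤ}
    (ha : ∀ n, p ^ (n + 1) ∣ a (n + 1) - a n) (hb : ∀ n, p ^ (n + 1) ∣ b (n + 1) - b n)
    (hS : ∀ n, S.Level n (a n) (b n)) {n : ℕ} {x y : ℤ} (hx : Exact p n (a n) x)
    (hy : ¬ Exact p n (b n) y) : S.δ x y ≠ 0 := by
  by_cases h1 : p ^ (n + 1) ∣ y - b n
  · exact ((hS n).neg x y hx h1).ne
  · rcases n with _ | n
    · exact absurd ⟨by simp, h1⟩ hy
    · have hx' := exact_of_levels ha hx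
      have h2 : ¬ p ^ (n + 1) ∣ y - b (n + 1) := fun h => hy ⟨h, h1⟩
      rw [PadicSystem.dvd_congr (hb n)] at h2
      by_cases h3 : p ^ n ∣ y - b n
      · exact ((hS n).pos x y hx' ⟨h3, h2⟩).ne'
      · rw [(hS n).lowI x y hx' h3]; norm_num

theorem quarter_of_tiles {z : ℤ → ℤ → PTile D} (hz : ∀ i j, Horiz H V L B (z i j) (z (i + 1) j))
    (hz' : ∀ i j, Vert (z i j) (z i (j + 1))) {ps : List (ℕ × D)}
    {starts : D → List (PTile D)} {mids ends : List (PTile D)}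
    (hs : ∀ q t, t ∈ starts q ↔ t.c₂.d = 0 ∧ t.c₃.ρ₁ ≠ 0 ∧ t.q = q)
    (hm : ∀ t, t ∈ mids ↔ t.c₂.d ≠ 0) (he : ∀ t, t ∈ ends ↔ t.c₂.d = 0)
    (hps : ∀ w ∈ ps.flatMap fun q => sandwich (starts q.2) mids ends (2 ^ (q.1 + 1) - 1),
      ∀ i j, ¬ OccAt j w (z i)) :
    ∃ d, Quarter H V L B d ∧ ∀ q ∈ ps, d q.1 0 ≠ q.2 := by
  have ok := fun i j => (hz i j).1
  obtain ⟨S, hS, hα⟩ := exists_padicSystem (p := 2) (by norm_num) (fun i j => (z i j).c₂)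
    (fun i j => (ok i j).ok₂) (fun i j => (hz i j).2.1) (fun i j => (hz' i j).1)
  obtain ⟨S', hS', hα'⟩ := exists_padicSystem (p := 3) (by norm_num) (fun i j => (z i j).c₃)
    (fun i j => (ok i j).ok₃) (fun i j => (hz i j).2.2.1) (fun i j => (hz' i j).2.1)
  obtain ⟨a, b, ha0, -, ha, hb, hl, hn⟩ := S.exists_levels
  obtain ⟨a', b', ha0', -, ha', hb', hl', hn'⟩ := S'.exists_levels
  have hr : ∀ i j, (z i j).r = (z 0 j).r := fun i j =>
    eq_of_step (g := fun i => (z i j).r) (fun i => (hz i j).2.2.2) i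
  have hq : ∀ i j, (z i j).q = (z i 0).q := fun i j =>
    eq_of_step (g := fun j => (z i j).q) (fun j => (hz' i j).2.2) j
  have cop : IsCoprime ((2 : ℕ) : ℤ) ((3 : ℕ) : ℤ) := ⟨-1, 1, by norm_num⟩
  choose X hX hX' using fun m n => exists_exact (by norm_num) (by norm_num) cop m n (a m) (a' n)
  choose Y hY hY' using fun m n => exists_exact (by norm_num) (by norm_num) cop m n (b m) (b' n)
  have hd : ∀ m n, (z 0 (Y m n)).r = (z (X m n) 0).q := fun m n => by
    rw [← hr (X m n), ← hq _ (Y m n)]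
    refine (ok _ _).same ?_ ?_
    · rw [← hS]; exact (hl m).zero _ _ (hX m n) (hY m n)
    · rw [← hS']; exact (hl' n).zero _ _ (hX' m n) (hY' m n)
  refine ⟨fun m n => (z (X m n) 0).q, ⟨fun m n => ?_, fun m n => ?_, fun n => ?_, fun m => ?_⟩, ?_⟩
  · rw [← hd m n, ← hr (X (m + 1) n), ← hq _ (Y m n)]
    refine (ok _ _).horiz ?_ ?_
    · rw [← hS]; exact hn m _ _ (hX _ _) (hY _ _)
    · rw [← hS']; exact (hl' n).zero _ _ (hX' _ _) (hY' _ _)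
  · rw [← hd m n, ← hr (X m (n + 1)), ← hq _ (Y m n)]
    refine (ok _ _).vert ?_ ?_
    · rw [← hS]; exact (hl m).zero _ _ (hX _ _) (hY _ _)
    · rw [← hS']; exact hn' n _ _ (hX' _ _) (hY' _ _)
  · refine (ok _ _).left ?_
    rw [ne_eq, hα, ← ha0]
    simpa using (hX 0 n).2
  · refine (ok _ _).bottom ?_
    rw [ne_eq, hα', ← ha0']
    simpa using (hX' m 0).2
  · rintro ⟨m, q⟩ hmem hbad
    simp only at hbad
    set x := X m 0
    set y := Y m 0
    have hx := hX m 0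
    have hy := hY m 0
    refine hps _ (List.mem_flatMap.2 ⟨(m, q), hmem, mem_sandwich.2 ⟨z x y, ?_,
      (List.range (2 ^ (m + 1) - 1)).map fun t : ℕ => z x (y + 1 + t), ⟨by simp, ?_⟩,
      z x (y + 1 + (2 ^ (m + 1) - 1 : ℕ)), ?_, rfl⟩⟩) x y ?_
    · refine (hs _ _).2 ⟨?_, ?_, ?_⟩
      · rw [← hS]; exact (hl m).zero _ _ hx hy
      · rw [ne_eq, hα', ← ha0']
        simpa using (hX' m 0).2
      · rw [hq]; exact hbad
    · intro c hc
      obtain ⟨t, ht, rfl⟩ := List.mem_map.1 hc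
      rw [List.mem_range] at ht
      rw [hm, ← hS]
      refine delta_ne_zero ha hb hl hx fun hex => ?_
      obtain ⟨s, h1⟩ := hy.1
      obtain ⟨s', h2⟩ := hex.1
      push_cast at h1 h2
      have h3 : ((t : ℤ) + 1) = 2 ^ m * (s' - s) := by linear_combination h2 - h1
      have h4 : ((t : ℤ) + 1) < 2 ^ (m + 1) := by
        have : t + 1 < 2 ^ (m + 1) := by omega
        exact_mod_cast this
      have hp : (0 : ℤ) < 2 ^ m := by positivity
      rw [h3, pow_succ, mul_lt_mul_iff_right₀ hp] at h4
      have h5 : 0 < s' - s := by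
        by_contra hc
        have := mul_nonpos_of_nonneg_of_nonpos hp.le (not_lt.1 hc)
        omega
      have h6 : s' = s + 1 := by omega
      have h7 : ¬ (2 : ℤ) ∣ s := fun ⟨c, hc⟩ => hy.2 ⟨c, by push_cast; rw [h1, hc]; ring⟩
      have h8 : ¬ (2 : ℤ) ∣ s' := fun ⟨c, hc⟩ => hex.2 ⟨c, by push_cast; rw [h2, hc]; ring⟩
      omega
    · rw [he, ← hS]
      refine (hl m).zero _ _ hx ?_
      have e : y + 1 + (2 ^ (m + 1) - 1 : ℕ) = y + 2 ^ (m + 1) := by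
        rw [Nat.cast_sub Nat.one_le_two_pow]; push_cast; ring
      have e2 : y + 1 + (2 ^ (m + 1) - 1 : ℕ) - b m = y - b m + 2 ^ (m + 1) := by rw [e]; ring
      refine ⟨?_, fun h => hy.2 ?_⟩
      · rw [e2]; exact dvd_add hy.1 (pow_dvd_pow _ (by omega))
      · rw [e2] at h; exact (dvd_add_left dvd_rfl).1 h
    · rw [occAt_cons, occAt_append, occAt_map_range]
      refine ⟨rfl, fun r hr => rfl, ?_⟩
      intro n hn
      have : n = 0 := by simpa using hn
      subst this
      simp

theorem canonDelta_eq_zero {p : ℕ} {x y : ℤ} (h : canonDelta p x y = 0) :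
    padicValInt p x = padicValInt p y ∧ (x = 0 ↔ y = 0) := by
  unfold canonDelta at h
  by_cases hx : x = 0 <;> by_cases hy : y = 0 <;> simp [hx, hy] at h ⊢
  omega

theorem canonDelta_eq_one {p : ℕ} {x y : ℤ} (h : canonDelta p x y = 1) :
    padicValInt p x = padicValInt p y + 1 := by
  unfold canonDelta at h
  by_cases hx : x = 0 <;> by_cases hy : y = 0 <;> simp [hx, hy] at h ⊢
  omega

theorem canonDelta_of_eq {p : ℕ} {x y : ℤ} (hx : x ≠ 0) (hy : y ≠ 0)
    (h : padicValInt p x = padicValInt p y) : canonDelta p x y = 0 := by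
  simp [canonDelta, hx, hy, h]

theorem tiles_of_quarter {d : ℕ → ℕ → D} (h : Quarter H V L B d) {ps : List (ℕ × D)}
    (hd : ∀ q ∈ ps, d q.1 0 ≠ q.2) {starts : D → List (PTile D)} {mids ends : List (PTile D)}
    (hs : ∀ q t, t ∈ starts q ↔ t.c₂.d = 0 ∧ t.c₃.ρ₁ ≠ 0 ∧ t.q = q)
    (hm : ∀ t, t ∈ mids ↔ t.c₂.d ≠ 0) (he : ∀ t, t ∈ ends ↔ t.c₂.d = 0) :
    Tiles (Horiz H V L B) Vert
      (ps.flatMap fun q => sandwich (starts q.2) mids ends (2 ^ (q.1 + 1) - 1)) := by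
  have : Fact (Nat.Prime 2) := ⟨Nat.prime_two⟩
  have : Fact (Nat.Prime 3) := ⟨Nat.prime_three⟩
  let e : ℤ → D := fun x => d (padicValInt 2 x) (padicValInt 3 x)
  let z : ℤ → ℤ → PTile D := fun x y =>
    ⟨(canonical 2).cell x y, (canonical 3).cell x y, e y, e x⟩
  have ρ : ∀ (p : ℕ) [Fact p.Prime] x y, ((canonical p).cell x y).ρ₁ ≠ 0 →
      padicValInt p x = 0 := fun p _ x y hx => by
    rw [ne_eq, PadicSystem.cell_ρ₁] at hx
    exact (padicValInt_eq_zero' (by simpa [canonical] using hx)).2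
  have ok : ∀ x y, (z x y).Ok H V L B := fun x y => by
    refine ⟨PadicSystem.cell_ok _ _ _, PadicSystem.cell_ok _ _ _, fun h2 h3 => ?_, fun h2 h3 => ?_,
      fun h2 h3 => ?_, fun h2 => ?_, fun h3 => ?_⟩
    · have e2 := canonDelta_eq_zero ((PadicSystem.cell_d _ _ _).symm.trans h2)
      have e3 := canonDelta_eq_zero ((PadicSystem.cell_d _ _ _).symm.trans h3)
      simp only [z, e, e2.1, e3.1]
    · have e2 := canonDelta_eq_one ((PadicSystem.cell_d _ _ _).symm.trans h2)
      have e3 := canonDelta_eq_zero ((PadicSystem.cell_d _ _ _).symm.trans h3)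
      simp only [z, e, e2, e3.1]
      exact h.horiz _ _
    · have e2 := canonDelta_eq_zero ((PadicSystem.cell_d _ _ _).symm.trans h2)
      have e3 := canonDelta_eq_one ((PadicSystem.cell_d _ _ _).symm.trans h3)
      simp only [z, e, e2.1, e3]
      exact h.vert _ _
    · have e2 := ρ 2 _ _ h2
      simp only [z, e, e2]
      exact h.left _
    · have e3 := ρ 3 _ _ h3
      simp only [z, e, e3]
      exact h.bottom _
  refine ⟨z, fun x y => ⟨ok x y, PadicSystem.cell_horiz _ _ _, PadicSystem.cell_horiz _ _ _, rfl⟩,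
    fun x y => ⟨PadicSystem.cell_vert _ _ _, PadicSystem.cell_vert _ _ _, rfl⟩, ?_⟩
  intro w hw x y hocc
  obtain ⟨⟨m, q⟩, hq, hw⟩ := List.mem_flatMap.1 hw
  obtain ⟨s, hs', v, ⟨hv, hv'⟩, t, ht, rfl⟩ := mem_sandwich.1 hw
  simp only at hv
  rw [occAt_cons, occAt_append, occAt_cons, hv] at hocc
  obtain ⟨rfl, ho, rfl, -⟩ := hocc
  rw [hs] at hs'
  rw [he] at ht
  have ey : y + 1 + (2 ^ (m + 1) - 1 : ℕ) = y + 2 ^ (m + 1) := by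
    rw [Nat.cast_sub Nat.one_le_two_pow]; push_cast; ring
  rw [ey] at ht
  obtain ⟨h1, h2, h3⟩ := hs'
  have h1 := canonDelta_eq_zero ((PadicSystem.cell_d _ _ _).symm.trans h1)
  have ht := canonDelta_eq_zero ((PadicSystem.cell_d _ _ _).symm.trans ht)
  have h20 : (0 : ℤ) < 2 ^ (m + 1) := by positivity
  have hx : x ≠ 0 := fun hx => by
    have := h1.2.1 hx
    have := ht.2.1 hx
    omega
  have hy : y ≠ 0 := fun hy => hx (h1.2.2 hy)
  have hmid : ∀ c : ℤ, 0 < c → c < 2 ^ (m + 1) → y + c ≠ 0 → padicValInt 2 x ≠ padicValInt 2 (y + c) :=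
    fun c hc0 hc1 hyc heq => by
      have hlt : c.toNat - 1 < v.length := by
        rw [hv]
        have : (c.toNat : ℤ) < 2 ^ (m + 1) := by omega
        have : c.toNat < 2 ^ (m + 1) := by exact_mod_cast this
        omega
      have h4 := ho (c.toNat - 1) hlt
      have h5 := (hm _).1 (hv' _ (List.get_mem v ⟨c.toNat - 1, hlt⟩))
      rw [← h4] at h5
      have e : y + 1 + ((c.toNat - 1 : ℕ) : ℤ) = y + c := by omega
      rw [e] at h5
      exact h5 ((PadicSystem.cell_d _ _ _).trans (canonDelta_of_eq hx hyc heq))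
  have hval : padicValInt 2 x = m := by
    set n := padicValInt 2 x
    have d0 : (2 : ℤ) ^ n ∣ y := (le_padicValInt_iff (p := 2) hy n).1 h1.1.le
    have nd0 : ¬ (2 : ℤ) ^ (n + 1) ∣ y := fun h => by
      have := (le_padicValInt_iff (p := 2) hy (n + 1)).2 h; omega
    have hy2 : y + 2 ^ (m + 1) ≠ 0 := fun h => hx (ht.2.2 h)
    have d1 : (2 : ℤ) ^ n ∣ y + 2 ^ (m + 1) := (le_padicValInt_iff (p := 2) hy2 n).1 ht.1.le
    have nd1 : ¬ (2 : ℤ) ^ (n + 1) ∣ y + 2 ^ (m + 1) := fun h => by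
      have := (le_padicValInt_iff (p := 2) hy2 (n + 1)).2 h; omega
    rcases lt_trichotomy n m with hlt | heq | hgt
    · exfalso
      have hy3 : y + 2 ^ (n + 1) ≠ 0 := fun h => nd0 ⟨-1, by linarith⟩
      refine hmid (2 ^ (n + 1)) (by positivity) (pow_lt_pow_right₀ (by norm_num) (by omega)) hy3 ?_
      refine le_antisymm ((le_padicValInt_iff hy3 _).2 (dvd_add d0 (pow_dvd_pow _ (by omega)))) ?_
      by_contra hc
      exact nd0 ((dvd_add_left dvd_rfl).1
        ((le_padicValInt_iff (p := 2) hy3 (n + 1)).1 (not_le.1 hc)))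
    · exact heq
    · exfalso
      rw [Int.dvd_add_right d0] at d1
      have h6 : (2 : ℤ) ^ n = 2 ^ (m + 1) * 2 ^ (n - (m + 1)) := by rw [← pow_add]; congr 1; omega
      have h7 : n = m + 1 := by
        by_contra hne
        have d2 : 2 ^ n ∣ 2 ^ (m + 1) := by exact_mod_cast d1
        have := (Nat.pow_dvd_pow_iff_le_right (x := 2) (by norm_num)).1 d2
        omega
      rw [← h7] at nd1
      obtain ⟨c, hc⟩ := d0
      have : ¬ (2 : ℤ) ∣ c := fun ⟨e, he⟩ => nd0 ⟨e, by rw [hc, he]; ring⟩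
      have h8 : (2 : ℤ) ∣ 1 + c := by omega
      obtain ⟨e, he⟩ := h8
      exact nd1 ⟨e, by rw [hc, pow_succ, h7]; linear_combination (2 ^ (m + 1)) * he⟩
  refine hd _ hq ?_
  have h3' : e x = q := h3
  rw [← h3']
  simp only [e, hval, ρ 3 _ _ h2]

end PTile

theorem exists_plane {D : Type} [Finite D] (H V : D → D → Prop) (L B : D → Prop) :
    ∃ (T : Type) (_ : Finite T) (R Vr : T → T → Prop) (starts : D → List T) (mids ends : List T),
      ∀ ps : List (ℕ × D),
        Tiles R Vr (ps.flatMap fun q => sandwich (starts q.2) mids ends (2 ^ (q.1 + 1) - 1)) ↔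
          ∃ d, Quarter H V L B d ∧ ∀ q ∈ ps, d q.1 0 ≠ q.2 := by
  have : NeZero 2 := ⟨by norm_num⟩
  have : NeZero 3 := ⟨by norm_num⟩
  have key : ∀ P : PTile D → Prop, ∃ l : List (PTile D), ∀ t, t ∈ l ↔ P t := fun P =>
    ⟨(Set.toFinite {t | P t}).toFinset.toList, by simp⟩
  choose starts hs using fun q : D => key fun t => t.c₂.d = 0 ∧ t.c₃.ρ₁ ≠ 0 ∧ t.q = q
  obtain ⟨mids, hm⟩ := key fun t => t.c₂.d ≠ 0
  obtain ⟨ends, he⟩ := key fun t => t.c₂.d = 0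
  refine ⟨PTile D, inferInstance, PTile.Horiz H V L B, PTile.Vert, starts, mids, ends,
    fun ps => ⟨?_, ?_⟩⟩
  · rintro ⟨z, h1, h2, h3⟩
    exact PTile.quarter_of_tiles h1 h2 hs hm he h3
  · rintro ⟨d, hd, hps⟩
    exact PTile.tiles_of_quarter hd hps hs hm he


open Turing

/-- The configuration reached after a number of steps, if any. -/
def run {σ : Type*} (f : σ → Option σ) (s : σ) : ℕ → Option σ
  | 0 => some s
  | n + 1 => (run f s n).bind f

theorem run_reaches {σ : Type*} {f : σ → Option σ} {s c : σ} {n : ℕ} (h : run f s n = some c) :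
    StateTransition.Reaches f s c := by
  induction n generalizing c with
  | zero => cases h; exact .refl
  | succ n ih =>
    obtain ⟨b, hb, hc⟩ := Option.bind_eq_some_iff.1 h
    exact (ih hb).tail hc

theorem not_dom_eval_iff {σ : Type*} (f : σ → Option σ) (s : σ) :
    ¬ (StateTransition.eval f s).Dom ↔ ∀ n, ∃ c, run f s n = some c := by
  constructor
  · intro h n
    induction n with
    | zero => exact ⟨s, rfl⟩
    | succ n ih =>
      obtain ⟨c, hc⟩ := ih
      rcases hf : f c with _ | b
      · exact absurd (Part.dom_iff_mem.2 ⟨c, StateTransition.mem_eval.2 ⟨run_reaches hc, hf⟩⟩) h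
      · exact ⟨b, by rw [run, hc]; exact hf⟩
  · intro h hd
    obtain ⟨b, hb'⟩ := Part.dom_iff_mem.1 hd
    obtain ⟨hr, hb⟩ := StateTransition.mem_eval.1 hb'
    have : ∃ n, run f s n = some b := by
      clear hb hb'
      induction hr with
      | refl => exact ⟨0, rfl⟩
      | tail _ hbc ih => obtain ⟨n, hn⟩ := ih; exact ⟨n + 1, by rw [run, hn]; exact hbc⟩
    obtain ⟨n, hn⟩ := this
    obtain ⟨c, hc⟩ := h (n + 1)
    rw [run, hn] at hc
    exact Option.some_ne_none c (hc.symm.trans hb)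

/-- A position of the folded space-time diagram of a Turing machine. -/
structure Square (Γ Λ : Type) where
  q : Λ
  h : Γ
  r : Γ
  l : Γ
  rp : Γ
  lp : Γ
  rm : Γ
  lm : Γ
  z : Bool
  e : Bool

namespace Square

variable {Γ Λ : Type}

instance [Finite Γ] [Finite Λ] : Finite (Square Γ Λ) :=
  Finite.of_injective
    (fun s : Square Γ Λ => (s.q, s.h, s.r, s.l, s.rp, s.lp, s.rm, s.lm, s.z, s.e)) <| by
      rintro ⟨⟩ ⟨⟩ h; simpa using h

/-- The horizontal rule. -/
structure Horiz (x y : Square Γ Λ) : Prop where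
  q : y.q = x.q
  h : y.h = x.h
  rp : x.rp = y.r
  lp : x.lp = y.l
  rm : y.rm = x.r
  lm : y.lm = x.l
  z : y.z = false
  e : x.e = true → y.e = true

/-- The rule at the left boundary. -/
structure Left (x : Square Γ Λ) : Prop where
  z : x.z = true
  h : x.h = x.r
  lm : x.lm = x.r
  rm : x.rm = x.l

variable [Inhabited Γ]

/-- The rule at the bottom. -/
structure Bottom (q : Λ) (x : Square Γ Λ) : Prop where
  q : x.q = q
  l : x.l = default
  e : x.e = true → x.r = default

/-- The effect of a statement. -/
def Act (x y : Square Γ Λ) : TM0.Stmt Γ → Prop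
  | .move .right => y.r = x.rp ∧ y.l = x.lm
  | .move .left => y.r = x.rm ∧ y.l = x.lp
  | .write s => y.r = (if x.z then s else x.r) ∧ y.l = x.l

/-- The vertical rule. -/
def Vert [Inhabited Λ] (M : TM0.Machine Γ Λ) {S : Set Λ} (x y : Square Γ S) : Prop :=
  ∃ s, M x.q x.h = some ((y.q : Λ), s) ∧ Act x y s

/-- The correct content of the square at a position. -/
structure Shows [Inhabited Λ] {S : Set Λ} (c : TM0.Cfg Γ Λ) (a : ℕ) (x : Square Γ S) : Prop where
  q : x.q = c.q
  r : x.r = c.Tape.nth a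
  l : x.l = c.Tape.nth (-1 - a)

/-- The prescribed content of the bottom row. -/
def Input (o : Option Γ) (x : Square Γ Λ) : Prop :=
  match o with
  | some s => x.r = s
  | none => x.e = true

end Square

open Square

variable {Γ Λ : Type} [Inhabited Γ] [Inhabited Λ]

theorem tape_mk₁_nth (l : List Γ) (a : ℕ) : (Tape.mk₁ l).nth a = l.getI a := by
  rw [Tape.mk₁, Tape.mk₂, Tape.mk'_nth_nat, ListBlank.nth_mk]

theorem tape_mk₁_nth_neg (l : List Γ) (a : ℕ) : (Tape.mk₁ l).nth (-1 - a) = default := by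
  have : (-1 - a : ℤ) = Int.negSucc a := by omega
  rw [this, Tape.mk₁, Tape.mk₂]
  simp [Tape.nth, Tape.mk', ListBlank.nth_mk]

theorem shows_of_quarter {M : TM0.Machine Γ Λ} {S : Set Λ} {q₀ : S} (hq₀ : (q₀ : Λ) = default)
    {d : ℕ → ℕ → Square Γ S} (hd : Quarter Horiz (Vert M) Left (Bottom q₀) d) {l : List Γ}
    (hl : ∀ a ≤ l.length, Input l[a]? (d a 0)) (n : ℕ) :
    ∃ c, run (TM0.step M) (TM0.init l) n = some c ∧ ∀ a, Shows c a (d a n) := by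
  have hq : ∀ b a, (d a b).q = (d 0 b).q := fun b a => by
    induction a with
    | zero => rfl
    | succ a ih => rw [(hd.horiz a b).q, ih]
  have hh : ∀ b a, (d a b).h = (d 0 b).h := fun b a => by
    induction a with
    | zero => rfl
    | succ a ih => rw [(hd.horiz a b).h, ih]
  induction n with
  | zero =>
    refine ⟨_, rfl, fun a => ⟨?_, ?_, ?_⟩⟩
    · rw [(hd.bottom a).q, hq₀]; rfl
    · rw [TM0.init, tape_mk₁_nth]
      rcases lt_or_ge a l.length with h | h
      · have := hl a h.le
        rw [List.getElem?_eq_getElem h] at this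
        rw [List.getI_eq_getElem _ h]
        exact this
      · rw [List.getI_eq_default _ h]
        refine (hd.bottom a).e ?_
        induction a, h using Nat.le_induction with
        | base =>
          have := hl _ le_rfl
          rw [List.getElem?_eq_none le_rfl] at this
          exact this
        | succ a _ ih => exact (hd.horiz a 0).e ih
    · rw [TM0.init, tape_mk₁_nth_neg]; exact (hd.bottom a).l
  | succ n ih =>
    obtain ⟨⟨q, T⟩, hc, hs⟩ := ih
    have hz : (d 0 n).z = true := (hd.left n).z
    have hz' : ∀ a, (d (a + 1) n).z = false := fun a => (hd.horiz a n).z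
    have h0 : T.head = (d 0 n).h := by rw [(hd.left n).h, (hs 0).r]; rfl
    have hrp : ∀ a, (d a n).rp = T.nth (a + 1) := fun a => by
      rw [(hd.horiz a n).rp, (hs _).r]; simp
    have hlp : ∀ a, (d a n).lp = T.nth (-1 - (a : ℤ) - 1) := fun a => by
      rw [(hd.horiz a n).lp, (hs _).l]; congr 1; push_cast; ring
    have hrm : ∀ a, (d a n).rm = T.nth (a - 1) := fun a => by
      rcases a with _ | a
      · rw [(hd.left n).rm, (hs 0).l]; rfl
      · rw [(hd.horiz a n).rm, (hs a).r]; congr 1; push_cast; ring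
    have hlm : ∀ a, (d a n).lm = T.nth (-1 - (a : ℤ) + 1) := fun a => by
      rcases a with _ | a
      · rw [(hd.left n).lm, (hs 0).r]; rfl
      · rw [(hd.horiz a n).lm, (hs a).l]; congr 1; push_cast; ring
    obtain ⟨s, h1, -⟩ := hd.vert 0 n
    have key : ∀ a, Act (d a n) (d a (n + 1)) s := fun a => by
      obtain ⟨s', h2, h3⟩ := hd.vert a n
      rw [hq, hh, h1] at h2
      have hs' : s = s' := (Prod.ext_iff.1 (Option.some.inj h2)).2
      rwa [hs']
    have hqq : q = (d 0 n).q := (hs 0).q.symm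
    have hstep : TM0.step M ⟨q, T⟩ = some ⟨(d 0 (n + 1)).q, match (motive := _ → Tape Γ) s with
        | TM0.Stmt.move d => T.move d
        | TM0.Stmt.write a => T.write a⟩ := by
      simp only [TM0.step, hqq, h0, h1, Option.map_some]
      cases s <;> rfl
    refine ⟨_, by rw [run, hc]; exact hstep, fun a => ⟨by rw [hq], ?_, ?_⟩⟩
    · have := key a
      rcases s with (_ | _) | s
      · exact this.1.trans ((hrm a).trans (Tape.move_left_nth _ _).symm)
      · exact this.1.trans ((hrp a).trans (Tape.move_right_nth _ _).symm)
      · refine this.1.trans ?_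
        rw [Tape.write_nth, (hs a).r]
        rcases a with _ | a
        · simp [hz]
        · rw [hz', if_neg (by simp), if_neg (by omega)]
    · have := key a
      rcases s with (_ | _) | s
      · exact this.2.trans ((hlp a).trans (Tape.move_left_nth _ _).symm)
      · exact this.2.trans ((hlm a).trans (Tape.move_right_nth _ _).symm)
      · refine this.2.trans ?_
        rw [Tape.write_nth, (hs a).l, if_neg (by omega)]

/-- The square showing a configuration at a position. -/
def ofCfg {S : Set Λ} (c : TM0.Cfg Γ Λ) (hc : c.q ∈ S) (a : ℕ) (e : Bool) : Square Γ S :=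
  ⟨⟨c.q, hc⟩, c.Tape.nth 0, c.Tape.nth a, c.Tape.nth (-1 - a), c.Tape.nth (a + 1),
    c.Tape.nth (-1 - a - 1), c.Tape.nth (a - 1), c.Tape.nth (-1 - a + 1), decide (a = 0), e⟩

theorem vert_ofCfg {M : TM0.Machine Γ Λ} {S : Set Λ} {c c' : TM0.Cfg Γ Λ}
    (h : TM0.step M c = some c') (hc : c.q ∈ S) (hc' : c'.q ∈ S) (a : ℕ) (e e' : Bool) :
    Vert M (ofCfg c hc a e) (ofCfg c' hc' a e') := by
  obtain ⟨q, T⟩ := c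
  obtain ⟨⟨q', s⟩, h1, rfl⟩ := Option.map_eq_some_iff.1 h
  refine ⟨s, h1, ?_⟩
  rcases s with (_ | _) | s
  · exact ⟨Tape.move_left_nth _ _, Tape.move_left_nth _ _⟩
  · exact ⟨Tape.move_right_nth _ _, Tape.move_right_nth _ _⟩
  · refine ⟨(Tape.write_nth _ _).trans ?_, (Tape.write_nth _ _).trans (if_neg (by omega))⟩
    simp [ofCfg]

theorem quarter_of_run {M : TM0.Machine Γ Λ} {S : Set Λ} (hS : TM0.Supports M S) {l : List Γ}
    (h : ∀ n, ∃ c, run (TM0.step M) (TM0.init l) n = some c) :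
    ∃ d, Quarter Horiz (Vert M) Left (Bottom (⟨default, hS.1⟩ : S)) d ∧
      ∀ a, a ≤ l.length → Input l[a]? (d a 0) := by
  choose c hc using h
  have h0 : c 0 = TM0.init l := (Option.some.inj (hc 0)).symm
  have hstep : ∀ n, TM0.step M (c n) = some (c (n + 1)) := fun n => by
    have := hc (n + 1); rwa [run, hc n] at this
  have hq : ∀ n, (c n).q ∈ S := fun n => by
    induction n with
    | zero => rw [h0]; exact hS.1
    | succ n ih => exact TM0.step_supports M hS (hstep n) ih
  refine ⟨fun a b => ofCfg (c b) (hq b) a (decide (b = 0 ∧ l.length ≤ a)),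
    ⟨fun a b => ?_, fun a b => ?_, fun b => ?_, fun a => ?_⟩, fun a ha => ?_⟩
  · refine ⟨rfl, rfl, ?_, ?_, ?_, ?_, ?_, ?_⟩
    · simp [ofCfg]
    · simp only [ofCfg]; congr 1; push_cast; ring
    · simp only [ofCfg]; congr 1; push_cast; ring
    · simp only [ofCfg]; congr 1; push_cast; ring
    · simp [ofCfg]
    · simp only [ofCfg, decide_eq_true_eq]; exact fun h => ⟨h.1, by omega⟩
  · exact vert_ofCfg (hstep b) _ _ _ _ _
  · exact ⟨rfl, rfl, rfl, rfl⟩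
  · refine ⟨Subtype.ext ?_, ?_, fun h => ?_⟩
    · change (c 0).q = _; rw [h0]; rfl
    · change (c 0).Tape.nth _ = _; rw [h0]; exact tape_mk₁_nth_neg l a
    · change (c 0).Tape.nth _ = _; rw [h0]
      refine (tape_mk₁_nth l a).trans (List.getI_eq_default _ ?_)
      simpa [ofCfg] using h
  · rcases ha.lt_or_eq with h | rfl
    · rw [List.getElem?_eq_getElem h]
      change (c 0).Tape.nth _ = _
      rw [h0, ← List.getI_eq_getElem _ h]
      exact tape_mk₁_nth l a
    · rw [List.getElem?_eq_none le_rfl]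
      simp [Input, ofCfg]

/-- Divergence of a Turing machine with finitely many relevant states is the existence of a
quarter plane avoiding some symbols in the bottom row. -/
theorem exists_quarter [Finite Γ] (M : TM0.Machine Γ Λ) {S : Set Λ} (hf : S.Finite)
    (hS : TM0.Supports M S) :
    ∃ (D : Type) (_ : Finite D) (H V : D → D → Prop) (L B : D → Prop) (bad : Option Γ → List D),
      ∀ l : List Γ, ¬ (TM0.eval M l).Dom ↔
        ∃ d, Quarter H V L B d ∧ ∀ a ≤ l.length, ∀ q ∈ bad l[a]?, d a 0 ≠ q := by
  have := hf.to_subtype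
  have key : ∀ o : Option Γ, ∃ L : List (Square Γ S), ∀ x, x ∈ L ↔ ¬ Input o x := fun o =>
    ⟨(Set.toFinite {x | ¬ Input o x}).toFinset.toList, by simp⟩
  choose bad hbad using key
  refine ⟨Square Γ S, inferInstance, Horiz, Vert M, Left, Bottom ⟨default, hS.1⟩, bad, fun l => ?_⟩
  have hpin : ∀ o x, (∀ q ∈ bad o, x ≠ q) ↔ Input o x := fun o x =>
    ⟨fun h => by_contra fun hx => h x ((hbad o x).2 hx) rfl,
      fun h q hq hx => (hbad o q).1 hq (hx ▸ h)⟩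
  simp only [hpin]
  change ¬ (StateTransition.eval (TM0.step M) (TM0.init l)).Dom ↔ _
  rw [not_dom_eval_iff]
  constructor
  · exact quarter_of_run hS
  · rintro ⟨d, hd, hl⟩ n
    obtain ⟨c, hc, -⟩ := shows_of_quarter rfl hd hl n
    exact ⟨c, hc⟩


open Turing

instance : Finite Turing.PartrecToTM2.K' :=
  Finite.of_surjective
    (fun i : Fin 4 => [PartrecToTM2.K'.main, .rev, .aux, .stack].get i) (by
      rintro (_ | _ | _ | _)
      exacts [⟨0, rfl⟩, ⟨1, rfl⟩, ⟨2, rfl⟩, ⟨3, rfl⟩])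

/-- The binary digits, most significant first, after an end marker. -/
def digits (n : ℕ) : List (Option Bool) :=
  none :: (Nat.bits n).reverse.map some

theorem trPosNum_eq (n : PosNum) : PartrecToTM2.trPosNum n =
    (Nat.bits (n : ℕ)).map fun b => cond b PartrecToTM2.Γ'.bit1 .bit0 := by
  induction n with
  | one => simp [PartrecToTM2.trPosNum]
  | bit1 n ih =>
    rw [PartrecToTM2.trPosNum, ih, PosNum.cast_bit1, ← two_mul, Nat.bit1_bits]; rfl
  | bit0 n ih =>
    rw [PartrecToTM2.trPosNum, ih, PosNum.cast_bit0, ← two_mul, Nat.bit0_bits]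
    · rfl
    · exact (PosNum.cast_pos n).ne'

theorem trNat_eq (n : ℕ) : PartrecToTM2.trNat n =
    (Nat.bits n).map fun b => cond b PartrecToTM2.Γ'.bit1 .bit0 := by
  have h : ((n : Num) : ℕ) = n := Num.to_of_nat n
  rw [PartrecToTM2.trNat]
  generalize (n : Num) = m at h
  subst h
  rcases m with _ | m
  · rfl
  · exact trPosNum_eq m

theorem exists_trInit_eq : ∃ γ : Option Bool → TM2to1.Γ' PartrecToTM2.K' fun _ => PartrecToTM2.Γ',
    ∀ n, TM2to1.trInit PartrecToTM2.K'.main (PartrecToTM2.trList [n]) = (digits n).map γ := by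
  refine ⟨fun o => o.elim (true, Function.update (fun _ => none) .main (some .cons)) fun b =>
    (false, Function.update (fun _ => none) .main (some (cond b .bit1 .bit0))), fun n => ?_⟩
  have h : PartrecToTM2.trList [n] =
      (Nat.bits n).map (fun b => cond b PartrecToTM2.Γ'.bit1 .bit0) ++ [.cons] := by
    rw [PartrecToTM2.trList, trNat_eq]; rfl
  have h' : (PartrecToTM2.trList [n]).reverse =
      .cons :: ((Nat.bits n).map fun b => cond b PartrecToTM2.Γ'.bit1 .bit0).reverse := by
    rw [h, List.reverse_append]; rfl
  rw [TM2to1.trInit, h', ← List.map_reverse]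
  refine congrArg (List.cons _) (List.map_map.trans ?_)
  rw [List.map_map]
  rfl

/-- A Turing machine whose halting problem is undecidable. -/
theorem exists_universal : ∃ (Γ Λ : Type) (_ : Inhabited Γ) (_ : Inhabited Λ) (_ : Finite Γ)
    (M : TM0.Machine Γ Λ) (S : Set Λ) (_ : S.Finite) (_ : TM0.Supports M S) (γ : Option Bool → Γ),
    ¬ ComputablePred fun n => ¬ (TM0.eval M ((digits n).map γ)).Dom := by
  classical
  have hf : Partrec fun m : ℕ => Nat.Partrec.Code.eval (Denumerable.ofNat Nat.Partrec.Code m) 0 :=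
    Nat.Partrec.Code.eval_part.comp (Computable.ofNat _) (Computable.const 0)
  obtain ⟨c, hc⟩ := ToPartrec.Code.exists_code (Nat.Partrec'.part_iff₁.2 hf)
  let _ : Inhabited PartrecToTM2.Λ' := ⟨PartrecToTM2.trNormal c .halt⟩
  obtain ⟨γ, hγ⟩ := exists_trInit_eq
  have : Fintype PartrecToTM2.K' := Fintype.ofFinite _
  let M₁ := TM2to1.tr (PartrecToTM2.tr)
  refine ⟨_, _, inferInstance, inferInstance, inferInstance, TM1to0.tr M₁, _, Finset.finite_toSet _,
    TM1to0.tr_supports _ (TM2to1.tr_supports _ (PartrecToTM2.tr_supports c .halt)), γ, fun h => ?_⟩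
  have key : ∀ n, (TM0.eval (TM1to0.tr M₁) ((digits n).map γ)).Dom ↔
      (Nat.Partrec.Code.eval (Denumerable.ofNat Nat.Partrec.Code n) 0).Dom := fun n => by
    rw [TM1to0.tr_eval, ← hγ]
    refine (TM2to1.tr_eval_dom _ _ _).trans ?_
    have h1 := PartrecToTM2.tr_eval c [n]
    have h2 : TM2.init .main (PartrecToTM2.trList [n]) = PartrecToTM2.init c [n] := by
      rw [TM2.init, PartrecToTM2.init]
      congr 1
      funext k
      rcases k <;> rfl
    change (StateTransition.eval (TM2.step PartrecToTM2.tr)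
      (TM2.init .main (PartrecToTM2.trList [n]))).Dom ↔ _
    rw [h2]
    have h3 := hc (n ::ᵥ .nil)
    rw [List.Vector.head_cons] at h3
    have h4 : c.eval [n] = _ := h3
    rw [h4] at h1
    refine (iff_of_eq (congrArg Part.Dom h1)).trans ?_
    simp
  refine ComputablePred.halting_problem 0 ?_
  refine ComputablePred.computable_of_manyOneReducible ⟨Encodable.encode, Computable.encode,
    fun c => ?_⟩ h.not
  rw [not_not, key, Denumerable.ofNat_encode]


theorem primrec_words {α : Type*} [Primcodable α] (L : List α) : Primrec (words L) := by
  have h : Primrec₂ fun (_ : ℕ) (W : List (List α)) => L.flatMap fun a => W.map (List.cons a) := by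
    refine Primrec.list_flatMap (Primrec.const L) ?_
    refine Primrec.list_map (Primrec.snd.comp Primrec.fst) ?_
    exact Primrec.list_cons.comp (Primrec.snd.comp Primrec.fst) Primrec.snd
  refine (Primrec.nat_rec₁ [[]] h).of_eq fun n => ?_
  induction n with
  | zero => rfl
  | succ n ih => rw [words, ← ih]

theorem primrec_pow (m : ℕ) : Primrec fun n : ℕ => m ^ n :=
  (Primrec.nat_rec₁ 1 (f := fun _ r => r * m)
    (Primrec.nat_mul.comp Primrec.snd (Primrec.const m))).of_eq fun n => by
      induction n with
      | zero => rfl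
      | succ n ih => rw [pow_succ, ← ih]

theorem bits_eq_cons {n : ℕ} (h : n ≠ 0) : n.bits = (n % 2 == 1) :: (n / 2).bits := by
  rcases Nat.even_or_odd' n with ⟨c, rfl | rfl⟩
  · rw [Nat.bit0_bits c (by omega)]; simp
  · rw [Nat.bit1_bits]
    have h1 : (2 * c + 1) / 2 = c := by omega
    have h2 : (2 * c + 1) % 2 = 1 := by omega
    rw [h1, h2]; rfl

theorem primrec_bits : Primrec Nat.bits := by
  have h : Primrec fun l : List (List Bool) =>
      if l.length = 0 then ([] : List Bool) else
        (l.length % 2 == 1) :: (l[l.length / 2]?.getD []) := by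
    refine Primrec.ite (Primrec.eq.comp Primrec.list_length (Primrec.const 0)) (Primrec.const []) ?_
    refine Primrec.list_cons.comp ?_ ?_
    · exact Primrec.beq.comp
        (Primrec.nat_mod.comp Primrec.list_length (Primrec.const 2)) (Primrec.const 1)
    · exact Primrec.option_getD.comp (Primrec.list_getElem?.comp Primrec.id
        (Primrec.nat_div.comp Primrec.list_length (Primrec.const 2))) (Primrec.const [])
  have h2 := Primrec.nat_strong_rec (fun (_ : Unit) n => Nat.bits n)
    (g := fun _ l => some (if l.length = 0 then ([] : List Bool) else
        (l.length % 2 == 1) :: (l[l.length / 2]?.getD [])))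
    (Primrec.option_some.comp (h.comp Primrec.snd)) (fun _ n => by
      rcases n with _ | n
      · rfl
      · have hn : (n + 1) / 2 < n + 1 := by omega
        simp only [List.length_map, List.length_range, Nat.succ_ne_zero, if_false,
          Option.some.injEq]
        rw [List.getElem?_map, List.getElem?_range hn, Option.map_some, Option.getD_some]
        exact (bits_eq_cons n.succ_ne_zero).symm)
  exact h2.comp (Primrec.const ()) Primrec.id

theorem primrec_digits : Primrec digits :=
  Primrec.list_cons.comp (Primrec.const none)
    (Primrec.list_map (Primrec.list_reverse.comp primrec_bits)
      (Primrec.option_some.comp Primrec.snd))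

theorem sandwich_map_flatMap {α β : Type*} (code : α → List β) (s m e : List α) (n : ℕ) :
    (sandwich s m e n).map (List.flatMap code) =
      (s.map code).flatMap fun a => (words (m.map code) n).flatMap fun w =>
        (e.map code).map fun b => a ++ (w.flatten ++ b) := by
  simp [sandwich, words_map, Function.comp_def, List.flatMap_def]

theorem Bad.not_computablePred {k : ℕ} {E : Fin k → Fin k → Prop} (Bd : Bad E) :
    ¬ ComputablePred fun F : List (List (Fin k)) =>
        (XHV (vertexShift E) {x | ∀ w ∈ F, ¬ occursIn1 w x}).Nonempty := by
  obtain ⟨Γ, Λ, _, _, _, M, S, hS, hM, γ, hγ⟩ := exists_universal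
  obtain ⟨D, _, H, V, L, B, bad, hbad⟩ := exists_quarter M hS hM
  obtain ⟨T, _, R, Vr, starts, mids, ends, hT⟩ := exists_plane H V L B
  obtain ⟨Fixed, code, hF⟩ := Bd.embed R Vr
  let st : Option (Option Bool) → List T := fun o => (bad (o.map γ)).flatMap starts
  let G : ℕ → List (List T) := fun n => (List.range ((digits n).length + 1)).flatMap fun a =>
    sandwich (st (digits n)[a]?) mids ends (2 ^ (a + 1) - 1)
  refine fun hc => hγ (ComputablePred.computable_of_manyOneReducible
    ⟨fun n => Fixed ++ (G n).map (List.flatMap code), Primrec.to_comp ?_, fun n => ?_⟩ hc)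
  · have h1 : ∀ n, (G n).map (List.flatMap code) =
        (List.range ((digits n).length + 1)).flatMap fun a =>
          ((st (digits n)[a]?).map code).flatMap fun u =>
            (words (mids.map code) (2 ^ (a + 1) - 1)).flatMap fun w =>
              (ends.map code).map fun b => u ++ (w.flatten ++ b) := fun n => by
      simp only [G, List.map_flatMap, sandwich_map_flatMap]
    simp only [h1]
    have hst : Primrec fun o => (st o).map code := Primrec.dom_finite _
    refine Primrec.list_append.comp (Primrec.const _) (Primrec.list_flatMap
      (Primrec.list_range.comp (Primrec.succ.comp (Primrec.list_length.comp primrec_digits))) ?_)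
    refine Primrec.list_flatMap (hst.comp (Primrec.list_getElem?.comp
      (primrec_digits.comp Primrec.fst) Primrec.snd)) ?_
    refine Primrec.list_flatMap ((primrec_words _).comp (Primrec.nat_sub.comp
      ((primrec_pow 2).comp (Primrec.succ.comp (Primrec.snd.comp Primrec.fst)))
      (Primrec.const 1))) ?_
    refine Primrec.list_map (Primrec.const _) ?_
    exact Primrec.list_append.comp (Primrec.snd.comp (Primrec.fst.comp Primrec.fst))
      (Primrec.list_append.comp (Primrec.list_flatten.comp (Primrec.snd.comp Primrec.fst))
        Primrec.snd)
  · refine (hbad _).trans (Iff.trans ?_ (hF (G n)))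
    let ps : List (ℕ × D) := (List.range ((digits n).length + 1)).flatMap fun a =>
      (bad ((digits n)[a]?.map γ)).map fun q => (a, q)
    have hG : G n = ps.flatMap fun q => sandwich (starts q.2) mids ends (2 ^ (q.1 + 1) - 1) := by
      simp only [G, st, ps, sandwich, List.flatMap_assoc, List.flatMap_map]
    rw [hG, hT]
    refine exists_congr fun d => and_congr_right fun _ => ?_
    simp only [ps, List.mem_flatMap, List.mem_range, List.mem_map, List.length_map,
      List.getElem?_map]
    constructor
    · rintro h _ ⟨a, ha, q, hq, rfl⟩
      exact h a (by omega) q hq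
    · intro h a ha q hq
      exact h (a, q) ⟨a, by omega, q, hq, rfl⟩


section Components

variable {A : Type} {E : A → A → Prop} {S : Set A}

theorem _root_.IsSCC.mem_iff (h : IsSCC E S) {a : A} (ha : a ∈ S) (c : A) :
    c ∈ S ↔ Relation.TransGen E a c ∧ Relation.TransGen E c a := by
  refine ⟨fun hc => ⟨h.2.1 a ha c hc, h.2.1 c hc a ha⟩, fun hc => ?_⟩
  have hT : {c | Relation.TransGen E a c ∧ Relation.TransGen E c a} = S :=
    h.2.2 _ (fun c hc => ⟨h.2.1 a ha c hc, h.2.1 c hc a ha⟩)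
      fun b hb c hc => hb.2.trans hc.1
  rw [← hT]; exact hc

theorem _root_.IsSCC.transGen_subtype (h : IsSCC E S) (a b : S) :
    Relation.TransGen (fun x y : S => E x y) a b := by
  have key : ∀ c : A, Relation.TransGen E c b → ∀ hc : c ∈ S,
      Relation.TransGen (fun x y : S => E x y) ⟨c, hc⟩ b := fun c hcb => by
    induction hcb using Relation.TransGen.head_induction_on with
    | single h1 => exact fun hc => .single h1
    | @head c d h1 h2 ih =>
      intro hc
      have hd : d ∈ S := (h.mem_iff hc d).2 ⟨.single h1, h2.trans (h.2.1 _ b.2 _ hc)⟩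
      exact Relation.TransGen.head (b := ⟨d, hd⟩) h1 (ih hd)
  exact key a (h.2.1 _ a.2 _ b.2) a.2

theorem _root_.IsSCC.exists_comp [Finite A] (h : IsSCC E S) :
    ∃ c : CyclicClasses (fun x y : S => E x y), ∃ C : Comp E, C =
      ⟨S, Subtype.val, Subtype.val_injective, c,
        fun x => (Relation.TransGen.head'_iff.1 (h.transGen_subtype x x)).imp fun _ h => h.1,
        fun x => (Relation.TransGen.tail'_iff.1 (h.transGen_subtype x x)).imp fun _ h => h.2⟩ := by
  have : Nonempty S := h.1.to_subtype
  obtain ⟨c⟩ := exists_cyclicClasses (fun x y : S => E x y) h.transGen_subtype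
  exact ⟨c, _, rfl⟩

theorem exists_bad_of_not_conditionD [Finite A] (hD : ¬ ConditionD E) : Nonempty (Bad E) := by
  classical
  simp only [ConditionD, not_or, not_forall] at hD
  obtain ⟨⟨S₁, h₁, hr⟩, ⟨S₂, h₂, hs⟩, ⟨S₃, h₃, ht⟩⟩ := hD
  obtain ⟨c₁, C₁, e₁⟩ := h₁.exists_comp
  obtain ⟨c₂, C₂, e₂⟩ := h₂.exists_comp
  obtain ⟨c₃, C₃, e₃⟩ := h₃.exists_comp
  have nonrefl : ∃ x, ¬ E (C₁.ι x) (C₁.ι x) := by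
    subst e₁
    simp only [ReflexiveType, not_forall] at hr
    obtain ⟨v, hv, hE⟩ := hr
    exact ⟨⟨v, hv⟩, hE⟩
  have nonsymm : ∃ x y, E (C₂.ι x) (C₂.ι y) ∧ ¬ E (C₂.ι y) (C₂.ι x) := by
    subst e₂
    simp only [SymmetricType, not_forall] at hs
    obtain ⟨v, hv, w, hw, _, hE, hE'⟩ := hs
    exact ⟨⟨v, hv⟩, ⟨w, hw⟩, hE, hE'⟩
  have nonsplit : ∃ x y, C₃.c.f y = C₃.c.f x + 1 ∧ ¬ E (C₃.ι x) (C₃.ι y) := by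
    by_contra! hcon
    have hsucc := C₃.succ
    subst e₃
    have : Nonempty S₃ := h₃.1.to_subtype
    obtain ⟨p, hp, f, hf, hE⟩ := CyclicClasses.exists_split c₃ hsucc hcon
    refine ht ⟨p, hp, fun a => if h : a ∈ S₃ then f ⟨a, h⟩ else 0, fun i => ?_, fun v hv w hw => ?_⟩
    · obtain ⟨v, hv⟩ := hf i
      exact ⟨v, v.2, by simp [hv]⟩
    · simp only [hv, hw, dif_pos]
      exact hE ⟨v, hv⟩ ⟨w, hw⟩
  have hpos : 1 ≤ C₁.c.p * C₂.c.p * C₃.c.p :=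
    Nat.mul_pos (Nat.mul_pos C₁.c.hp C₂.c.hp) C₃.c.hp
  have hle := Nat.mul_le_mul_right (2 * C₁.c.n0 + 2 * C₂.c.n0 + 2 * C₃.c.n0 + 4) hpos
  rw [one_mul] at hle
  exact ⟨⟨C₁, C₂, C₃, nonrefl, nonsymm, nonsplit,
    C₁.c.p * C₂.c.p * C₃.c.p * (2 * C₁.c.n0 + 2 * C₂.c.n0 + 2 * C₃.c.n0 + 4),
    by omega, by omega, by omega,
    Dvd.dvd.mul_right (Dvd.dvd.mul_right (Dvd.intro _ rfl) _) _,
    Dvd.dvd.mul_right (Dvd.dvd.mul_right (Dvd.intro_left _ rfl) _) _,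
    Dvd.dvd.mul_right (Dvd.intro_left _ rfl) _⟩⟩

end Components


section Strip

variable {A B : Type*}

/-- A window of length `N` without forbidden words. -/
def AvoidsUpTo {I : Type*} (π : I → B → A) (F : List (List A)) (N : ℕ) (v : ℕ → B) : Prop :=
  ∀ f ∈ F, ∀ i n, n + f.length ≤ N → ¬ ∀ t (h : t < f.length), π i (v (n + t)) = f[t]

theorem periodic_extension {w : ℕ → B} {a d L : ℕ} (hd : 0 < d)
    (h : ∀ t < L, w (a + t) = w (a + d + t)) (q : ℕ) (hq : q < d + L) :
    w (a + q % d) = w (a + q) := by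
  induction q using Nat.strong_induction_on with
  | _ q ih =>
    by_cases hqd : q < d
    · rw [Nat.mod_eq_of_lt hqd]
    · rw [Nat.mod_eq_sub_mod (by omega), ih (q - d) (by omega) (by omega), h _ (by omega)]
      congr 1; omega

theorem exists_avoiding_iff [Fintype B] {I : Type*} (π : I → B → A) (F : List (List A)) :
    (∃ s : ℤ → B, ∀ i, ∀ f ∈ F, ¬ occursIn1 f (fun l => π i (s l))) ↔
      ∃ v, AvoidsUpTo π F (Fintype.card B ^ F.flatten.length + F.flatten.length + 1) v := by
  set L := F.flatten.length with hL
  have hle : ∀ f ∈ F, f.length ≤ L := fun f hf => by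
    rw [hL, List.length_flatten]
    exact List.single_le_sum (by simp) _ (List.mem_map_of_mem hf)
  constructor
  · rintro ⟨s, hs⟩
    refine ⟨fun n => s n, fun f hf i n _ h => hs i f hf ⟨n, fun t ht => ?_⟩⟩
    simpa using h t ht
  · rintro ⟨v, hv⟩
    have hcard : Fintype.card (Fin L → B) < Fintype.card (Fin (Fintype.card B ^ L + 1)) := by
      simp
    obtain ⟨a, b, hne, hab⟩ := Fintype.exists_ne_map_eq_of_card_lt
      (fun (n : Fin (Fintype.card B ^ L + 1)) (t : Fin L) => v (n + t)) hcard
    wlog hlt : a < b generalizing a b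
    · exact this b a hne.symm hab.symm (lt_of_le_of_ne (not_lt.1 hlt) hne.symm)
    obtain ⟨d, hd⟩ := Nat.exists_eq_add_of_lt (Fin.lt_def.1 hlt)
    have hper := periodic_extension (w := v) (a := a) (d := d + 1) (L := L) d.succ_pos fun t ht => by
      have := congrFun hab ⟨t, ht⟩
      simp only at this
      rw [this, hd]; congr 1
    refine ⟨fun n => v (a + (n % (d + 1 : ℕ)).toNat), fun i f hf ⟨n, hn⟩ => ?_⟩
    have hf' := hle f hf
    have hr0 := Int.emod_nonneg n (b := ((d + 1 : ℕ) : ℤ)) (by omega)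
    have hr1 := Int.emod_lt_of_pos n (b := ((d + 1 : ℕ) : ℤ)) (by omega)
    obtain ⟨r, hr⟩ := Int.eq_ofNat_of_zero_le hr0
    have hb := b.2
    refine hv f hf i (a + r) (by omega) fun t ht => ?_
    have h1 := hn t ht
    have h2 : ((n + t) % ((d + 1 : ℕ) : ℤ)).toNat = (r + t) % (d + 1) := by
      rw [Int.add_emod, hr, ← Int.natCast_mod, ← Int.natCast_add, ← Int.natCast_mod,
        Int.toNat_natCast, Nat.add_mod_mod]
    simp only [h2] at h1
    rw [hper _ (by omega), ← add_assoc] at h1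
    exact h1

theorem exists_avoidsUpTo_iff {m : ℕ} {I : Type*} (π : I → Fin m → A) (F : List (List A)) {N : ℕ}
    (hN : 0 < N) :
    (∃ v, AvoidsUpTo π F N v) ↔ ∃ w ∈ words (List.finRange m) N, ∀ f ∈ F, ∀ i,
      ∀ n < w.length + 1, ((w.map (π i)).drop n).take f.length ≠ f := by
  constructor
  · rintro ⟨v, hv⟩
    refine ⟨(List.range N).map v, mem_words.2 ⟨by simp, by simp⟩, fun f hf i n hn h => ?_⟩
    have hlen := congrArg List.length h
    simp only [List.length_take, List.length_drop, List.length_map, List.length_range] at hlen hn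
    refine hv f hf i n (by omega) fun t ht => ?_
    have := congrArg (fun l => l[t]?) h
    simp only [List.getElem?_take, if_pos ht, List.getElem?_drop, List.getElem?_map,
      List.getElem?_range (show n + t < N by omega), Option.map_some,
      List.getElem?_eq_getElem ht, Option.some.injEq] at this
    exact this
  · rintro ⟨w, hw, h⟩
    have hlen := (mem_words.1 hw).1
    have h0 : 0 < w.length := by omega
    refine ⟨fun n => w.getD n w[0], fun f hf i n hn hv => h f hf i n (by omega) ?_⟩
    refine List.ext_getElem (by simp; omega) fun t h1 h2 => ?_
    have := hv t h2
    simp only [List.getD_eq_getElem w w[0] (show n + t < w.length by omega)] at this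
    simpa using this

theorem primrecPred_exists_avoiding {k m P : ℕ} (π : Fin P → Fin m → Fin k) :
    PrimrecPred fun F : List (List (Fin k)) =>
      ∃ s : ℤ → Fin m, ∀ i, ∀ f ∈ F, ¬ occursIn1 f (fun l => π i (s l)) := by
  have hπ : Primrec₂ π := Primrec.dom_finite _
  have h1 : PrimrecRel fun (n : ℕ) (q : (Fin P × List (Fin k)) × List (Fin m)) =>
      ((q.2.map (π q.1.1)).drop n).take q.1.2.length ≠ q.1.2 := by
    refine PrimrecPred.not (Primrec.eq.comp ?_ (Primrec.snd.comp (Primrec.fst.comp Primrec.snd)))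
    refine Primrec.list_take.comp (Primrec.list_length.comp
      (Primrec.snd.comp (Primrec.fst.comp Primrec.snd))) ?_
    refine Primrec.list_drop.comp Primrec.fst ?_
    refine Primrec.list_map (Primrec.snd.comp Primrec.snd) ?_
    exact hπ.comp (Primrec.fst.comp (Primrec.fst.comp (Primrec.snd.comp Primrec.fst))) Primrec.snd
  have h1' : PrimrecRel fun (N : ℕ) (q : (Fin P × List (Fin k)) × List (Fin m)) =>
      ∀ n < N, ((q.2.map (π q.1.1)).drop n).take q.1.2.length ≠ q.1.2 :=
    (h1.forall_mem_list.comp (Primrec.list_range.comp Primrec.fst) Primrec.snd).of_eq (by simp)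
  have h2 : PrimrecRel fun (i : Fin P) (q : List (Fin k) × List (Fin m)) =>
      ∀ n < q.2.length + 1, ((q.2.map (π i)).drop n).take q.1.length ≠ q.1 :=
    h1'.comp (Primrec.succ.comp (Primrec.list_length.comp (Primrec.snd.comp Primrec.snd)))
      (Primrec.pair (Primrec.pair Primrec.fst (Primrec.fst.comp Primrec.snd))
        (Primrec.snd.comp Primrec.snd))
  have h3 : PrimrecRel fun (f : List (Fin k)) (w : List (Fin m)) =>
      ∀ i ∈ List.finRange P, ∀ n < w.length + 1, ((w.map (π i)).drop n).take f.length ≠ f :=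
    h2.forall_mem_list.comp (Primrec.const _) Primrec.id
  have h4 : PrimrecRel fun (w : List (Fin m)) (F : List (List (Fin k))) => ∀ f ∈ F,
      ∀ i ∈ List.finRange P, ∀ n < w.length + 1, ((w.map (π i)).drop n).take f.length ≠ f :=
    h3.forall_mem_list.comp Primrec.snd Primrec.fst
  have hlen : Primrec fun F : List (List (Fin k)) => F.flatten.length :=
    Primrec.list_length.comp Primrec.list_flatten
  have h5 := h4.exists_mem_list.comp ((primrec_words (List.finRange m)).comp (Primrec.succ.comp
    (Primrec.nat_add.comp ((primrec_pow m).comp hlen) hlen))) Primrec.id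
  refine h5.of_eq fun F => ?_
  rw [exists_avoiding_iff, Fintype.card_fin, exists_avoidsUpTo_iff _ _ (Nat.succ_pos _)]
  simp

end Strip

section Periodic

variable {A : Type} {E : A → A → Prop}

theorem transGen_of_mem_vertexShift {z : ℤ → A} (hz : z ∈ vertexShift E) {i j : ℤ} (h : i < j) :
    Relation.TransGen E (z i) (z j) := by
  obtain ⟨d, rfl⟩ : ∃ d : ℕ, j = i + d + 1 := ⟨(j - i - 1).toNat, by omega⟩
  clear h
  induction d with
  | zero => simpa using Relation.TransGen.single (hz i)
  | succ d ih =>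
    refine ih.tail ?_
    have := hz (i + d + 1)
    push_cast
    rwa [show i + ((d : ℤ) + 1) + 1 = i + d + 1 + 1 by ring]

theorem exists_recurrent [Finite A] {F : List (List A)}
    (h : (XHV (vertexShift E) {x | ∀ w ∈ F, ¬ occursIn1 w x}).Nonempty) :
    ∃ y ∈ XHV (vertexShift E) {x | ∀ w ∈ F, ¬ occursIn1 w x},
      ∀ i i' j, Relation.TransGen E (y (i, j)) (y (i', j)) := by
  obtain ⟨x, hx⟩ := h
  have key : ∀ p : ℤ × ℤ, ∃ a, ∀ᶠ n : ℕ in Filter.hyperfilter ℕ, x (p.1 + n, p.2) = a := fun p => by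
    obtain ⟨a, ha⟩ := Ultrafilter.eq_pure_of_finite
      ((Filter.hyperfilter ℕ).map fun n : ℕ => x (p.1 + n, p.2))
    refine ⟨a, ?_⟩
    have : {a} ∈ (Filter.hyperfilter ℕ).map fun n : ℕ => x (p.1 + n, p.2) := by
      rw [ha]; exact Ultrafilter.mem_pure.2 rfl
    exact this
  choose y hy using key
  refine ⟨y, ⟨fun j i => ?_, fun i w hw ⟨l, hl⟩ => ?_⟩, fun i i' j => ?_⟩
  · obtain ⟨n, h1, h2⟩ := ((hy (i, j)).and (hy (i + 1, j))).exists
    simp only at h1 h2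
    change E (y (i, j)) (y (i + 1, j))
    rw [← h1, ← h2, add_right_comm]
    exact hx.1 j (i + n)
  · have hall : ∀ᶠ n : ℕ in Filter.hyperfilter ℕ, ∀ t : Fin w.length,
        x (i + n, l + (t : ℕ)) = y (i, l + (t : ℕ)) :=
      Filter.eventually_all.2 fun t => hy (i, l + (t : ℕ))
    obtain ⟨n, hn⟩ := hall.exists
    exact hx.2 (i + n) w hw ⟨l, fun t ht => (hn ⟨t, ht⟩).trans (hl t ht)⟩
  · obtain ⟨n, hn⟩ := (hy (i, j)).exists
    have hlarge : ∀ᶠ n' : ℕ in Filter.hyperfilter ℕ, (i + n - i').toNat < n' :=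
      Filter.hyperfilter_le_cofinite (by
        rw [Nat.cofinite_eq_atTop]; exact Filter.eventually_gt_atTop _)
    obtain ⟨n', h1, h2⟩ := ((hy (i', j)).and hlarge).exists
    simp only at hn h1
    rw [← hn, ← h1]
    exact transGen_of_mem_vertexShift (hx.1 j) (by omega)

theorem isSCC_of_recurrent {y : ℤ × ℤ → A} {j : ℤ}
    (h : ∀ i i', Relation.TransGen E (y (i, j)) (y (i', j))) :
    ∃ S, IsSCC E S ∧ ∀ i, y (i, j) ∈ S := by
  refine ⟨{c | Relation.TransGen E (y (0, j)) c ∧ Relation.TransGen E c (y (0, j))},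
    ⟨⟨y (0, j), h 0 0, h 0 0⟩, fun a ha b hb => ha.2.trans hb.1, fun T hT hT' => ?_⟩,
    fun i => ⟨h 0 i, h i 0⟩⟩
  refine Set.Subset.antisymm (fun c hc => ?_) hT
  have h0 : y (0, j) ∈ T := hT ⟨h 0 0, h 0 0⟩
  exact ⟨hT' _ h0 _ hc, hT' _ hc _ h0⟩

theorem exists_period_of_conditionD [Finite A] (hD : ConditionD E) :
    ∃ P : ℕ, ∀ y : ℤ → A, y ∈ vertexShift E → (∃ S, IsSCC E S ∧ ∀ i, y i ∈ S) →
      ∀ i : ZMod (P + 1), E (y i.val) (y (i + 1).val) := by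
  rcases hD with hD | hD | hD
  · refine ⟨0, fun y _ ⟨S, hS, hyS⟩ i => ?_⟩
    rw [show i + 1 = i from Subsingleton.elim (α := Fin 1) _ _]
    exact hD S hS _ (hyS _)
  · refine ⟨1, fun y hy ⟨S, hS, hyS⟩ i => ?_⟩
    have h01 := hy 0
    have h10 : E (y 1) (y 0) := by
      by_cases he : y 0 = y 1
      · simpa [he] using h01
      · exact hD S hS _ (hyS _) _ (hyS _) he h01
    fin_cases i
    · exact h01
    · exact h10
  · obtain ⟨P, hP⟩ := Nat.exists_eq_succ_of_ne_zero (Nat.card A).factorial_ne_zero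
    refine ⟨P, fun y hy ⟨S, hS, hyS⟩ i => ?_⟩
    obtain ⟨p, hp, f, hf, hE⟩ := hD S hS
    have hpA : p ≤ Nat.card A := by
      have : NeZero p := ⟨hp.ne'⟩
      have hs : Function.Surjective f := fun i => (hf i).imp fun _ h => h.2
      simpa using Nat.card_le_card_of_surjective f hs
    have hpP : p ∣ P + 1 := by
      rw [Nat.succ_eq_add_one] at hP
      rw [← hP]; exact Nat.dvd_factorial hp hpA
    have hfy : ∀ n : ℕ, f (y n) = f (y 0) + n := fun n => by
      induction n with
      | zero => simp
      | succ n ih =>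
        have := (hE _ (hyS n) _ (hyS (n + 1))).1 (hy n)
        push_cast
        rw [this, ih]; ring
    rw [hE _ (hyS _) _ (hyS _), hfy, hfy, ZMod.natCast_val, ZMod.natCast_val,
      ZMod.cast_add hpP, ZMod.cast_one hpP]
    ring

theorem exists_period_nonempty_iff [Finite A] (hD : ConditionD E) :
    ∃ P : ℕ, ∀ F : List (List A),
      (XHV (vertexShift E) {x | ∀ w ∈ F, ¬ occursIn1 w x}).Nonempty ↔
      ∃ s : ℤ → {σ : ZMod (P + 1) → A // ∀ i, E (σ i) (σ (i + 1))},
        ∀ i, ∀ f ∈ F, ¬ occursIn1 f (fun l => (s l).1 i) := by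
  obtain ⟨P, hP⟩ := exists_period_of_conditionD hD
  refine ⟨P, fun F => ⟨fun h => ?_, fun ⟨s, hs⟩ => ?_⟩⟩
  · obtain ⟨y, hy, hrec⟩ := exists_recurrent h
    exact ⟨fun j => ⟨fun i => y (i.val, j), hP (fun i => y (i, j)) (hy.1 j)
      (isSCC_of_recurrent fun i i' => hrec i i' j)⟩, fun i f hf => hy.2 i.val f hf⟩
  · refine ⟨fun p => (s p.2).1 p.1, fun j i => ?_, fun i => hs i⟩
    have := (s j).2 i
    simp only [Int.cast_add, Int.cast_one]
    exact this

theorem computablePred_of_conditionD {k : ℕ} {E : Fin k → Fin k → Prop} (hD : ConditionD E) :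
    ComputablePred fun F : List (List (Fin k)) =>
      (XHV (vertexShift E) {x | ∀ w ∈ F, ¬ occursIn1 w x}).Nonempty := by
  obtain ⟨P, hP⟩ := exists_period_nonempty_iff hD
  obtain ⟨m, ⟨e⟩⟩ := Finite.exists_equiv_fin {σ : ZMod (P + 1) → Fin k // ∀ i, E (σ i) (σ (i + 1))}
  refine (primrecPred_exists_avoiding fun (i : Fin (P + 1)) (b : Fin m) =>
    (e.symm b).1 i).computablePred.of_eq fun F => ?_
  rw [hP F]
  refine ⟨fun ⟨s, hs⟩ => ⟨fun l => e.symm (s l), hs⟩, fun ⟨s, hs⟩ => ⟨fun l => e (s l), ?_⟩⟩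
  simp only [Equiv.symm_apply_apply]
  exact hs

end Periodic

end CombinedSubshift

/-- nonemptiness of `X_{H,V}`, as a predicate on finite sets of forbidden
words encoding `V` (over a primcodable type), is a `ComputablePred` iff the Rauzy graph of
`H` satisfies condition D. -/
theorem stmt12 {k : ℕ} (E : Fin k → Fin k → Prop)
    (hout : ∀ a, ∃ b, E a b) (hin : ∀ a, ∃ b, E b a) :
    ComputablePred (fun F : List (List (Fin k)) =>
        (XHV (vertexShift E) {x | ∀ w ∈ F, ¬ occursIn1 w x}).Nonempty) ↔
      ConditionD E := by
  refine ⟨fun hc => by_contra fun h => ?_, CombinedSubshift.computablePred_of_conditionD⟩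
  obtain ⟨Bd⟩ := CombinedSubshift.exists_bad_of_not_conditionD h
  exact Bd.not_computablePred hc
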